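/- Let n ∈ {2,3,4}, let Ω ⊆ ℝⁿ be a bounded smooth domain which is convex in case n ∈ {3,4}, and let g : ℝ → ℝ be a C¹ nondecreasing function with g(0) > 0 and g(s)/s → +∞ as s → +∞. Let (λ_k) be a nondecreasing sequence of positive reals converging to λ* > 0, and for each k let u_k be a classical semi-stable solution of −Δu = λ_k g(u) in Ω with u_k = 0 on ∂Ω and u_k > 0 in Ω, with u_k ≤ u_{k+1} in Ω for every k. Suppose u* ∈ L¹(Ω) is a weak solution of −Δu = λ* g(u) in Ω, u = 0 on ∂Ω, and u_k → u* in L¹(Ω). Then u* ∈ L∞(Ω), i.e. there is M such that |u*(x)| ≤ M for a.e. x ∈ Ω. -/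

import Mathlib

open MeasureTheory Filter

noncomputable section

/-- The Euclidean Laplacian: trace of the Hessian. -/
def lapl {n : ℕ} (u : EuclideanSpace ℝ (Fin n) → ℝ) (x : EuclideanSpace ℝ (Fin n)) : ℝ :=
  ∑ i : Fin n, fderiv ℝ (fun y => fderiv ℝ u y (EuclideanSpace.single i 1)) x
    (EuclideanSpace.single i 1)

/-- Entries of the Hessian matrix. -/
def hess {n : ℕ} (u : EuclideanSpace ℝ (Fin n) → ℝ) (x : EuclideanSpace ℝ (Fin n))
    (i j : Fin n) : ℝ :=
  fderiv ℝ (fun y => fderiv ℝ u y (EuclideanSpace.single j 1)) x (EuclideanSpace.single i 1)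

/-- A bounded smooth domain of ℝⁿ. -/
def IsSmoothBoundedDomain {n : ℕ} (Ω : Set (EuclideanSpace ℝ (Fin n))) : Prop :=
  IsOpen Ω ∧ Bornology.IsBounded Ω ∧ Ω.Nonempty ∧
  ∃ ρ : EuclideanSpace ℝ (Fin n) → ℝ, ContDiff ℝ (⊤ : ℕ∞) ρ ∧
    Ω = {x | ρ x < 0} ∧ frontier Ω = {x | ρ x = 0} ∧
    ∀ x ∈ frontier Ω, gradient ρ x ≠ 0

/-- Classical solution of −Δu = f(u) in Ω, u = 0 on ∂Ω. -/
def IsClassicalSol {n : ℕ} (Ω : Set (EuclideanSpace ℝ (Fin n))) (f : ℝ → ℝ)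
    (u : EuclideanSpace ℝ (Fin n) → ℝ) : Prop :=
  (∃ U, IsOpen U ∧ closure Ω ⊆ U ∧ ContDiffOn ℝ 2 u U) ∧
  (∀ x ∈ Ω, lapl u x + f (u x) = 0) ∧
  (∀ x ∈ frontier Ω, u x = 0)

/-- Semi-stability of a solution u. -/
def IsSemiStable {n : ℕ} (Ω : Set (EuclideanSpace ℝ (Fin n))) (f : ℝ → ℝ)
    (u : EuclideanSpace ℝ (Fin n) → ℝ) : Prop :=
  ∀ ξ : EuclideanSpace ℝ (Fin n) → ℝ, (∃ K : NNReal, LipschitzWith K ξ) →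
    (∀ x ∈ frontier Ω, ξ x = 0) →
    0 ≤ ∫ x in Ω, (‖gradient ξ x‖ ^ 2 - deriv f (u x) * ξ x ^ 2)

/-- Weak solution of −Δu = f(u) in Ω, u = 0 on ∂Ω. -/
def IsWeakSol {n : ℕ} (Ω : Set (EuclideanSpace ℝ (Fin n))) (f : ℝ → ℝ)
    (u : EuclideanSpace ℝ (Fin n) → ℝ) : Prop :=
  IntegrableOn u Ω volume ∧
  IntegrableOn (fun x => f (u x) * Metric.infDist x (frontier Ω)) Ω volume ∧
  ∀ ξ : EuclideanSpace ℝ (Fin n) → ℝ,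
    (∃ U, IsOpen U ∧ closure Ω ⊆ U ∧ ContDiffOn ℝ 2 ξ U) →
    (∀ x ∈ frontier Ω, ξ x = 0) →
    ∫ x in Ω, (u x * lapl ξ x + f (u x) * ξ x) = 0

abbrev Euc (n : ℕ) := EuclideanSpace ℝ (Fin n)

/-- The `i`-th partial derivative. -/
def pd {n : ℕ} (i : Fin n) (u : Euc n → ℝ) (x : Euc n) : ℝ :=
  fderiv ℝ u x (EuclideanSpace.single i 1)

section PartialDerivatives

variable {n : ℕ} {u v : Euc n → ℝ} {x : Euc n}

lemma lapl_eq_sum_pd (u : Euc n → ℝ) (x : Euc n) : lapl u x = ∑ i, pd i (pd i u) x := rfl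

lemma pd_congr (h : u =ᶠ[nhds x] v) (i : Fin n) : pd i u x = pd i v x := by
  simp only [pd, h.fderiv_eq]

lemma pd_eventuallyEq (h : u =ᶠ[nhds x] v) (i : Fin n) : pd i u =ᶠ[nhds x] pd i v := by
  filter_upwards [h.eventuallyEq_nhds] with y hy using pd_congr hy i

lemma lapl_congr (h : u =ᶠ[nhds x] v) : lapl u x = lapl v x := by
  simp only [lapl_eq_sum_pd]
  exact Finset.sum_congr rfl fun i _ => pd_congr (pd_eventuallyEq h i) i

lemma pd_add (hu : DifferentiableAt ℝ u x) (hv : DifferentiableAt ℝ v x) (i : Fin n) :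
    pd i (fun y => u y + v y) x = pd i u x + pd i v x := by
  simp [pd, fderiv_fun_add hu hv]

lemma pd_sub (hu : DifferentiableAt ℝ u x) (hv : DifferentiableAt ℝ v x) (i : Fin n) :
    pd i (fun y => u y - v y) x = pd i u x - pd i v x := by
  simp [pd, fderiv_fun_sub hu hv]

lemma pd_mul (hu : DifferentiableAt ℝ u x) (hv : DifferentiableAt ℝ v x) (i : Fin n) :
    pd i (fun y => u y * v y) x = pd i u x * v x + u x * pd i v x := by
  simp [pd, fderiv_fun_mul hu hv]; ring

lemma pd_const (c : ℝ) (i : Fin n) : pd i (fun _ : Euc n => c) x = 0 := by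
  simp [pd]

lemma pd_const_mul (hu : DifferentiableAt ℝ u x) (c : ℝ) (i : Fin n) :
    pd i (fun y => c * u y) x = c * pd i u x := by
  rw [pd_mul (by fun_prop) hu, pd_const]; ring

lemma pd_sum {ι : Type*} (s : Finset ι) {w : ι → Euc n → ℝ}
    (hw : ∀ k ∈ s, DifferentiableAt ℝ (w k) x) (i : Fin n) :
    pd i (fun y => ∑ k ∈ s, w k y) x = ∑ k ∈ s, pd i (w k) x := by
  simp only [pd]
  rw [fderiv_fun_sum hw]
  simp

lemma pd_comp {F : ℝ → ℝ} {F' : ℝ} (hF : HasDerivAt F F' (u x)) (hu : DifferentiableAt ℝ u x)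
    (i : Fin n) : pd i (fun y => F (u y)) x = F' * pd i u x := by
  have := hF.comp_hasFDerivAt x hu.hasFDerivAt
  simp only [pd]
  rw [show (fun y => F (u y)) = F ∘ u from rfl, this.fderiv]
  simp

lemma pd_coord (i j : Fin n) : pd i (fun y : Euc n => y j) x = if i = j then 1 else 0 := by
  have h : HasFDerivAt (fun y : Euc n => y j) (EuclideanSpace.proj j : Euc n →L[ℝ] ℝ) x :=
    (EuclideanSpace.proj j : Euc n →L[ℝ] ℝ).hasFDerivAt
  simp only [pd, h.fderiv]
  simp [eq_comm]

lemma sum_smul_single (v : Euc n) : ∑ i, v i • EuclideanSpace.single i (1 : ℝ) = v := by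
  ext j
  simp [Pi.single_apply]

lemma fderiv_apply_eq_sum (u : Euc n → ℝ) (x v : Euc n) :
    fderiv ℝ u x v = ∑ i, v i * pd i u x := by
  conv_lhs => rw [← sum_smul_single v]
  simp [pd]

lemma contDiffAt_pd {m k : WithTop ℕ∞} (hu : ContDiffAt ℝ m u x) (hk : k + 1 ≤ m) (i : Fin n) :
    ContDiffAt ℝ k (pd i u) x :=
  (hu.fderiv_right hk).clm_apply contDiffAt_const

lemma contDiff_pd {m k : WithTop ℕ∞} (hu : ContDiff ℝ m u) (hk : k + 1 ≤ m) (i : Fin n) :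
    ContDiff ℝ k (pd i u) :=
  contDiff_iff_contDiffAt.2 fun _ => contDiffAt_pd hu.contDiffAt hk i

lemma pd_comm (hu : ContDiffAt ℝ 2 u x) (i j : Fin n) : pd i (pd j u) x = pd j (pd i u) x := by
  have h := (hu.isSymmSndFDerivAt (by simp)) (EuclideanSpace.single i 1) (EuclideanSpace.single j 1)
  have hd : DifferentiableAt ℝ (fderiv ℝ u) x :=
    (hu.fderiv_right (m := 1) (by norm_num)).differentiableAt (by norm_num)
  have key : ∀ a b : Fin n, pd a (pd b u) x
      = fderiv ℝ (fderiv ℝ u) x (EuclideanSpace.single a 1) (EuclideanSpace.single b 1) := by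
    intro a b
    simp only [pd, show pd b u = fun y => fderiv ℝ u y (EuclideanSpace.single b 1) from rfl]
    rw [fderiv_clm_apply hd (by fun_prop)]
    simp
  rw [key, key, h]

lemma eventually_contDiffAt_two (hu : ContDiffAt ℝ 2 u x) : ∀ᶠ y in nhds x, ContDiffAt ℝ 2 u y :=
  hu.eventually (by simp)

lemma eventually_differentiableAt (hu : ContDiffAt ℝ 2 u x) :
    ∀ᶠ y in nhds x, DifferentiableAt ℝ u y :=
  (eventually_contDiffAt_two hu).mono fun _ h => h.differentiableAt (by norm_num)

lemma differentiableAt_pd (hu : ContDiffAt ℝ 2 u x) (i : Fin n) : DifferentiableAt ℝ (pd i u) x :=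
  (contDiffAt_pd (k := 1) hu (by norm_num) i).differentiableAt (by norm_num)

lemma lapl_sub (hu : ContDiffAt ℝ 2 u x) (hv : ContDiffAt ℝ 2 v x) :
    lapl (fun y => u y - v y) x = lapl u x - lapl v x := by
  simp only [lapl_eq_sum_pd, ← Finset.sum_sub_distrib]
  refine Finset.sum_congr rfl fun i _ => ?_
  rw [← pd_sub (differentiableAt_pd hu i) (differentiableAt_pd hv i)]
  apply pd_congr
  filter_upwards [eventually_differentiableAt hu, eventually_differentiableAt hv] with y h1 h2
  exact pd_sub h1 h2 i

lemma lapl_const_mul (hu : ContDiffAt ℝ 2 u x) (c : ℝ) :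
    lapl (fun y => c * u y) x = c * lapl u x := by
  simp only [lapl_eq_sum_pd, Finset.mul_sum]
  refine Finset.sum_congr rfl fun i _ => ?_
  rw [← pd_const_mul (differentiableAt_pd hu i)]
  apply pd_congr
  filter_upwards [eventually_differentiableAt hu] with y h1
  exact pd_const_mul h1 c i

/-- Chain rule for the partial derivatives of a composition. -/
lemma pd_comp_map {φ : Euc n → Euc n} (hu : DifferentiableAt ℝ u (φ x))
    (hφ : DifferentiableAt ℝ φ x) (i : Fin n) :
    pd i (fun y => u (φ y)) x = ∑ j, pd j u (φ x) * pd i (fun y => φ y j) x := by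
  have h := hu.hasFDerivAt.comp x hφ.hasFDerivAt
  have hj : ∀ j, pd i (fun y => φ y j) x = (fderiv ℝ φ x (EuclideanSpace.single i 1)) j := by
    intro j
    have := ((EuclideanSpace.proj j : Euc n →L[ℝ] ℝ).hasFDerivAt.comp x hφ.hasFDerivAt)
    simp only [pd]
    rw [show (fun y => φ y j) = (EuclideanSpace.proj j : Euc n →L[ℝ] ℝ) ∘ φ from rfl, this.fderiv]
    simp
  simp only [hj]
  rw [show pd i (fun y => u (φ y)) x = fderiv ℝ (u ∘ φ) x (EuclideanSpace.single i 1) from rfl,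
    h.fderiv]
  simp only [ContinuousLinearMap.comp_apply]
  rw [fderiv_apply_eq_sum]
  exact Finset.sum_congr rfl fun j _ => mul_comm _ _

/-- The Laplacian of `u ∘ φ` for a conformal map `φ` with harmonic components. -/
lemma lapl_comp_conformal {φ : Euc n → Euc n} {μ : ℝ} (hu : ContDiffAt ℝ 2 u (φ x))
    (hφ : ContDiffAt ℝ 2 φ x)
    (hconf : ∀ j k, ∑ i, pd i (fun y => φ y j) x * pd i (fun y => φ y k) x
      = if j = k then μ else 0)
    (hharm : ∀ j, lapl (fun y => φ y j) x = 0) :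
    lapl (fun y => u (φ y)) x = μ * lapl u (φ x) := by
  have hφj : ∀ j, ContDiffAt ℝ 2 (fun y => φ y j) x := fun j =>
    (EuclideanSpace.proj j : Euc n →L[ℝ] ℝ).contDiff.contDiffAt.comp x hφ
  have hcont := hφ.continuousAt
  have hφd : DifferentiableAt ℝ φ x := hφ.differentiableAt (by norm_num)
  have hstep : ∀ i, pd i (pd i (fun y => u (φ y))) x
      = ∑ j, ((∑ k, pd k (pd j u) (φ x) * pd i (fun y => φ y k) x) * pd i (fun y => φ y j) x
        + pd j u (φ x) * pd i (pd i (fun y => φ y j)) x) := by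
    intro i
    have h1 : pd i (fun y => u (φ y)) =ᶠ[nhds x]
        fun y => ∑ j, pd j u (φ y) * pd i (fun y => φ y j) y := by
      have e1 := hcont.eventually (eventually_differentiableAt hu)
      have e2 : ∀ᶠ y in nhds x, DifferentiableAt ℝ φ y :=
        (hφ.eventually (by simp)).mono fun _ h => h.differentiableAt (by norm_num)
      filter_upwards [e1, e2] with y hy1 hy2 using pd_comp_map hy1 hy2 i
    have hd1 : ∀ j, DifferentiableAt ℝ (fun y => pd j u (φ y)) x := fun j =>
      (differentiableAt_pd hu j).comp x hφd
    rw [pd_congr h1, pd_sum]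
    · refine Finset.sum_congr rfl fun j _ => ?_
      rw [pd_mul (hd1 j) (differentiableAt_pd (hφj j) i),
        pd_comp_map (differentiableAt_pd hu j) hφd]
    · intro j _
      exact (hd1 j).mul (differentiableAt_pd (hφj j) i)
  simp only [lapl_eq_sum_pd, hstep, Finset.sum_add_distrib]
  have hA : ∑ i, ∑ j, (∑ k, pd k (pd j u) (φ x) * pd i (fun y => φ y k) x)
      * pd i (fun y => φ y j) x = μ * ∑ i, pd i (pd i u) (φ x) := by
    calc _ = ∑ j, ∑ k, pd k (pd j u) (φ x) *
          ∑ i, pd i (fun y => φ y k) x * pd i (fun y => φ y j) x := by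
          rw [Finset.sum_comm]
          refine Finset.sum_congr rfl fun j _ => ?_
          simp only [Finset.sum_mul, Finset.mul_sum]
          rw [Finset.sum_comm]
          exact Finset.sum_congr rfl fun _ _ => Finset.sum_congr rfl fun _ _ => by ring
      _ = _ := by
          rw [Finset.mul_sum]
          refine Finset.sum_congr rfl fun j _ => ?_
          simp [hconf, mul_comm]
  have hB : ∑ i, ∑ j, pd j u (φ x) * pd i (pd i (fun y => φ y j)) x = 0 := by
    rw [Finset.sum_comm]
    refine Finset.sum_eq_zero fun j _ => ?_
    rw [← Finset.mul_sum, ← lapl_eq_sum_pd, hharm, mul_zero]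
  rw [hA, hB, add_zero]

/-- At a local minimum the Laplacian is nonnegative. -/
lemma lapl_nonneg_of_isLocalMin (hu : ContDiffAt ℝ 2 u x) (h : IsLocalMin u x) :
    0 ≤ lapl u x := by
  rw [lapl_eq_sum_pd]
  refine Finset.sum_nonneg fun i _ => ?_
  set e : Euc n := EuclideanSpace.single i 1
  set γ : ℝ → Euc n := fun t => x + t • e with hγ
  have hγ0 : γ 0 = x := by simp [hγ]
  have hγc : Continuous γ := by fun_prop
  have hγd : ∀ t, HasDerivAt γ e t := fun t => by
    simpa [hγ] using ((hasDerivAt_id t).smul_const e).const_add x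
  have htend : Tendsto γ (nhds 0) (nhds x) := by
    simpa [hγ0] using hγc.tendsto 0
  have hd1 : ∀ᶠ t in nhds (0 : ℝ), deriv (u ∘ γ) t = pd i u (γ t) := by
    filter_upwards [htend.eventually (eventually_differentiableAt hu)] with t ht
    exact (ht.hasFDerivAt.comp_hasDerivAt t (hγd t)).deriv
  have hd2 : deriv (deriv (u ∘ γ)) 0 = pd i (pd i u) x := by
    rw [Filter.EventuallyEq.deriv_eq hd1]
    have h2 : DifferentiableAt ℝ (pd i u) (γ 0) := by
      rw [hγ0]; exact differentiableAt_pd hu i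
    have := (h2.hasFDerivAt.comp_hasDerivAt 0 (hγd 0)).deriv
    rw [hγ0] at this
    exact this
  have hmin : IsLocalMin (u ∘ γ) 0 := by
    have : ∀ᶠ y in nhds x, u x ≤ u y := h
    have h3 := htend.eventually this
    filter_upwards [h3] with t ht
    simpa [hγ0] using ht
  by_contra hneg
  push Not at hneg
  have hmax : IsLocalMax (u ∘ γ) 0 := by
    apply isLocalMax_of_deriv_deriv_neg (by rw [hd2]; exact hneg) hmin.deriv_eq_zero
    exact (hu.continuousAt.comp_of_eq hγc.continuousAt hγ0)
  have hconst : u ∘ γ =ᶠ[nhds 0] fun _ => (u ∘ γ) 0 := by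
    filter_upwards [hmin, hmax] with t h1 h2 using le_antisymm h2 h1
  have h0 : deriv (deriv (u ∘ γ)) 0 = 0 := by
    have : deriv (u ∘ γ) =ᶠ[nhds 0] fun _ => 0 := by
      have := hconst.deriv
      simpa using this
    rw [this.deriv_eq]; simp
  rw [hd2] at h0
  exact absurd h0 hneg.ne

end PartialDerivatives

section MaximumPrinciple

variable {n : ℕ}

lemma pd_norm_sub_sq (c x : Euc n) (i : Fin n) :
    pd i (fun y => ‖y - c‖ ^ 2) x = 2 * (x i - c i) := by
  have h := ((hasFDerivAt_id x).sub_const c).norm_sq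
  simp only [id_eq] at h
  simp only [pd, h.fderiv]
  simp [innerSL_apply_apply, EuclideanSpace.inner_single_right]

lemma pd_coord_sub (c x : Euc n) (i j : Fin n) :
    pd i (fun y : Euc n => y j - c j) x = if i = j then 1 else 0 := by
  rw [pd_sub (by fun_prop) (by fun_prop), pd_coord, pd_const, sub_zero]

lemma norm_sub_sq_eq_sum (x c : Euc n) : ‖x - c‖ ^ 2 = ∑ i, (x i - c i) ^ 2 := by
  rw [EuclideanSpace.real_norm_sq_eq]
  simp

/-- The barrier used in the Hopf lemma. -/
def hopfBarrier (c : Euc n) (R β : ℝ) (y : Euc n) : ℝ :=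
  (R ^ 2 - ‖y - c‖ ^ 2) + β * (R ^ 2 - ‖y - c‖ ^ 2) ^ 2

lemma contDiff_norm_sub_sq (c : Euc n) {m : WithTop ℕ∞} :
    ContDiff ℝ m (fun y : Euc n => ‖y - c‖ ^ 2) :=
  (contDiff_id.sub contDiff_const).norm_sq ℝ

lemma contDiff_hopfBarrier (c : Euc n) (R β : ℝ) : ContDiff ℝ 2 (hopfBarrier c R β) := by
  have h := contDiff_norm_sub_sq (n := n) c (m := 2)
  unfold hopfBarrier
  fun_prop

lemma lapl_hopfBarrier (c : Euc n) (R β : ℝ) (x : Euc n) :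
    lapl (hopfBarrier c R β) x
      = -2 * n * (1 + 2 * β * (R ^ 2 - ‖x - c‖ ^ 2)) + 8 * β * ‖x - c‖ ^ 2 := by
  have hd : ∀ y : Euc n, DifferentiableAt ℝ (fun y : Euc n => ‖y - c‖ ^ 2) y := fun y =>
    (contDiff_norm_sub_sq (n := n) c (m := 1)).differentiable (by norm_num) y
  have h1 : ∀ i : Fin n, pd i (hopfBarrier c R β)
      = fun y => (1 + 2 * β * (R ^ 2 - ‖y - c‖ ^ 2)) * (-2 * (y i - c i)) := by
    intro i
    funext y
    have hF : HasDerivAt (fun t : ℝ => (R ^ 2 - t) + β * (R ^ 2 - t) ^ 2)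
        (-(1 + 2 * β * (R ^ 2 - ‖y - c‖ ^ 2))) (‖y - c‖ ^ 2) := by
      have h0 : HasDerivAt (fun t : ℝ => R ^ 2 - t) (-1) (‖y - c‖ ^ 2) := by
        simpa using (hasDerivAt_id (‖y - c‖ ^ 2)).const_sub (R ^ 2)
      have := h0.add ((h0.pow 2).const_mul β)
      convert! this using 1
      simp; ring
    have := pd_comp hF (hd y) i
    rw [pd_norm_sub_sq] at this
    rw [show hopfBarrier c R β = fun y => (fun t : ℝ => (R ^ 2 - t) + β * (R ^ 2 - t) ^ 2)
      (‖y - c‖ ^ 2) from rfl, this]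
    ring
  have h2 : ∀ i : Fin n, pd i (pd i (hopfBarrier c R β)) x
      = -2 * (1 + 2 * β * (R ^ 2 - ‖x - c‖ ^ 2)) + 8 * β * (x i - c i) ^ 2 := by
    intro i
    have hdx := hd x
    rw [h1, pd_mul (by fun_prop) (by fun_prop), pd_const_mul (by fun_prop), pd_coord_sub,
      if_pos rfl, pd_add (by fun_prop) (by fun_prop), pd_const, pd_const_mul (by fun_prop),
      pd_sub (by fun_prop) hdx, pd_const, pd_norm_sub_sq]
    ring
  rw [lapl_eq_sum_pd]
  simp only [h2, Finset.sum_add_distrib, Finset.sum_const, ← Finset.mul_sum,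
    ← norm_sub_sq_eq_sum]
  simp
  ring

/-- The Hopf lemma, in quantitative form. -/
lemma hopf_lemma {w : Euc n → ℝ} {c : Euc n} {R : ℝ} (hR : 0 < R)
    (hw : ∀ y ∈ Metric.ball c R, ContDiffAt ℝ 2 w y)
    (hc : ContinuousOn w (Metric.closedBall c R))
    (hlap : ∀ y ∈ Metric.ball c R, lapl w y ≤ 0)
    (hpos : ∀ y ∈ Metric.ball c R, 0 < w y)
    (hnn : ∀ y ∈ Metric.closedBall c R, 0 ≤ w y) :
    ∃ κ > 0, ∀ y ∈ Metric.closedBall c R, κ * (R ^ 2 - ‖y - c‖ ^ 2) ≤ w y := by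
  set θ : ℝ := 1 / (n + 2) with hθ
  have hn2 : (0 : ℝ) < n + 2 := by positivity
  have hθ0 : 0 < θ := by positivity
  have hθ1 : θ < 1 := by
    rw [hθ, div_lt_one hn2]
    have : (0 : ℝ) ≤ n := by positivity
    linarith
  have hθn : θ * (n + 2) = 1 := by rw [hθ]; field_simp
  set β : ℝ := (n + 1) / R ^ 2 with hβ
  have hβ0 : 0 < β := by positivity
  have hβR : β * R ^ 2 = n + 1 := by rw [hβ]; field_simp
  set r : ℝ := Real.sqrt (1 - θ) * R with hr
  have hr2 : r ^ 2 = (1 - θ) * R ^ 2 := by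
    rw [hr, mul_pow, Real.sq_sqrt (by linarith)]
  have hr0 : 0 < r := by rw [hr]; exact mul_pos (Real.sqrt_pos.2 (by linarith)) hR
  have hrR : r < R := by
    apply lt_of_pow_lt_pow_left₀ 2 hR.le
    rw [hr2]; nlinarith [pow_pos hR 2]
  obtain ⟨y1, hy1, hmin1⟩ := (isCompact_closedBall c r).exists_isMinOn
    ⟨c, Metric.mem_closedBall_self hr0.le⟩
    (hc.mono (Metric.closedBall_subset_closedBall hrR.le))
  set m := w y1 with hm
  have hm0 : 0 < m := hpos _ (Metric.closedBall_subset_ball hrR hy1)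
  set H : ℝ := R ^ 2 + β * (R ^ 2) ^ 2 with hH
  have hH0 : 0 < H := by positivity
  set ε : ℝ := m / H with hε
  have hε0 : 0 < ε := div_pos hm0 hH0
  have hεH : ε * H = m := by rw [hε]; field_simp
  have hbar : ∀ y ∈ Metric.closedBall c R, R ^ 2 - ‖y - c‖ ^ 2 ≤ hopfBarrier c R β y ∧
      hopfBarrier c R β y ≤ H ∧ 0 ≤ R ^ 2 - ‖y - c‖ ^ 2 := by
    intro y hy
    have h1 : ‖y - c‖ ≤ R := by simpa [dist_eq_norm] using hy
    have h2 : 0 ≤ R ^ 2 - ‖y - c‖ ^ 2 := by nlinarith [norm_nonneg (y - c)]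
    have h3 : R ^ 2 - ‖y - c‖ ^ 2 ≤ R ^ 2 := by nlinarith [norm_nonneg (y - c)]
    refine ⟨?_, ?_, h2⟩
    · have : 0 ≤ β * (R ^ 2 - ‖y - c‖ ^ 2) ^ 2 := by positivity
      unfold hopfBarrier; linarith
    · have : β * (R ^ 2 - ‖y - c‖ ^ 2) ^ 2 ≤ β * (R ^ 2) ^ 2 := by gcongr
      unfold hopfBarrier; linarith
  refine ⟨ε, hε0, ?_⟩
  have hinner : ∀ y ∈ Metric.closedBall c r, ε * hopfBarrier c R β y ≤ w y := by
    intro y hy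
    have h1 : m ≤ w y := hmin1 hy
    have h2 := (hbar y (Metric.closedBall_subset_closedBall hrR.le hy)).2.1
    calc ε * hopfBarrier c R β y ≤ ε * H := by gcongr
      _ = m := hεH
      _ ≤ w y := h1
  suffices hall : ∀ y ∈ Metric.closedBall c R, ε * hopfBarrier c R β y ≤ w y by
    intro y hy
    have h1 := (hbar y hy).1
    have : ε * (R ^ 2 - ‖y - c‖ ^ 2) ≤ ε * hopfBarrier c R β y := by gcongr
    linarith [hall y hy]
  set D : Euc n → ℝ := fun y => w y - ε * hopfBarrier c R β y with hD
  have hDc : ContinuousOn D (Metric.closedBall c R) :=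
    hc.sub ((contDiff_hopfBarrier c R β).continuous.continuousOn.const_smul ε)
  obtain ⟨y0, hy0, hmin0⟩ := (isCompact_closedBall c R).exists_isMinOn
    ⟨c, Metric.mem_closedBall_self hR.le⟩ hDc
  by_cases hD0 : 0 ≤ D y0
  · intro y hy
    have : D y0 ≤ D y := hmin0 hy
    have : 0 ≤ D y := hD0.trans this
    simp only [hD] at this; linarith
  exfalso
  push Not at hD0
  have hyr : r < ‖y0 - c‖ := by
    by_contra h
    push Not at h
    have := hinner y0 (by simpa [dist_eq_norm] using h)
    simp only [hD] at hD0; linarith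
  have hyR : ‖y0 - c‖ < R := by
    have h1 : ‖y0 - c‖ ≤ R := by simpa [dist_eq_norm] using hy0
    refine lt_of_le_of_ne h1 fun h => ?_
    have : hopfBarrier c R β y0 = 0 := by simp [hopfBarrier, h]
    have h2 := hnn y0 hy0
    simp only [hD, this] at hD0; linarith
  have hy0b : y0 ∈ Metric.ball c R := by simpa [dist_eq_norm] using hyR
  have hlocal : IsLocalMin D y0 := by
    filter_upwards [Metric.isOpen_ball.mem_nhds hy0b] with y hy
    exact hmin0 (Metric.ball_subset_closedBall hy)
  have hb : ContDiffAt ℝ 2 (hopfBarrier c R β) y0 := (contDiff_hopfBarrier c R β).contDiffAt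
  have hDcd : ContDiffAt ℝ 2 D y0 := (hw y0 hy0b).sub (contDiffAt_const.mul hb)
  have h1 := lapl_nonneg_of_isLocalMin hDcd hlocal
  rw [hD, lapl_sub (hw y0 hy0b) (contDiffAt_const.mul hb), lapl_const_mul hb,
    lapl_hopfBarrier] at h1
  have h2 := hlap y0 hy0b
  have h3 : (1 - θ) * R ^ 2 < ‖y0 - c‖ ^ 2 := by
    rw [← hr2]; gcongr
  have h4 : 0 < -2 * n * (1 + 2 * β * (R ^ 2 - ‖y0 - c‖ ^ 2)) + 8 * β * ‖y0 - c‖ ^ 2 := by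
    set t := ‖y0 - c‖ ^ 2
    have hnn0 : (0 : ℝ) ≤ n := by positivity
    have h5 : β * ((1 - θ) * R ^ 2) ≤ β * t := by gcongr
    have h6 : β * ((1 - θ) * R ^ 2) = (1 - θ) * (n + 1) := by rw [← hβR]; ring
    have h7 : (n + 1 : ℝ) * 4 ≤ (4 * n + 8) * ((1 - θ) * (n + 1)) - 4 * n * (n + 1) := by
      have : (4 * n + 8 : ℝ) * ((1 - θ) * (n + 1)) - 4 * n * (n + 1)
          = (n + 1) * (8 - 4 * (θ * (n + 2))) := by ring
      rw [this, hθn]; linarith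
    have h8 : (4 * n + 8 : ℝ) * ((1 - θ) * (n + 1)) ≤ (4 * n + 8) * (β * t) := by
      rw [← h6]; gcongr
    have h9 : -2 * n * (1 + 2 * β * (R ^ 2 - t)) + 8 * β * t
        = -2 * n - 4 * n * (β * R ^ 2) + (4 * n + 8) * (β * t) := by ring
    rw [h9, hβR]
    linarith
  have := mul_pos hε0 h4
  linarith

/-- Strong maximum principle: a nonnegative superharmonic function that vanishes at a point of a
connected set vanishes on that set. -/
lemma strong_maximum_principle {w : Euc n → ℝ} {V S : Set (Euc n)} (hV : IsOpen V)
    (hw : ∀ y ∈ V, ContDiffAt ℝ 2 w y) (hlap : ∀ y ∈ V, lapl w y ≤ 0)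
    (hnn : ∀ y ∈ V, 0 ≤ w y) (hSV : S ⊆ V) (hS : IsPreconnected S)
    {x : Euc n} (hxS : x ∈ S) (hx : w x = 0) : ∀ y ∈ S, w y = 0 := by
  have hwc : ContinuousOn w V := fun y hy => (hw y hy).continuousAt.continuousWithinAt
  have hopen : IsOpen (V ∩ {y | w y = 0}) := by
    rw [Metric.isOpen_iff]
    rintro x0 ⟨hx0V, hx0⟩
    obtain ⟨r, hr, hball⟩ := Metric.isOpen_iff.1 hV x0 hx0V
    refine ⟨r / 4, by positivity, fun y0 hy0 => ?_⟩
    have hy0V : y0 ∈ V := hball (Metric.ball_subset_ball (by linarith) hy0)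
    refine ⟨hy0V, ?_⟩
    by_contra hne
    have hy0d : dist y0 x0 < r / 4 := hy0
    set Z := Metric.closedBall x0 (r / 2) ∩ {y | w y = 0} with hZ
    have hZc : IsCompact Z := by
      have hcl : ContinuousOn w (Metric.closedBall x0 (r / 2)) :=
        hwc.mono ((Metric.closedBall_subset_ball (by linarith)).trans hball)
      have := hcl.preimage_isClosed_of_isClosed Metric.isClosed_closedBall
        (isClosed_singleton (x := (0 : ℝ)))
      exact (isCompact_closedBall x0 (r / 2)).of_isClosed_subset this Set.inter_subset_left
    have hx0Z : x0 ∈ Z := ⟨Metric.mem_closedBall_self (by positivity), hx0⟩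
    obtain ⟨p, hpZ, hp⟩ := hZc.exists_infDist_eq_dist ⟨x0, hx0Z⟩ y0
    set R := dist y0 p with hRdef
    have hR0 : 0 < R := by
      rw [hRdef, dist_pos]
      rintro rfl
      exact hne hpZ.2
    have hRle : R ≤ dist y0 x0 := hp ▸ Metric.infDist_le_dist_of_mem hx0Z
    have hsub : Metric.closedBall y0 R ⊆ Metric.closedBall x0 (r / 2) := by
      intro y hy
      have : dist y y0 ≤ R := hy
      have := dist_triangle y y0 x0
      simp only [Metric.mem_closedBall]; linarith
    have hsubV : Metric.closedBall y0 R ⊆ V :=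
      hsub.trans ((Metric.closedBall_subset_ball (by linarith)).trans hball)
    have hbV : Metric.ball y0 R ⊆ V := Metric.ball_subset_closedBall.trans hsubV
    obtain ⟨κ, hκ, hlow⟩ := hopf_lemma hR0 (fun y hy => hw y (hbV hy)) (hwc.mono hsubV)
      (fun y hy => hlap y (hbV hy)) (fun y hy => by
        refine lt_of_le_of_ne (hnn y (hbV hy)) fun h => ?_
        have hyZ : y ∈ Z := ⟨hsub (Metric.ball_subset_closedBall hy), h.symm⟩
        have h1 := Metric.infDist_le_dist_of_mem (x := y0) hyZ
        have h2 : dist y y0 < R := hy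
        rw [dist_comm] at h2
        linarith) (fun y hy => hnn y (hsubV hy))
    have hpV : p ∈ V := hsubV (by simp [hRdef, dist_comm])
    have hlm : IsLocalMin w p := by
      filter_upwards [hV.mem_nhds hpV] with y hy
      rw [show w p = 0 from hpZ.2]; exact hnn y hy
    set γ : ℝ → Euc n := fun t => p + t • (y0 - p) with hγ
    have hγd : HasDerivAt γ (y0 - p) 0 := by
      simpa [hγ] using ((hasDerivAt_id (0 : ℝ)).smul_const (y0 - p)).const_add p
    have hγ0 : γ 0 = p := by simp [hγ]
    have hder : HasDerivAt (w ∘ γ) 0 0 := by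
      have hdp : HasFDerivAt w (0 : Euc n →L[ℝ] ℝ) (γ 0) := by
        rw [hγ0, ← hlm.fderiv_eq_zero]
        exact ((hw p hpV).differentiableAt (by norm_num)).hasFDerivAt
      simpa using hdp.comp_hasDerivAt 0 hγd
    have hslope := hder.tendsto_slope_zero_right
    have hbound : ∀ᶠ t in nhdsWithin (0 : ℝ) (Set.Ioi 0),
        κ * R ^ 2 ≤ t⁻¹ • ((w ∘ γ) (0 + t) - (w ∘ γ) 0) := by
      filter_upwards [Ioo_mem_nhdsGT (show (0 : ℝ) < 1 by norm_num)] with t ht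
      have hdist : ‖γ t - y0‖ = (1 - t) * R := by
        have : γ t - y0 = (-(1 - t)) • (y0 - p) := by simp only [hγ]; module
        rw [this, norm_smul, ← dist_eq_norm, Real.norm_eq_abs, abs_neg,
          abs_of_pos (by linarith [ht.2])]
      have hmem : γ t ∈ Metric.closedBall y0 R := by
        rw [Metric.mem_closedBall, dist_eq_norm, hdist]
        nlinarith [ht.1]
      have h1 := hlow _ hmem
      rw [hdist] at h1
      have h2 : w (γ 0) = 0 := by rw [hγ0]; exact hpZ.2
      simp only [Function.comp, zero_add, h2, sub_zero, smul_eq_mul]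
      rw [inv_mul_eq_div, le_div_iff₀ ht.1]
      have : κ * R ^ 2 * t ≤ κ * (R ^ 2 - ((1 - t) * R) ^ 2) := by
        have h3 : R ^ 2 - ((1 - t) * R) ^ 2 = R ^ 2 * t * (2 - t) := by ring
        rw [h3]
        have h4 : 0 ≤ κ * R ^ 2 * t := by have := ht.1; positivity
        nlinarith [ht.2]
      linarith
    have h0 := ge_of_tendsto hslope hbound
    have : 0 < κ * R ^ 2 := by positivity
    linarith
  have hopen2 : IsOpen (V ∩ {y | w y ≠ 0}) :=
    hwc.isOpen_inter_preimage hV (isOpen_compl_singleton (x := (0 : ℝ)))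
  by_contra hcon
  push Not at hcon
  obtain ⟨y, hyS, hy⟩ := hcon
  obtain ⟨z, -, hz1, hz2⟩ := hS _ _ hopen hopen2 (fun z hz => by
    by_cases h : w z = 0
    · exact Or.inl ⟨hSV hz, h⟩
    · exact Or.inr ⟨hSV hz, h⟩) ⟨x, hxS, hSV hxS, hx⟩ ⟨y, hyS, hSV hyS, hy⟩
  exact hz2.2 hz1.2

end MaximumPrinciple

section MovingPlanes

variable {n : ℕ}

/-- Data of a one-parameter family of reflections `x ↦ x + τ s (ℓ x) • N x` across the level sets
`{ℓ = s}` of a distance-like function `ℓ` with normal field `N`. -/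
structure ReflectionFamily (ℓ : Euc n → ℝ) (N : Euc n → Euc n) (τ : ℝ → ℝ → ℝ) : Prop where
  norm_normal : ∀ x, 0 < ℓ x → ‖N x‖ = 1
  lip : ∀ x y, |ℓ x - ℓ y| ≤ ‖x - y‖
  level_add : ∀ x t, 0 < ℓ x → 0 < ℓ x + t → ℓ (x + t • N x) = ℓ x + t
  normal_add : ∀ x t, 0 < ℓ x → 0 < ℓ x + t → N (x + t • N x) = N x
  contDiffAt_level : ∀ x, 0 < ℓ x → ContDiffAt ℝ 2 ℓ x
  contDiffAt_normal : ∀ x, 0 < ℓ x → ContDiffAt ℝ 2 N x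
  shift_self : ∀ s, 0 < s → τ s s = 0
  shift_pos : ∀ s l, 0 < l → l < s → 0 < τ s l
  contDiffAt_shift : ∀ s l, 0 < s → 0 < l → ContDiffAt ℝ 2 (fun p : ℝ × ℝ => τ p.1 p.2) (s, l)
  hasDerivAt_shift : ∀ s, 0 < s → HasDerivAt (fun t => τ s (s - t)) 2 0

/-- The reflection across `{ℓ = s}`. -/
def reflMap (ℓ : Euc n → ℝ) (N : Euc n → Euc n) (τ : ℝ → ℝ → ℝ) (s : ℝ) (x : Euc n) : Euc n :=
  x + τ s (ℓ x) • N x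

variable {ℓ : Euc n → ℝ} {N : Euc n → Euc n} {τ : ℝ → ℝ → ℝ}

lemma ReflectionFamily.continuous_level (h : ReflectionFamily ℓ N τ) : Continuous ℓ := by
  have : LipschitzWith 1 ℓ := LipschitzWith.of_dist_le_mul fun x y => by
    simpa [dist_eq_norm] using h.lip x y
  exact this.continuous

lemma ReflectionFamily.contDiffAt_reflMap (h : ReflectionFamily ℓ N τ) {s : ℝ} (hs : 0 < s)
    {x : Euc n} (hx : 0 < ℓ x) : ContDiffAt ℝ 2 (reflMap ℓ N τ s) x := by
  have h1 : ContDiffAt ℝ 2 (fun y => (s, ℓ y)) x := contDiffAt_const.prodMk (h.contDiffAt_level x hx)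
  have h2 : ContDiffAt ℝ 2 (fun y => τ s (ℓ y)) x :=
    ContDiffAt.comp (g := fun p : ℝ × ℝ => τ p.1 p.2) (f := fun y => (s, ℓ y)) x
      (h.contDiffAt_shift s (ℓ x) hs hx) h1
  exact contDiffAt_id.add (h2.smul (h.contDiffAt_normal x hx))

lemma ReflectionFamily.continuousAt_reflMap (h : ReflectionFamily ℓ N τ) {s : ℝ} (hs : 0 < s)
    {x : Euc n} (hx : 0 < ℓ x) :
    ContinuousAt (fun p : ℝ × Euc n => reflMap ℓ N τ p.1 p.2) (s, x) := by
  have h1 : ContinuousAt (fun p : ℝ × Euc n => (p.1, ℓ p.2)) (s, x) :=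
    continuousAt_fst.prodMk (h.continuous_level.continuousAt.comp continuousAt_snd)
  have h2 : ContinuousAt (fun p : ℝ × Euc n => τ p.1 (ℓ p.2)) (s, x) :=
    ContinuousAt.comp (f := fun p : ℝ × Euc n => (p.1, ℓ p.2))
      (g := fun p : ℝ × ℝ => τ p.1 p.2) (h.contDiffAt_shift s (ℓ x) hs hx).continuousAt h1
  have h3 : ContinuousAt (fun p : ℝ × Euc n => N p.2) (s, x) :=
    ContinuousAt.comp (f := fun p : ℝ × Euc n => p.2) (g := N)
      (h.contDiffAt_normal x hx).continuousAt continuousAt_snd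
  exact continuousAt_snd.add (h2.smul h3)

/-- First exit point when moving against the normal field. -/
lemma ReflectionFamily.exists_exit (h : ReflectionFamily ℓ N τ) {Ω : Set (Euc n)} (hΩ : IsOpen Ω)
    {s0 : ℝ} (hs0 : 0 < s0) (hΩs : ∀ x ∈ Ω, s0 ≤ ℓ x) {x : Euc n} (hx : x ∈ Ω) :
    ∃ r > 0, r ≤ ℓ x - s0 ∧ x - r • N x ∈ frontier Ω ∧ ∀ t, 0 ≤ t → t < r → x - t • N x ∈ Ω := by
  have hlx := hΩs x hx
  have hlev : ∀ t, t < ℓ x → ℓ (x - t • N x) = ℓ x - t := by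
    intro t ht
    have := h.level_add x (-t) (by linarith) (by linarith)
    rw [neg_smul, ← sub_eq_add_neg] at this
    rw [this]; ring
  set T : Set ℝ := Set.Icc 0 (ℓ x - s0 / 2) ∩ {r | x - r • N x ∉ Ω} with hT
  have hcont : Continuous (fun r : ℝ => x - r • N x) := by fun_prop
  have hTc : IsCompact T :=
    isCompact_Icc.inter_right (hΩ.isClosed_compl.preimage hcont)
  have hne : T.Nonempty := by
    refine ⟨ℓ x - s0 / 2, ⟨by linarith, le_rfl⟩, fun hmem => ?_⟩
    have := hΩs _ hmem
    rw [hlev _ (by linarith)] at this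
    linarith
  obtain ⟨r, hrT, hrmin⟩ := hTc.exists_isLeast hne
  have hr0 : 0 < r := by
    refine lt_of_le_of_ne hrT.1.1 fun h0 => hrT.2 ?_
    rw [← h0]; simpa using hx
  have hin : ∀ t, 0 ≤ t → t < r → x - t • N x ∈ Ω := by
    intro t ht0 htr
    by_contra hcon
    exact absurd (hrmin ⟨⟨ht0, htr.le.trans hrT.1.2⟩, hcon⟩) (not_le.2 htr)
  have hcl : x - r • N x ∈ closure Ω := by
    have h1 : Tendsto (fun t : ℝ => x - t • N x) (nhdsWithin r (Set.Iio r)) (nhds (x - r • N x)) :=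
      hcont.continuousAt.tendsto.mono_left nhdsWithin_le_nhds
    refine mem_closure_of_tendsto h1 ?_
    filter_upwards [Ioo_mem_nhdsLT hr0] with t ht using hin t ht.1.le ht.2
  have hfr : x - r • N x ∈ frontier Ω := by
    rw [hΩ.frontier_eq]; exact ⟨hcl, hrT.2⟩
  have hls : ∀ y ∈ closure Ω, s0 ≤ ℓ y := fun y hy =>
    closure_minimal hΩs (isClosed_le continuous_const h.continuous_level) hy
  refine ⟨r, hr0, ?_, hfr, hin⟩
  have := hls _ hcl
  rw [hlev r (by linarith [hrT.1.2])] at this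
  linarith

/-- Points of the cap are moved into the domain along the normal field. -/
lemma ReflectionFamily.add_mem (h : ReflectionFamily ℓ N τ) {Ω : Set (Euc n)} (hΩ : IsOpen Ω)
    {s0 s1 R : ℝ} (hs0 : 0 < s0) (hR : 0 < R) (hΩs : ∀ x ∈ Ω, s0 ≤ ℓ x)
    (hball : ∀ q ∈ frontier Ω, ℓ q ≤ s1 → ∃ ν : Euc n, ‖ν‖ = 1 ∧
      Metric.ball (q - R • ν) R ⊆ Ω ∧ inner ℝ ν (N q) ≤ -(1 / 2))
    {x : Euc n} (hx : x ∈ closure Ω) (hxs : ℓ x ≤ s1) {t : ℝ} (ht : 0 < t)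
    (htR : ℓ x + t < s0 + R) : x + t • N x ∈ Ω := by
  have hls : ∀ y ∈ closure Ω, s0 ≤ ℓ y := fun y hy =>
    closure_minimal hΩs (isClosed_le continuous_const h.continuous_level) hy
  have key : ∀ q ∈ frontier Ω, ℓ q ≤ s1 → ∀ t, 0 < t → ℓ q + t < s0 + R → q + t • N q ∈ Ω := by
    intro q hq hqs t ht htR
    obtain ⟨ν, hν, hsub, hin⟩ := hball q hq hqs
    have hlq := hls q (frontier_subset_closure hq)
    have hNq := h.norm_normal q (by linarith)
    apply hsub
    rw [Metric.mem_ball, dist_eq_norm]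
    have h1 : q + t • N q - (q - R • ν) = t • N q + R • ν := by abel
    rw [h1]
    refine lt_of_pow_lt_pow_left₀ 2 hR.le ?_
    rw [norm_add_sq_real, norm_smul, norm_smul, hNq, hν, inner_smul_left, inner_smul_right,
      real_inner_comm]
    simp only [Real.norm_eq_abs, mul_one, sq_abs, conj_trivial]
    have h2 : t * (R * inner ℝ ν (N q)) ≤ t * (R * (-(1 / 2))) := by gcongr
    nlinarith
  by_cases hxΩ : x ∈ Ω
  · obtain ⟨r, hr, hrl, hfr, -⟩ := h.exists_exit hΩ hs0 hΩs hxΩ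
    have hlx := hls x hx
    have hlev := h.level_add x (-r) (by linarith) (by linarith)
    have hnor := h.normal_add x (-r) (by linarith) (by linarith)
    rw [neg_smul, ← sub_eq_add_neg] at hlev hnor
    have := key _ hfr (by rw [hlev]; linarith) (r + t) (by linarith) (by rw [hlev]; linarith)
    rw [hnor] at this
    convert this using 1
    module
  · exact key x (by rw [hΩ.frontier_eq]; exact ⟨hx, hxΩ⟩) hxs t ht htR

/-- The abstract moving planes (or spheres) method. -/
lemma ReflectionFamily.moving_method (h : ReflectionFamily ℓ N τ) {Ω : Set (Euc n)}
    (hΩ : IsOpen Ω) (hbd : Bornology.IsBounded Ω) {u : Euc n → ℝ}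
    (hu : ∀ x ∈ closure Ω, ContDiffAt ℝ 2 u x) (h0 : ∀ x ∈ frontier Ω, u x = 0)
    (hpos : ∀ x ∈ Ω, 0 < u x) (hsup : ∀ x ∈ Ω, lapl u x ≤ 0)
    {s0 s1 R : ℝ} (hs0 : 0 < s0) (hR : 0 < R) (hΩs : ∀ x ∈ Ω, s0 ≤ ℓ x)
    (hball : ∀ q ∈ frontier Ω, ℓ q ≤ s1 → ∃ ν : Euc n, ‖ν‖ = 1 ∧
      Metric.ball (q - R • ν) R ⊆ Ω ∧ inner ℝ ν (N q) ≤ -(1 / 2))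
    (hτ : ∀ l s, s0 ≤ l → l < s → s ≤ s1 → l + τ s l < s0 + R)
    (hsuper : ∀ s ≤ s1, ∀ x ∈ Ω, ℓ x < s → reflMap ℓ N τ s x ∈ Ω →
      u x ≤ u (reflMap ℓ N τ s x) →
      lapl (fun y => u (reflMap ℓ N τ s y)) x ≤ lapl u x) :
    ∀ s ≤ s1, ∀ x ∈ Ω, ℓ x < s → reflMap ℓ N τ s x ∈ Ω ∧ u x ≤ u (reflMap ℓ N τ s x) := by
  have hls : ∀ y ∈ closure Ω, s0 ≤ ℓ y := fun y hy =>
    closure_minimal hΩs (isClosed_le continuous_const h.continuous_level) hy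
  have hmem : ∀ s ≤ s1, ∀ x ∈ closure Ω, ℓ x < s → reflMap ℓ N τ s x ∈ Ω := by
    intro s hs x hx hxs
    have hlx := hls x hx
    exact h.add_mem hΩ hs0 hR hΩs hball hx (by linarith) (h.shift_pos s _ (by linarith) hxs)
      (hτ _ s hlx hxs hs)
  have hΩcl : Ω ⊆ closure Ω := subset_closure
  suffices hgood : ∀ s ≤ s1, ∀ x ∈ Ω, ℓ x < s → u x ≤ u (reflMap ℓ N τ s x) from
    fun s hs x hx hxs => ⟨hmem s hs x (hΩcl hx) hxs, hgood s hs x hx hxs⟩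
  by_contra hcon
  push Not at hcon
  set B : Set ℝ := {s | s ≤ s1 ∧ ∃ x ∈ Ω, ℓ x < s ∧ u (reflMap ℓ N τ s x) < u x} with hB
  have hBne : B.Nonempty := by
    obtain ⟨s, hs, x, hx, hxs, hlt⟩ := hcon
    exact ⟨s, hs, x, hx, hxs, hlt⟩
  have hBlow : ∀ s ∈ B, s0 ≤ s := by
    rintro s ⟨-, x, hx, hxs, -⟩
    linarith [hΩs x hx]
  have hBb : BddBelow B := ⟨s0, hBlow⟩
  set σ := sInf B with hσ
  have hσ0 : s0 ≤ σ := le_csInf hBne hBlow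
  have hσpos : 0 < σ := by linarith
  have hσ1 : σ ≤ s1 := by
    obtain ⟨s, hs⟩ := hBne
    exact (csInf_le hBb hs).trans hs.1
  have hlt : ∀ s < σ, ∀ x ∈ Ω, ℓ x < s → u x ≤ u (reflMap ℓ N τ s x) := by
    intro s hs x hx hxs
    by_contra hc
    push Not at hc
    exact absurd (csInf_le hBb (show s ∈ B from ⟨by linarith, x, hx, hxs, hc⟩)) (not_le.2 hs)
  have huc : ∀ x ∈ closure Ω, ContinuousAt u x := fun x hx => (hu x hx).continuousAt
  have hgoodσ : ∀ x ∈ Ω, ℓ x < σ → u x ≤ u (reflMap ℓ N τ σ x) := by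
    intro x hx hxs
    have h1 : ContinuousAt (fun s => reflMap ℓ N τ s x) σ :=
      ContinuousAt.comp (f := fun s : ℝ => (s, x))
        (g := fun p : ℝ × Euc n => reflMap ℓ N τ p.1 p.2)
        (h.continuousAt_reflMap hσpos (by linarith [hΩs x hx])) (by fun_prop)
    have h2 : ContinuousAt (fun s => u (reflMap ℓ N τ s x)) σ :=
      ContinuousAt.comp (g := u) (huc _ (hΩcl (hmem σ hσ1 x (hΩcl hx) hxs))) h1
    refine ge_of_tendsto (h2.tendsto.mono_left (nhdsWithin_le_nhds (s := Set.Iio σ))) ?_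
    filter_upwards [Ioo_mem_nhdsLT hxs] with s hs using hlt s hs.2 x hx hs.1
  set v : Euc n → ℝ := fun y => u (reflMap ℓ N τ σ y) - u y with hv
  set V : Set (Euc n) := Ω ∩ {y | ℓ y < σ} with hV
  have hVo : IsOpen V := hΩ.inter (isOpen_lt h.continuous_level continuous_const)
  have huφ : ∀ y ∈ closure Ω, 0 < ℓ y → reflMap ℓ N τ σ y ∈ closure Ω →
      ContDiffAt ℝ 2 (fun z => u (reflMap ℓ N τ σ z)) y := fun y _ hy0 hyφ =>
    ContDiffAt.comp y (hu _ hyφ) (h.contDiffAt_reflMap hσpos hy0)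
  have hvcd : ∀ y ∈ V, ContDiffAt ℝ 2 v y := fun y hy =>
    (huφ y (hΩcl hy.1) (by linarith [hΩs y hy.1])
      (hΩcl (hmem σ hσ1 y (hΩcl hy.1) hy.2))).sub (hu y (hΩcl hy.1))
  have hvlap : ∀ y ∈ V, lapl v y ≤ 0 := by
    intro y hy
    have h1 := hmem σ hσ1 y (hΩcl hy.1) hy.2
    rw [hv, lapl_sub (huφ y (hΩcl hy.1) (by linarith [hΩs y hy.1]) (hΩcl h1)) (hu y (hΩcl hy.1))]
    linarith [hsuper σ hσ1 y hy.1 hy.2 h1 (hgoodσ y hy.1 hy.2)]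
  have hvnn : ∀ y ∈ V, 0 ≤ v y := fun y hy => sub_nonneg.2 (hgoodσ y hy.1 hy.2)
  have hvpos : ∀ y ∈ V, 0 < v y := by
    intro y hy
    refine lt_of_le_of_ne (hvnn y hy) fun hzero => ?_
    obtain ⟨r, hr, hrl, hfr, hseg⟩ := h.exists_exit hΩ hs0 hΩs hy.1
    have hly := hΩs y hy.1
    have hlev : ∀ t, 0 ≤ t → t ≤ r → ℓ (y - t • N y) = ℓ y - t := by
      intro t ht0 ht
      have := h.level_add y (-t) (by linarith) (by linarith)
      rw [neg_smul, ← sub_eq_add_neg] at this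
      rw [this]; ring
    set S : Set (Euc n) := (fun t : ℝ => y - t • N y) '' Set.Ico 0 r with hS
    have hcont : Continuous (fun t : ℝ => y - t • N y) := by fun_prop
    have hSp : IsPreconnected S := isPreconnected_Ico.image _ hcont.continuousOn
    have hSV : S ⊆ V := by
      rintro _ ⟨t, ht, rfl⟩
      refine ⟨hseg t ht.1 ht.2, ?_⟩
      have : ℓ (y - t • N y) = ℓ y - t := hlev t ht.1 ht.2.le
      have h2 : ℓ y < σ := hy.2
      simp only [Set.mem_ofPred_eq, this]
      linarith [ht.1]
    have hyS : y ∈ S := ⟨0, ⟨le_rfl, hr⟩, by simp⟩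
    have hall := strong_maximum_principle hVo hvcd hvlap hvnn hSV hSp hyS hzero.symm
    set q := y - r • N y with hq
    have hlq : ℓ q = ℓ y - r := hlev r hr.le le_rfl
    have hqcl : q ∈ closure Ω := frontier_subset_closure hfr
    have hqσ : ℓ q < σ := by have : ℓ y < σ := hy.2; linarith
    have hφq := hmem σ hσ1 q hqcl hqσ
    have hvq : ContinuousAt v q :=
      (huφ q hqcl (by linarith [hls q hqcl]) (hΩcl hφq)).continuousAt.sub (huc q hqcl)
    have hlim : Tendsto (fun t : ℝ => v (y - t • N y)) (nhdsWithin r (Set.Iio r)) (nhds (v q)) :=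
      (ContinuousAt.tendsto (ContinuousAt.comp (g := v) (f := fun t : ℝ => y - t • N y) (x := r)
        hvq hcont.continuousAt)).mono_left nhdsWithin_le_nhds
    have hzero2 : Tendsto (fun t : ℝ => v (y - t • N y)) (nhdsWithin r (Set.Iio r)) (nhds 0) := by
      refine tendsto_const_nhds.congr' ?_
      filter_upwards [Ioo_mem_nhdsLT hr] with t ht
      exact (hall _ ⟨t, ⟨ht.1.le, ht.2⟩, rfl⟩).symm
    have := tendsto_nhds_unique hlim hzero2
    simp only [hv, h0 q hfr] at this
    linarith [hpos _ hφq]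
  -- a sequence of bad pairs
  have hex : ∀ j : ℕ, ∃ p : ℝ × Euc n, p.1 ∈ B ∧ p.1 < σ + 1 / (j + 1) ∧ p.2 ∈ Ω ∧ ℓ p.2 < p.1 ∧
      u (reflMap ℓ N τ p.1 p.2) < u p.2 := by
    intro j
    have : (0 : ℝ) < 1 / (j + 1) := by positivity
    obtain ⟨s, hs, hsj⟩ := exists_lt_of_csInf_lt hBne (show sInf B < σ + 1 / (j + 1) by linarith)
    obtain ⟨hs1, x, hx, hxs, hlt⟩ := hs
    exact ⟨(s, x), ⟨hs1, x, hx, hxs, hlt⟩, hsj, hx, hxs, hlt⟩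
  choose p hpB hpσ hpΩ hpl hpu using hex
  have hcomp : IsCompact (closure Ω) := hbd.isCompact_closure
  obtain ⟨xb, hxb, θ, hθ, hlimx⟩ := hcomp.tendsto_subseq (fun j => hΩcl (hpΩ j))
  have hlims0 : Tendsto (fun j => (p j).1) atTop (nhds σ) := by
    have h1 : Tendsto (fun j : ℕ => σ + 1 / ((j : ℝ) + 1)) atTop (nhds σ) := by
      simpa using (tendsto_one_div_add_atTop_nhds_zero_nat (𝕜 := ℝ)).const_add σ
    exact tendsto_of_tendsto_of_tendsto_of_le_of_le tendsto_const_nhds h1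
      (fun j => csInf_le hBb (hpB j)) (fun j => (hpσ j).le)
  have hlims : Tendsto (fun j => (p (θ j)).1) atTop (nhds σ) := hlims0.comp hθ.tendsto_atTop
  have hlimx : Tendsto (fun j => (p (θ j)).2) atTop (nhds xb) := hlimx
  have hlb0 : 0 < ℓ xb := by linarith [hls xb hxb]
  have hlimp : Tendsto (fun j => p (θ j)) atTop (nhds (σ, xb)) := by
    simpa using hlims.prodMk_nhds hlimx
  have hlbσ : ℓ xb ≤ σ :=
    le_of_tendsto_of_tendsto ((h.continuous_level.tendsto xb).comp hlimx) hlims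
      (Eventually.of_forall fun j => (hpl (θ j)).le)
  have hlimφ : Tendsto (fun j => reflMap ℓ N τ (p (θ j)).1 (p (θ j)).2) atTop
      (nhds (reflMap ℓ N τ σ xb)) :=
    (h.continuousAt_reflMap hσpos hlb0).tendsto.comp hlimp
  rcases hlbσ.lt_or_eq with hlt1 | heq
  · have hφb := hmem σ hσ1 xb hxb hlt1
    have hle : u (reflMap ℓ N τ σ xb) ≤ u xb :=
      le_of_tendsto_of_tendsto ((huc _ (hΩcl hφb)).tendsto.comp hlimφ)
        ((huc _ hxb).tendsto.comp hlimx) (Eventually.of_forall fun j => (hpu (θ j)).le)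
    by_cases hbΩ : xb ∈ Ω
    · have := hvpos xb ⟨hbΩ, hlt1⟩
      simp only [hv] at this; linarith
    · have hfr : xb ∈ frontier Ω := by rw [hΩ.frontier_eq]; exact ⟨hxb, hbΩ⟩
      rw [h0 xb hfr] at hle
      linarith [hpos _ hφb]
  -- tangential case
  have hφxb : reflMap ℓ N τ σ xb = xb := by simp [reflMap, heq, h.shift_self σ hσpos]
  have hDle : fderiv ℝ u xb (N xb) ≤ 0 := by
    have hdiff : ∀ᶠ y in nhds xb, DifferentiableAt ℝ u y := eventually_differentiableAt (hu xb hxb)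
    obtain ⟨δ, hδ, hball'⟩ := Metric.eventually_nhds_iff_ball.1 hdiff
    have hmvt : ∀ᶠ j in atTop, ∃ y : Euc n, ‖y - (p (θ j)).2‖ ≤
        ‖reflMap ℓ N τ (p (θ j)).1 (p (θ j)).2 - (p (θ j)).2‖ ∧
        fderiv ℝ u y (N (p (θ j)).2) ≤ 0 := by
      rw [hφxb] at hlimφ
      filter_upwards [hlimφ.eventually (Metric.ball_mem_nhds xb hδ),
        hlimx.eventually (Metric.ball_mem_nhds xb hδ)] with j hj1 hj2
      set s := (p (θ j)).1
      set x := (p (θ j)).2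
      have hx0 : 0 < ℓ x := by linarith [hΩs x (hpΩ (θ j))]
      set T := τ s (ℓ x) with hT
      have hT0 : 0 < T := h.shift_pos s _ hx0 (hpl (θ j))
      have hφ : reflMap ℓ N τ s x = x + T • N x := rfl
      have hseg : ∀ t ∈ Set.Icc 0 T, x + t • N x ∈ Metric.ball xb δ := by
        intro t ht
        have hc := convex_ball xb δ hj2 hj1
          (show 0 ≤ 1 - t / T by rw [sub_nonneg, div_le_one hT0]; exact ht.2)
          (show 0 ≤ t / T from div_nonneg ht.1 hT0.le) (by ring)
        rw [hφ] at hc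
        convert hc using 1
        have : t = t / T * T := by field_simp
        conv_lhs => rw [this]
        module
      have hder : ∀ t ∈ Set.Icc 0 T, HasDerivAt (fun t : ℝ => u (x + t • N x))
          (fderiv ℝ u (x + t • N x) (N x)) t := by
        intro t ht
        have h1 : HasDerivAt (fun t : ℝ => x + t • N x) (N x) t := by
          simpa using ((hasDerivAt_id t).smul_const (N x)).const_add x
        exact (hball' _ (hseg t ht)).hasFDerivAt.comp_hasDerivAt t h1
      obtain ⟨t, ht, hteq⟩ := exists_deriv_eq_slope (fun t : ℝ => u (x + t • N x)) hT0
        (fun t ht => (hder t ht).continuousAt.continuousWithinAt)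
        (fun t ht => (hder t (Set.Ioo_subset_Icc_self ht)).differentiableAt.differentiableWithinAt)
      rw [(hder t (Set.Ioo_subset_Icc_self ht)).deriv] at hteq
      refine ⟨x + t • N x, ?_, ?_⟩
      · rw [hφ]
        simp only [add_sub_cancel_left, norm_smul, Real.norm_eq_abs, abs_of_pos ht.1,
          abs_of_pos hT0]
        gcongr
        exact ht.2.le
      · rw [hteq]
        refine div_nonpos_of_nonpos_of_nonneg ?_ (by linarith)
        have := hpu (θ j)
        change u (reflMap ℓ N τ s x) < u x at this
        rw [hφ] at this
        simp only [zero_smul, add_zero]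
        linarith
    obtain ⟨y, hy⟩ : ∃ y : ℕ → Euc n, ∀ᶠ j in atTop, ‖y j - (p (θ j)).2‖ ≤
        ‖reflMap ℓ N τ (p (θ j)).1 (p (θ j)).2 - (p (θ j)).2‖ ∧
        fderiv ℝ u (y j) (N (p (θ j)).2) ≤ 0 := by
      classical
      refine ⟨fun j => if hj : ∃ y : Euc n, ‖y - (p (θ j)).2‖ ≤
        ‖reflMap ℓ N τ (p (θ j)).1 (p (θ j)).2 - (p (θ j)).2‖ ∧
        fderiv ℝ u y (N (p (θ j)).2) ≤ 0 then hj.choose else 0, ?_⟩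
      filter_upwards [hmvt] with j hj
      rw [dif_pos hj]
      exact hj.choose_spec
    have hylim : Tendsto y atTop (nhds xb) := by
      have h1 : Tendsto (fun j => ‖reflMap ℓ N τ (p (θ j)).1 (p (θ j)).2 - (p (θ j)).2‖) atTop
          (nhds 0) := by
        have := (hlimφ.sub hlimx).norm
        rwa [hφxb, sub_self, norm_zero] at this
      have h2 : Tendsto (fun j => y j - (p (θ j)).2) atTop (nhds 0) :=
        squeeze_zero_norm' (hy.mono fun j hj => hj.1) h1
      have := h2.add hlimx
      simpa using this
    have hNlim : Tendsto (fun j => N (p (θ j)).2) atTop (nhds (N xb)) :=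
      (h.contDiffAt_normal xb hlb0).continuousAt.tendsto.comp hlimx
    have hfc : ContinuousAt (fderiv ℝ u) xb :=
      ((hu xb hxb).fderiv_right (m := 1) (by norm_num)).continuousAt
    have hfl : Tendsto (fun j => fderiv ℝ u (y j) (N (p (θ j)).2)) atTop
        (nhds (fderiv ℝ u xb (N xb))) :=
      (isBoundedBilinearMap_apply (𝕜 := ℝ) (E := Euc n) (F := ℝ)).continuous.tendsto
        (fderiv ℝ u xb, N xb) |>.comp ((hfc.tendsto.comp hylim).prodMk_nhds hNlim)
    exact le_of_tendsto hfl (hy.mono fun j hj => hj.2)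
  have hudiff : HasFDerivAt u (fderiv ℝ u xb) xb :=
    ((hu xb hxb).differentiableAt (by norm_num)).hasFDerivAt
  have hNb := h.norm_normal xb hlb0
  -- lower bounds on a one-sided derivative
  have hone : ∀ (F : ℝ → ℝ) (F' a b : ℝ), HasDerivAt F F' 0 → F 0 = 0 → 0 < a → 0 < b →
      (∀ t ∈ Set.Ioo 0 b, a * t ≤ F t) → 0 < F' := by
    intro F F' a b hF hF0 ha hb hle
    have hslope := hF.tendsto_slope_zero_right
    refine ha.trans_le (ge_of_tendsto hslope ?_)
    filter_upwards [Ioo_mem_nhdsGT hb] with t ht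
    have := hle t ht
    rw [zero_add, hF0, sub_zero, smul_eq_mul, inv_mul_eq_div, le_div_iff₀ ht.1]
    exact this
  by_cases hbΩ : xb ∈ Ω
  · -- interior tangential point
    obtain ⟨ε0, hε0, hεball⟩ := Metric.isOpen_iff.1 hΩ xb hbΩ
    set ε := min (ε0 / 4) (σ / 4) with hε
    have hεpos : 0 < ε := by positivity
    have hε1 : ε ≤ ε0 / 4 := min_le_left _ _
    have hε2 : ε ≤ σ / 4 := min_le_right _ _
    set c := xb - ε • N xb with hc
    have hlc : ℓ c = σ - ε := by
      have := h.level_add xb (-ε) hlb0 (by linarith)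
      rw [neg_smul, ← sub_eq_add_neg] at this
      rw [hc, this, heq]; ring
    have hsub : Metric.closedBall c ε ⊆ Ω := by
      intro y hy
      apply hεball
      have h1 : dist y c ≤ ε := hy
      have h2 : dist c xb = ε := by
        simp [hc, norm_smul, hNb, abs_of_pos hεpos]
      have := dist_triangle y c xb
      simp only [Metric.mem_ball]; linarith
    have hlball : ∀ y, ℓ y ≤ σ - ε + ‖y - c‖ := by
      intro y
      have := (abs_le.1 (h.lip y c)).2
      linarith
    have hbV : Metric.ball c ε ⊆ V := by
      intro y hy
      refine ⟨hsub (Metric.ball_subset_closedBall hy), ?_⟩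
      have h1 : ‖y - c‖ < ε := by simpa [dist_eq_norm] using hy
      have := hlball y
      simp only [Set.mem_ofPred_eq]; linarith
    have hclose : ∀ y ∈ Metric.closedBall c ε, reflMap ℓ N τ σ y ∈ Ω ∧ 0 ≤ v y := by
      intro y hy
      have h1 : ‖y - c‖ ≤ ε := by simpa [dist_eq_norm] using hy
      have h2 := hlball y
      rcases (show ℓ y ≤ σ by linarith).lt_or_eq with h3 | h3
      · exact ⟨hmem σ hσ1 y (hΩcl (hsub hy)) h3, hvnn y ⟨hsub hy, h3⟩⟩
      · have : reflMap ℓ N τ σ y = y := by simp [reflMap, h3, h.shift_self σ hσpos]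
        simp only [hv, this, sub_self, le_refl, and_true]
        exact hsub hy
    obtain ⟨κ, hκ, hlow⟩ := hopf_lemma hεpos (fun y hy => hvcd y (hbV hy))
      (fun y hy => ((huφ y (hΩcl (hsub hy)) (by linarith [hΩs y (hsub hy)])
        (hΩcl (hclose y hy).1)).sub (hu y (hΩcl (hsub hy)))).continuousAt.continuousWithinAt)
      (fun y hy => hvlap y (hbV hy)) (fun y hy => hvpos y (hbV hy)) (fun y hy => (hclose y hy).2)
    have hd1 : HasDerivAt (fun t : ℝ => xb + (τ σ (σ - t) - t) • N xb) ((2 - 1 : ℝ) • N xb) 0 :=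
      (((h.hasDerivAt_shift σ hσpos).sub (hasDerivAt_id 0)).smul_const (N xb)).const_add xb
    have hd2 : HasDerivAt (fun t : ℝ => xb + (-t) • N xb) ((-1 : ℝ) • N xb) 0 :=
      (((hasDerivAt_id (0 : ℝ)).neg).smul_const (N xb)).const_add xb
    have hp1 : xb + (τ σ (σ - 0) - 0) • N xb = xb := by simp [h.shift_self σ hσpos]
    have hp2 : xb + (-(0 : ℝ)) • N xb = xb := by simp
    have hF := (HasFDerivAt.comp_hasDerivAt (f := fun t : ℝ => xb + (τ σ (σ - t) - t) • N xb) 0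
      (by rw [hp1]; exact hudiff) hd1).sub
      (HasFDerivAt.comp_hasDerivAt (f := fun t : ℝ => xb + (-t) • N xb) 0
      (by rw [hp2]; exact hudiff) hd2)
    have := hone _ _ (κ * ε) ε hF (by simp [h.shift_self σ hσpos]) (by positivity) hεpos ?_
    · simp only [map_smul, smul_eq_mul] at this
      linarith
    · intro t ht
      have hlt' : ℓ (xb + (-t) • N xb) = σ - t := by
        rw [h.level_add xb (-t) hlb0 (by rw [heq]; linarith [ht.2]), heq]; ring
      have hnt : N (xb + (-t) • N xb) = N xb :=
        h.normal_add xb (-t) hlb0 (by rw [heq]; linarith [ht.2])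
      have hdc : ‖xb + (-t) • N xb - c‖ = ε - t := by
        have : xb + (-t) • N xb - c = (ε - t) • N xb := by simp only [hc]; module
        rw [this, norm_smul, hNb, Real.norm_eq_abs, abs_of_pos (by linarith [ht.2]), mul_one]
      have h1 := hlow (xb + (-t) • N xb) (by
        rw [Metric.mem_closedBall, dist_eq_norm, hdc]; linarith [ht.1])
      rw [hdc] at h1
      have h2 : v (xb + (-t) • N xb)
          = u (xb + (τ σ (σ - t) - t) • N xb) - u (xb + (-t) • N xb) := by
        simp only [hv, reflMap, hlt', hnt]
        congr 2
        module
      simp only [Pi.sub_apply, Function.comp]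
      rw [← h2]
      refine le_trans ?_ h1
      have h3 := ht.1
      have h4 := ht.2
      have : ε * t ≤ ε ^ 2 - (ε - t) ^ 2 := by nlinarith
      calc κ * ε * t = κ * (ε * t) := by ring
        _ ≤ _ := by gcongr
  · -- boundary tangential point
    have hfr : xb ∈ frontier Ω := by rw [hΩ.frontier_eq]; exact ⟨hxb, hbΩ⟩
    obtain ⟨ν, hν, hsub, hin⟩ := hball xb hfr (by rw [heq]; exact hσ1)
    set c := xb - R • ν with hc
    have hclsub : Metric.closedBall c R ⊆ closure Ω := by
      rw [← closure_ball c hR.ne']; exact closure_mono hsub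
    obtain ⟨κ, hκ, hlow⟩ := hopf_lemma hR (fun y hy => hu y (hΩcl (hsub hy)))
      (fun y hy => (huc y (hclsub hy)).continuousWithinAt) (fun y hy => hsup y (hsub hy))
      (fun y hy => hpos y (hsub hy)) (fun y hy => by
        by_cases hyΩ : y ∈ Ω
        · exact (hpos y hyΩ).le
        · rw [h0 y (by rw [hΩ.frontier_eq]; exact ⟨hclsub hy, hyΩ⟩)])
    have hd2 : HasDerivAt (fun t : ℝ => xb + t • N xb) ((1 : ℝ) • N xb) 0 :=
      ((hasDerivAt_id (0 : ℝ)).smul_const (N xb)).const_add xb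
    have hp2 : xb + (0 : ℝ) • N xb = xb := by simp
    have hF := HasFDerivAt.comp_hasDerivAt (f := fun t : ℝ => xb + t • N xb) 0
      (by rw [hp2]; exact hudiff) hd2
    have := hone _ _ (κ * (R / 2)) (R / 2) hF (by simp [h0 xb hfr]) (by positivity)
      (by positivity) ?_
    · simp only [one_smul] at this
      linarith
    · intro t ht
      have hsq : ‖xb + t • N xb - c‖ ^ 2 ≤ R ^ 2 - t * (R - t) := by
        have h1 : xb + t • N xb - c = t • N xb + R • ν := by simp only [hc]; abel
        rw [h1, norm_add_sq_real, norm_smul, norm_smul, hNb, hν, inner_smul_left,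
          inner_smul_right, real_inner_comm]
        simp only [Real.norm_eq_abs, mul_one, sq_abs, conj_trivial]
        have h2 : t * (R * inner ℝ ν (N xb)) ≤ t * (R * (-(1 / 2))) := by
          have := ht.1
          gcongr
        nlinarith
      have h3 := ht.1
      have h4 := ht.2
      have h1 := hlow (xb + t • N xb) (by
        rw [Metric.mem_closedBall, dist_eq_norm]
        refine le_of_sq_le_sq ?_ hR.le
        nlinarith)
      simp only [Function.comp]
      refine le_trans ?_ h1
      have : R / 2 * t ≤ R ^ 2 - ‖xb + t • N xb - c‖ ^ 2 := by nlinarith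
      calc κ * (R / 2) * t = κ * (R / 2 * t) := by ring
        _ ≤ _ := by gcongr

end MovingPlanes

section Reflections

variable {n : ℕ}

lemma planeFamily {e : Euc n} (he : ‖e‖ = 1) (x0 : Euc n) (R0 : ℝ) :
    ReflectionFamily (fun y => R0 + inner ℝ e (x0 - y)) (fun _ => -e) (fun s l => 2 * (s - l)) where
  norm_normal _ _ := by simpa using he
  lip x y := by
    have h1 : R0 + inner ℝ e (x0 - x) - (R0 + inner ℝ e (x0 - y)) = inner ℝ e (y - x) := by
      rw [add_sub_add_left_eq_sub, ← inner_sub_right]; congr 1; abel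
    rw [h1]
    have := abs_real_inner_le_norm e (y - x)
    rwa [he, one_mul, norm_sub_rev] at this
  level_add x t _ _ := by
    have : x0 - (x + t • -e) = (x0 - x) + t • e := by module
    rw [this, inner_add_right, inner_smul_right, real_inner_self_eq_norm_sq, he]; ring
  normal_add _ _ _ _ := rfl
  contDiffAt_level x _ := contDiffAt_const.add
    (contDiffAt_const.inner ℝ (contDiffAt_const.sub contDiffAt_id))
  contDiffAt_normal x _ := contDiffAt_const
  shift_self s _ := by ring
  shift_pos s l _ h := by linarith
  contDiffAt_shift s l _ _ := by fun_prop
  hasDerivAt_shift s _ := by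
    have h : (fun t : ℝ => 2 * (s - (s - t))) = fun t => 2 * t := by funext t; ring
    change HasDerivAt (fun t : ℝ => 2 * (s - (s - t))) 2 0
    rw [h]
    simpa using (hasDerivAt_id (0 : ℝ)).const_mul 2

lemma sphereFamily (z : Euc n) :
    ReflectionFamily (fun y => ‖y - z‖) (fun y => ‖y - z‖⁻¹ • (y - z)) (fun s l => s ^ 2 / l - l) where
  norm_normal x hx := by
    rw [norm_smul, norm_inv, norm_norm, inv_mul_cancel₀ hx.ne']
  lip x y := by
    have := abs_norm_sub_norm_le (x - z) (y - z)
    rwa [sub_sub_sub_cancel_right] at this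
  level_add x t hx ht := by
    have h1 : x + t • (‖x - z‖⁻¹ • (x - z)) - z = ((‖x - z‖ + t) * ‖x - z‖⁻¹) • (x - z) := by
      have : x - z = (‖x - z‖ * ‖x - z‖⁻¹) • (x - z) := by rw [mul_inv_cancel₀ hx.ne', one_smul]
      rw [add_mul, add_smul, ← this, smul_smul]; abel
    rw [h1, norm_smul, norm_mul, norm_inv, norm_norm, Real.norm_eq_abs, abs_of_pos ht, mul_assoc,
      inv_mul_cancel₀ hx.ne', mul_one]
  normal_add x t hx ht := by
    have h1 : x + t • (‖x - z‖⁻¹ • (x - z)) - z = ((‖x - z‖ + t) * ‖x - z‖⁻¹) • (x - z) := by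
      have : x - z = (‖x - z‖ * ‖x - z‖⁻¹) • (x - z) := by rw [mul_inv_cancel₀ hx.ne', one_smul]
      rw [add_mul, add_smul, ← this, smul_smul]; abel
    have h2 : ‖x + t • (‖x - z‖⁻¹ • (x - z)) - z‖ = ‖x - z‖ + t := by
      rw [h1, norm_smul, norm_mul, norm_inv, norm_norm, Real.norm_eq_abs, abs_of_pos ht, mul_assoc,
        inv_mul_cancel₀ hx.ne', mul_one]
    simp only [h2]
    rw [h1, smul_smul, inv_mul_cancel_left₀ ht.ne']
  contDiffAt_level x hx := by
    have : x - z ≠ 0 := norm_pos_iff.1 hx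
    exact (contDiffAt_id.sub contDiffAt_const).norm ℝ this
  contDiffAt_normal x hx := by
    have : x - z ≠ 0 := norm_pos_iff.1 hx
    have h1 : ContDiffAt ℝ 2 (fun y => ‖y - z‖) x := (contDiffAt_id.sub contDiffAt_const).norm ℝ this
    exact (h1.inv hx.ne').smul (contDiffAt_id.sub contDiffAt_const)
  shift_self s hs := by field_simp; ring
  shift_pos s l hl h := by
    rw [sub_pos, lt_div_iff₀ hl]; nlinarith
  contDiffAt_shift s l _ hl := by
    have h2 : ContDiffAt ℝ 2 (fun p : ℝ × ℝ => p.2) (s, l) := contDiffAt_snd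
    have h1 : ContDiffAt ℝ 2 (fun p : ℝ × ℝ => p.1) (s, l) := contDiffAt_fst
    exact ((h1.pow 2).div h2 hl.ne').sub h2
  hasDerivAt_shift s hs := by
    have h1 : HasDerivAt (fun t : ℝ => s - t) (-1) 0 := by
      simpa using (hasDerivAt_id (0 : ℝ)).const_sub s
    have h2 := ((h1.inv (by simpa using hs.ne')).const_mul (s ^ 2)).sub h1
    have h3 : s ^ 2 * (-(-1) / (s - 0) ^ 2) - -1 = 2 := by
      rw [sub_zero]; field_simp; norm_num
    rw [h3] at h2
    exact h2

lemma lapl_comp_plane {u : Euc n → ℝ} {e : Euc n} (he : ‖e‖ = 1) (x0 : Euc n) (R0 s : ℝ) {x : Euc n}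
    (hu : ContDiffAt ℝ 2 u (reflMap (fun y => R0 + inner ℝ e (x0 - y)) (fun _ => -e)
      (fun s l => 2 * (s - l)) s x)) :
    lapl (fun y => u (reflMap (fun y => R0 + inner ℝ e (x0 - y)) (fun _ => -e)
      (fun s l => 2 * (s - l)) s y)) x
    = lapl u (reflMap (fun y => R0 + inner ℝ e (x0 - y)) (fun _ => -e)
      (fun s l => 2 * (s - l)) s x) := by
  set φ := reflMap (fun y => R0 + inner ℝ e (x0 - y)) (fun _ => -e) (fun s l => 2 * (s - l)) s with hφ
  have hcomp : ∀ j, (fun y => φ y j)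
      = fun y => (∑ i, (-2 * e j * e i) * y i) + y j + -2 * e j * (s - R0 - inner ℝ e x0) := by
    intro j
    funext y
    have : inner ℝ e (x0 - y) = inner ℝ e x0 - ∑ i, e i * y i := by
      rw [inner_sub_right]
      congr 1
      simp [PiLp.inner_apply, mul_comm]
    simp only [hφ, reflMap, this, PiLp.add_apply, PiLp.smul_apply, PiLp.neg_apply, smul_eq_mul]
    simp only [mul_assoc, ← Finset.mul_sum]
    ring
  have hpd : ∀ i j, ∀ y, pd i (fun y => φ y j) y = (if i = j then 1 else 0) - 2 * e i * e j := by
    intro i j y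
    rw [hcomp j, pd_add (by fun_prop) (by fun_prop), pd_const, pd_add (by fun_prop) (by fun_prop),
      pd_coord, pd_sum _ (fun k _ => by fun_prop)]
    have : ∀ k ∈ Finset.univ, pd i (fun y : Euc n => -2 * e j * e k * y k) y
        = if i = k then -2 * e j * e k else 0 := by
      intro k _
      rw [pd_const_mul (by fun_prop), pd_coord]; simp
    rw [Finset.sum_congr rfl this]
    simp
    ring
  have hsum : ∑ i, e i * e i = 1 := by
    have := EuclideanSpace.real_norm_sq_eq e
    rw [he] at this
    simp only [← sq]; linarith
  have hμ := lapl_comp_conformal (φ := φ) (μ := 1) hu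
    (contDiffAt_id.add ((contDiffAt_const.mul (contDiffAt_const.sub
      (contDiffAt_const.add (contDiffAt_const.inner ℝ (contDiffAt_const.sub contDiffAt_id))))).smul
      contDiffAt_const)) (by
      intro j k
      simp only [hpd]
      have : ∀ i, ((if i = j then (1 : ℝ) else 0) - 2 * e i * e j)
          * ((if i = k then 1 else 0) - 2 * e i * e k)
          = (if i = j then (if i = k then 1 else 0) else 0) - (if i = j then 2 * e i * e k else 0)
            - (if i = k then 2 * e i * e j else 0) + 4 * e j * e k * (e i * e i) := by
        intro i
        split_ifs <;> ring
      simp only [this, Finset.sum_add_distrib, Finset.sum_sub_distrib, ← Finset.mul_sum, hsum]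
      simp
      ring) (by
      intro j
      rw [lapl_eq_sum_pd]
      refine Finset.sum_eq_zero fun i _ => ?_
      have : pd i (fun y => φ y j) = fun _ => (if i = j then 1 else 0) - 2 * e i * e j :=
        funext fun y => hpd i j y
      rw [this, pd_const])
  rw [hμ, one_mul]

lemma reflMap_sphere_apply (z : Euc n) (s : ℝ) {y : Euc n} (hy : y ≠ z) (j : Fin n) :
    reflMap (fun y => ‖y - z‖) (fun y => ‖y - z‖⁻¹ • (y - z)) (fun s l => s ^ 2 / l - l) s y j
      = z j + s ^ 2 * ((y j - z j) * (‖y - z‖ ^ 2)⁻¹) := by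
  have : ‖y - z‖ ≠ 0 := norm_ne_zero_iff.2 (sub_ne_zero.2 hy)
  simp only [reflMap, PiLp.add_apply, PiLp.smul_apply, PiLp.sub_apply, smul_eq_mul]
  field_simp
  ring

lemma lapl_comp_sphere {u : Euc n → ℝ} (hn : n = 2) (z : Euc n) {s : ℝ} (hs : 0 < s) {x : Euc n}
    (hx : x ≠ z)
    (hu : ContDiffAt ℝ 2 u (reflMap (fun y => ‖y - z‖) (fun y => ‖y - z‖⁻¹ • (y - z))
      (fun s l => s ^ 2 / l - l) s x)) :
    lapl (fun y => u (reflMap (fun y => ‖y - z‖) (fun y => ‖y - z‖⁻¹ • (y - z))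
      (fun s l => s ^ 2 / l - l) s y)) x
    = (s ^ 2 / ‖x - z‖ ^ 2) ^ 2 * lapl u (reflMap (fun y => ‖y - z‖)
      (fun y => ‖y - z‖⁻¹ • (y - z)) (fun s l => s ^ 2 / l - l) s x) := by
  set φ := reflMap (fun y => ‖y - z‖) (fun y => ‖y - z‖⁻¹ • (y - z))
    (fun s l => s ^ 2 / l - l) s with hφ
  have hq : ∀ y, y ≠ z → ‖y - z‖ ^ 2 ≠ 0 := fun y hy =>
    pow_ne_zero 2 (norm_ne_zero_iff.2 (sub_ne_zero.2 hy))
  have hqd : ∀ y : Euc n, DifferentiableAt ℝ (fun y : Euc n => ‖y - z‖ ^ 2) y := fun y =>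
    (contDiff_norm_sub_sq (n := n) z (m := 1)).differentiable (by norm_num) y
  have hnear : ∀ y, y ≠ z → ∀ᶠ w in nhds y, w ≠ z := fun y hy => isOpen_ne.mem_nhds hy
  have hinv : ∀ (m : ℕ) i y, y ≠ z → pd i (fun y : Euc n => ((‖y - z‖ ^ 2) ^ (m + 1))⁻¹) y
      = -(m + 1) * ((‖y - z‖ ^ 2) ^ (m + 2))⁻¹ * (2 * (y i - z i)) := by
    intro m i y hy
    have hF : HasDerivAt (fun t : ℝ => (t ^ (m + 1))⁻¹)
        (-(m + 1) * ((‖y - z‖ ^ 2) ^ (m + 2))⁻¹) (‖y - z‖ ^ 2) := by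
      have := (hasDerivAt_pow (m + 1) (‖y - z‖ ^ 2)).inv (pow_ne_zero _ (hq y hy))
      have key : ∀ q : ℝ, q ≠ 0 → -(((m + 1 : ℕ) : ℝ) * q ^ (m + 1 - 1)) / (q ^ (m + 1)) ^ 2
          = -(m + 1) * (q ^ (m + 2))⁻¹ := by
        intro q hq0
        rw [Nat.add_sub_cancel, neg_mul, neg_div, ← pow_mul, neg_inj,
          div_eq_iff (pow_ne_zero _ hq0), mul_assoc, show (m + 1) * 2 = (m + 2) + m by ring, pow_add q (m + 2),
          inv_mul_cancel_left₀ (pow_ne_zero _ hq0)]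
        push_cast
        rfl
      exact this.congr_deriv (key _ (hq y hy))
    rw [pd_comp hF (hqd y), pd_norm_sub_sq]
  have hinvd : ∀ (m : ℕ) y, y ≠ z →
      DifferentiableAt ℝ (fun y : Euc n => ((‖y - z‖ ^ 2) ^ (m + 1))⁻¹) y := fun m y hy =>
    ((hqd y).pow _).inv (pow_ne_zero _ (hq y hy))
  have hcomp : ∀ j y, y ≠ z → (fun y => φ y j) =ᶠ[nhds y]
      fun y => z j + s ^ 2 * ((y j - z j) * ((‖y - z‖ ^ 2) ^ (0 + 1))⁻¹) := by
    intro j y hy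
    filter_upwards [hnear y hy] with w hw
    rw [reflMap_sphere_apply z s hw j]
    simp
  have hpd : ∀ i j y, y ≠ z → pd i (fun y => φ y j) y
      = s ^ 2 * ((if i = j then 1 else 0) * ((‖y - z‖ ^ 2) ^ (0 + 1))⁻¹
        + (y j - z j) * (-2 * (y i - z i) * ((‖y - z‖ ^ 2) ^ (1 + 1))⁻¹)) := by
    intro i j y hy
    have h0 := hinvd 0 y hy
    rw [pd_congr (hcomp j y hy), pd_add (by fun_prop) (by fun_prop), pd_const,
      pd_const_mul (by fun_prop), pd_mul (by fun_prop) h0, hinv 0 i y hy, pd_coord_sub]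
    push_cast
    ring
  have hlap : ∀ j, lapl (fun y => φ y j) x = 0 := by
    intro j
    rw [lapl_eq_sum_pd]
    have h1 : ∀ i ∈ Finset.univ, pd i (pd i (fun y => φ y j)) x
        = s ^ 2 * ((if i = j then -4 * (x j - z j) * ((‖x - z‖ ^ 2) ^ 2)⁻¹ else 0)
          + (-2 * (x j - z j) * ((‖x - z‖ ^ 2) ^ 2)⁻¹)
          + 8 * (x j - z j) * ((‖x - z‖ ^ 2) ^ 3)⁻¹ * (x i - z i) ^ 2) := by
      intro i _
      have he : pd i (fun y => φ y j) =ᶠ[nhds x] fun y =>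
          s ^ 2 * ((if i = j then 1 else 0) * ((‖y - z‖ ^ 2) ^ (0 + 1))⁻¹
        + (y j - z j) * (-2 * (y i - z i) * ((‖y - z‖ ^ 2) ^ (1 + 1))⁻¹)) := by
        filter_upwards [hnear x hx] with y hy using hpd i j y hy
      have h0 := hinvd 0 x hx
      have h1 := hinvd 1 x hx
      rw [pd_congr he, pd_const_mul (by fun_prop), pd_add (by fun_prop) (by fun_prop),
        pd_const_mul h0, hinv 0 i x hx, pd_mul (by fun_prop) (by fun_prop), pd_coord_sub,
        pd_mul (by fun_prop) h1, hinv 1 i x hx, pd_const_mul (by fun_prop), pd_coord_sub]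
      simp only [if_true]
      split_ifs with h
      · subst h; push_cast; ring
      · push_cast; ring
    have h8 : ∑ i, 8 * (x j - z j) * ((‖x - z‖ ^ 2) ^ 3)⁻¹ * (x i - z i) ^ 2
        = 8 * (x j - z j) * ((‖x - z‖ ^ 2) ^ 3)⁻¹ * ‖x - z‖ ^ 2 := by
      rw [← Finset.mul_sum, ← norm_sub_sq_eq_sum]
    rw [Finset.sum_congr rfl h1, ← Finset.mul_sum, Finset.sum_add_distrib, Finset.sum_add_distrib,
      h8]
    have := hq x hx
    simp only [Finset.sum_ite_eq', Finset.mem_univ, if_true, Finset.sum_const, Finset.card_univ,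
      Fintype.card_fin, nsmul_eq_mul, hn]
    field_simp
    push_cast
    ring
  have hxz : 0 < ‖x - z‖ := norm_pos_iff.2 (sub_ne_zero.2 hx)
  refine lapl_comp_conformal hu ((sphereFamily z).contDiffAt_reflMap hs hxz) ?_ hlap
  intro j k
  simp only [hpd _ _ x hx]
  have : ∀ i, s ^ 2 * ((if i = j then 1 else 0) * ((‖x - z‖ ^ 2) ^ (0 + 1))⁻¹
        + (x j - z j) * (-2 * (x i - z i) * ((‖x - z‖ ^ 2) ^ (1 + 1))⁻¹)) *
      (s ^ 2 * ((if i = k then 1 else 0) * ((‖x - z‖ ^ 2) ^ (0 + 1))⁻¹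
        + (x k - z k) * (-2 * (x i - z i) * ((‖x - z‖ ^ 2) ^ (1 + 1))⁻¹)))
      = s ^ 4 * ((if i = j then (if i = k then ((‖x - z‖ ^ 2) ^ 2)⁻¹ else 0) else 0)
        + (if i = j then -2 * (x k - z k) * (x i - z i) * ((‖x - z‖ ^ 2) ^ 3)⁻¹ else 0)
        + (if i = k then -2 * (x j - z j) * (x i - z i) * ((‖x - z‖ ^ 2) ^ 3)⁻¹ else 0)
        + 4 * (x j - z j) * (x k - z k) * ((‖x - z‖ ^ 2) ^ 4)⁻¹ * (x i - z i) ^ 2) := by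
    intro i
    have := hq x hx
    split_ifs <;> field_simp <;> ring
  rw [Finset.sum_congr rfl fun i _ => this i, ← Finset.mul_sum, Finset.sum_add_distrib,
    Finset.sum_add_distrib, Finset.sum_add_distrib, ← Finset.mul_sum, ← norm_sub_sq_eq_sum]
  have := hq x hx
  simp only [Finset.sum_ite_eq', Finset.mem_univ, if_true]
  split_ifs <;> field_simp <;> ring

end Reflections

section DomainGeometry

variable {n : ℕ}

/-- A ball of radius `R` touches the set from inside and another one from outside at `q`, with
outward unit normal `ν`. -/
def TouchingBalls (Ω : Set (Euc n)) (R : ℝ) (q ν : Euc n) : Prop :=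
  ‖ν‖ = 1 ∧ Metric.ball (q - R • ν) R ⊆ Ω ∧ Disjoint (Metric.ball (q + R • ν) R) Ω

lemma inner_lt_of_mem_ball {q ν y : Euc n} {R : ℝ} (hR : 0 < R) (hν : ‖ν‖ = 1)
    (hy : y ∈ Metric.ball (q + R • ν) R) :
    ‖y - q‖ ^ 2 < 2 * R * inner ℝ ν (y - q) ∧ ‖y - q‖ < 2 * R := by
  have h1 : ‖y - q - R • ν‖ < R := by
    have : y - q - R • ν = y - (q + R • ν) := by abel
    rw [this]; simpa [dist_eq_norm] using hy
  constructor
  · have h2 : ‖y - q - R • ν‖ ^ 2 < R ^ 2 := by gcongr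
    rw [norm_sub_sq_real, inner_smul_right, norm_smul, hν, real_inner_comm] at h2
    simp only [Real.norm_eq_abs, mul_one, sq_abs] at h2
    linarith
  · have h3 : ‖R • ν‖ = R := by rw [norm_smul, hν, Real.norm_eq_abs, abs_of_pos hR, mul_one]
    have := norm_add_le (y - q - R • ν) (R • ν)
    rw [sub_add_cancel] at this
    linarith

lemma exists_bound_norm_fderiv {E F : Type*} [NormedAddCommGroup E] [NormedSpace ℝ E]
    [NormedAddCommGroup F] [NormedSpace ℝ F] {f : E → F} (hf : ContDiff ℝ 1 f) {s : Set E}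
    (hs : IsCompact s) : ∃ K : ℝ, ∀ w ∈ s, ‖fderiv ℝ f w‖ ≤ K :=
  hs.exists_bound_of_continuousOn (hf.continuous_fderiv (by norm_num)).continuousOn

/-- Uniform interior and exterior ball condition for smooth bounded domains. -/
lemma IsSmoothBoundedDomain.exists_touchingBalls {Ω : Set (Euc n)}
    (hΩ : IsSmoothBoundedDomain Ω) :
    ∃ R > 0, ∀ q ∈ frontier Ω, ∃ ν, TouchingBalls Ω R q ν := by
  obtain ⟨-, hbd, -, ρ, hρ, hΩρ, hfr, hgrad⟩ := hΩ
  obtain ⟨L, hL, hLs⟩ := hbd.closure.subset_closedBall_lt 0 0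
  have hρ2 : ContDiff ℝ 2 ρ := contDiff_infty.1 hρ 2
  have hD1 : ContDiff ℝ 1 (fderiv ℝ ρ) := hρ2.fderiv_right (by norm_num)
  obtain ⟨K0, hK0⟩ := exists_bound_norm_fderiv hD1 (isCompact_closedBall (0 : Euc n) (L + 1))
  set K := max K0 1 with hK
  have hK1 : 1 ≤ K := le_max_right _ _
  have hcompact : IsCompact (frontier Ω) :=
    hbd.isCompact_closure.of_isClosed_subset isClosed_frontier frontier_subset_closure
  have hmin : ∃ m > 0, ∀ q ∈ frontier Ω, m ≤ ‖gradient ρ q‖ := by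
    by_cases hne : (frontier Ω).Nonempty
    · have hgc : Continuous (fun q => ‖gradient ρ q‖) := by
        have : ∀ q, ‖gradient ρ q‖ = ‖fderiv ℝ ρ q‖ := fun q => by
          rw [gradient, LinearIsometryEquiv.norm_map]
        simp only [this]
        exact hD1.continuous.norm
      obtain ⟨q0, hq0, hmin⟩ := hcompact.exists_isMinOn hne hgc.continuousOn
      exact ⟨_, norm_pos_iff.2 (hgrad q0 hq0), fun q hq => hmin hq⟩
    · exact ⟨1, one_pos, fun q hq => absurd ⟨q, hq⟩ hne⟩
  obtain ⟨m, hm, hmle⟩ := hmin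
  set R := min (1 / 2) (m / (2 * K)) with hR
  have hR0 : 0 < R := by positivity
  have hR1 : 2 * R ≤ 1 := by linarith [min_le_left (1 / 2) (m / (2 * K))]
  have hR2 : K * (2 * R) ≤ m := by
    have h1 := min_le_right (1 / 2) (m / (2 * K))
    have h2 : R * (2 * K) ≤ m := by rw [← le_div_iff₀ (by positivity)]; exact h1
    linarith
  have htaylor : ∀ q ∈ frontier Ω, ∀ y, ‖y - q‖ ≤ 1 →
      |ρ y - inner ℝ (gradient ρ q) (y - q)| ≤ K * ‖y - q‖ ^ 2 := by
    intro q hq y hy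
    have hqL : ‖q‖ ≤ L := by simpa using hLs (frontier_subset_closure hq)
    have hsub : Metric.closedBall q ‖y - q‖ ⊆ Metric.closedBall 0 (L + 1) := by
      intro z hz
      have h1 : ‖z - q‖ ≤ ‖y - q‖ := by simpa [dist_eq_norm] using hz
      have := norm_add_le (z - q) q
      rw [sub_add_cancel] at this
      simp only [mem_closedBall_zero_iff]; linarith
    have hconv : Convex ℝ (Metric.closedBall q ‖y - q‖) := convex_closedBall _ _
    have hqm : q ∈ Metric.closedBall q ‖y - q‖ := Metric.mem_closedBall_self (norm_nonneg _)
    have hfl : ∀ z ∈ Metric.closedBall q ‖y - q‖, ‖fderiv ℝ ρ z - fderiv ℝ ρ q‖ ≤ K * ‖y - q‖ := by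
      intro z hz
      have h1 := hconv.norm_image_sub_le_of_norm_fderiv_le (f := fderiv ℝ ρ) (𝕜 := ℝ) (C := K)
        (fun w _ => hD1.differentiable (by norm_num) w)
        (fun w hw => (hK0 w (hsub hw)).trans (le_max_left _ _)) hqm hz
      have h2 : ‖z - q‖ ≤ ‖y - q‖ := by simpa [dist_eq_norm] using hz
      exact h1.trans (by gcongr)
    have h3 := hconv.norm_image_sub_le_of_norm_fderiv_le' (f := ρ) (𝕜 := ℝ) (C := K * ‖y - q‖)
      (fun w _ => hρ2.differentiable (by norm_num) w) hfl hqm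
      (show y ∈ Metric.closedBall q ‖y - q‖ by simp [dist_eq_norm])
    have h4 : ρ q = 0 := by rw [hfr] at hq; exact hq
    rw [h4, sub_zero, ← inner_gradient_left, Real.norm_eq_abs] at h3
    linarith [h3, show K * ‖y - q‖ ^ 2 = K * ‖y - q‖ * ‖y - q‖ by ring]
  refine ⟨R, hR0, fun q hq => ?_⟩
  have hg0 : 0 < ‖gradient ρ q‖ := hm.trans_le (hmle q hq)
  set ν := ‖gradient ρ q‖⁻¹ • gradient ρ q with hν
  have hν1 : ‖ν‖ = 1 := by rw [hν, norm_smul, norm_inv, norm_norm, inv_mul_cancel₀ hg0.ne']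
  have hgν : gradient ρ q = ‖gradient ρ q‖ • ν := by
    rw [hν, smul_smul, mul_inv_cancel₀ hg0.ne', one_smul]
  have hmain : ∀ y, ‖y - q‖ < 2 * R → ∀ σ : ℝ, ‖y - q‖ ^ 2 < 2 * R * (σ * inner ℝ ν (y - q)) →
      K * ‖y - q‖ ^ 2 < σ * inner ℝ (gradient ρ q) (y - q) := by
    intro y hy σ hlt
    rw [hgν, inner_smul_left]
    simp only [conj_trivial]
    set a := σ * inner ℝ ν (y - q)
    have ha : 0 < a := by
      by_contra hc
      push Not at hc
      nlinarith [sq_nonneg ‖y - q‖]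
    calc K * ‖y - q‖ ^ 2 < K * (2 * R * a) := by gcongr
      _ = K * (2 * R) * a := by ring
      _ ≤ ‖gradient ρ q‖ * a := by
        have := hmle q hq
        gcongr; linarith
      _ = _ := by simp only [a]; ring
  refine ⟨ν, hν1, fun y hy => ?_, Set.disjoint_left.2 fun y hy hyΩ => ?_⟩
  · have hy' : y ∈ Metric.ball (q + R • (-ν)) R := by rwa [smul_neg, ← sub_eq_add_neg]
    obtain ⟨h1, h2⟩ := inner_lt_of_mem_ball hR0 (by rwa [norm_neg]) hy'
    have h3 := hmain y h2 (-1) (by simpa [inner_neg_left] using h1)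
    have h4 := (abs_le.1 (htaylor q hq y (by linarith))).2
    rw [hΩρ]
    simp only [Set.mem_ofPred_eq]
    linarith
  · obtain ⟨h1, h2⟩ := inner_lt_of_mem_ball hR0 hν1 hy
    have h3 := hmain y h2 1 (by simpa using h1)
    have h4 := (abs_le.1 (htaylor q hq y (by linarith))).1
    rw [hΩρ] at hyΩ
    simp only [Set.mem_ofPred_eq] at hyΩ
    linarith

lemma inner_nonpos_of_convex {Ω : Set (Euc n)} (hconv : Convex ℝ Ω) (hopen : IsOpen Ω) {R : ℝ}
    (hR : 0 < R) {q ν y : Euc n} (hq : q ∈ frontier Ω) (h : TouchingBalls Ω R q ν) (hy : y ∈ Ω) :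
    inner ℝ ν (y - q) ≤ 0 := by
  by_contra hcon
  push Not at hcon
  obtain ⟨hν, hsub, -⟩ := h
  set a := inner ℝ ν (y - q) with ha
  set ε := R * a / (‖y - q‖ ^ 2 + 1) with hε
  have hε0 : 0 < ε := by positivity
  have hmem : q - ε • (y - q) ∈ Ω := by
    apply hsub
    rw [Metric.mem_ball, dist_eq_norm]
    have h1 : q - ε • (y - q) - (q - R • ν) = R • ν - ε • (y - q) := by abel
    rw [h1]
    refine lt_of_pow_lt_pow_left₀ 2 hR.le ?_
    rw [norm_sub_sq_real, inner_smul_left, inner_smul_right, norm_smul, norm_smul, hν, ← ha]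
    simp only [Real.norm_eq_abs, mul_one, sq_abs, conj_trivial, mul_pow]
    have h2 : ε * ‖y - q‖ ^ 2 ≤ R * a := by
      have h3 : ε * (‖y - q‖ ^ 2 + 1) = R * a := by rw [hε]; field_simp
      nlinarith
    have h4 : ε ^ 2 * ‖y - q‖ ^ 2 ≤ ε * (R * a) := by
      rw [sq, mul_assoc]; gcongr
    have h5 : 0 < ε * (R * a) := by positivity
    nlinarith
  have hqΩ : q ∈ Ω := by
    have h1 := hconv hmem hy (show 0 ≤ 1 / (1 + ε) by positivity)
      (show 0 ≤ ε / (1 + ε) by positivity) (by field_simp)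
    convert h1 using 1
    have h2 : (1 / (1 + ε)) • (q - ε • (y - q)) + (ε / (1 + ε)) • y
      = (1 / (1 + ε) * (1 + ε)) • q + (ε / (1 + ε) - 1 / (1 + ε) * ε) • y := by module
    rw [h2, one_div, inv_mul_cancel₀ (by positivity), inv_mul_eq_div, sub_self]
    simp
  rw [hopen.frontier_eq] at hq
  exact hq.2 hqΩ

end DomainGeometry

section CapLemma

variable {n : ℕ}

/-- A positive `C²` solution of `-Δu = f(u)` with zero boundary values on a bounded open set, with
`f` nondecreasing and nonnegative on the positive axis. -/
structure PositiveSolution (Ω : Set (Euc n)) (f : ℝ → ℝ) (u : Euc n → ℝ) : Prop where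
  isOpen : IsOpen Ω
  isBounded : Bornology.IsBounded Ω
  contDiffAt : ∀ x ∈ closure Ω, ContDiffAt ℝ 2 u x
  eq_zero : ∀ x ∈ frontier Ω, u x = 0
  pos : ∀ x ∈ Ω, 0 < u x
  equation : ∀ x ∈ Ω, lapl u x + f (u x) = 0
  mono : Monotone f
  nonneg : ∀ s, 0 ≤ s → 0 ≤ f s

lemma PositiveSolution.lapl_nonpos {Ω : Set (Euc n)} {f : ℝ → ℝ} {u : Euc n → ℝ}
    (hu : PositiveSolution Ω f u) : ∀ x ∈ Ω, lapl u x ≤ 0 := fun x hx => by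
  linarith [hu.equation x hx, hu.nonneg _ (hu.pos x hx).le]

/-- Moving planes: a positive solution in a convex domain increases away from the boundary. -/
lemma PositiveSolution.le_sub_smul_of_convex {Ω : Set (Euc n)} {f : ℝ → ℝ} {u : Euc n → ℝ}
    (hu : PositiveSolution Ω f u) (hconv : Convex ℝ Ω) {R D d η T : ℝ} (hR : 0 < R)
    (hD : ∀ x ∈ Ω, ∀ y ∈ Ω, ‖y - x‖ ≤ D) (hball : ∀ q ∈ frontier Ω, ∃ ν, TouchingBalls Ω R q ν)
    {x q ν e : Euc n} (hx : x ∈ Ω) (hq : q ∈ frontier Ω) (hν : TouchingBalls Ω R q ν)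
    (hxq : ‖x - q‖ ≤ d) (he : ‖e‖ = 1) (heν : ‖e - ν‖ ≤ η) (hT : 0 < T)
    (hh : d + D * η + T / 2 ≤ R / 8) : x - T • e ∈ Ω ∧ u x ≤ u (x - T • e) := by
  have hD0 : 0 ≤ D := (norm_nonneg _).trans (hD x hx x hx)
  have hd0 : 0 ≤ d := (norm_nonneg _).trans hxq
  have hη0 : 0 ≤ η := (norm_nonneg _).trans heν
  have hDη : 0 ≤ D * η := mul_nonneg hD0 hη0
  set R0 : ℝ := d + D * η + 1 with hR0
  have hlow : ∀ y ∈ Ω, (1 : ℝ) ≤ R0 + inner ℝ e (x - y) := by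
    intro y hy
    have h1 := inner_nonpos_of_convex hconv hu.isOpen hR hq hν hy
    have h2 : inner ℝ ν (q - x) ≤ d := by
      have := real_inner_le_norm ν (q - x)
      rw [hν.1, one_mul, norm_sub_rev] at this
      linarith
    have h3 : inner ℝ (e - ν) (y - x) ≤ D * η := by
      have := real_inner_le_norm (e - ν) (y - x)
      have h4 : ‖e - ν‖ * ‖y - x‖ ≤ η * D := by
        have := hD x hx y hy
        gcongr
      linarith
    have h5 : inner ℝ e (x - y) = - (inner ℝ ν (y - q) + inner ℝ ν (q - x) + inner ℝ (e - ν) (y - x)) := by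
      simp only [inner_sub_left, inner_sub_right]; ring
    linarith
  have hcont := (planeFamily he x R0).continuous_level
  have hmm := (planeFamily he x R0).moving_method hu.isOpen hu.isBounded hu.contDiffAt hu.eq_zero
    hu.pos hu.lapl_nonpos (s0 := 1) (s1 := R0 + T / 2) (R := R) one_pos hR hlow ?_ ?_ ?_
    (R0 + T / 2) le_rfl x hx (by simp; linarith)
  · have : reflMap (fun y => R0 + inner ℝ e (x - y)) (fun _ => -e) (fun s l => 2 * (s - l))
        (R0 + T / 2) x = x - T • e := by
      simp only [reflMap, sub_self, inner_zero_right, add_zero, add_sub_cancel_left, smul_neg]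
      rw [mul_div_cancel₀ _ (two_ne_zero), sub_eq_add_neg]
    rwa [this] at hmm
  · intro q' hq' hl
    obtain ⟨ν', hν'⟩ := hball q' hq'
    refine ⟨ν', hν'.1, hν'.2.1, ?_⟩
    have hmem : q' - R • ν' + (3 * R / 4) • e ∈ Ω := by
      apply hν'.2.1
      rw [Metric.mem_ball, dist_eq_norm, add_sub_cancel_left, norm_smul, he, Real.norm_eq_abs,
        abs_of_pos (by positivity)]
      linarith
    have h1 := hlow _ hmem
    have h2 : inner ℝ e (x - (q' - R • ν' + (3 * R / 4) • e))
        = inner ℝ e (x - q') + R * inner ℝ ν' e - 3 * R / 4 := by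
      simp only [inner_sub_right, inner_add_right, inner_smul_right, real_inner_self_eq_norm_sq, he,
        real_inner_comm e ν']
      ring
    rw [inner_neg_right]
    have h3 : R * (1 / 2) ≤ R * inner ℝ ν' e := by linarith
    have := le_of_mul_le_mul_left h3 hR
    linarith
  · intro l s hl hls hs
    linarith
  · intro s hs y hy hys hmem hle
    rw [lapl_comp_plane he x R0 s (hu.contDiffAt _ (subset_closure hmem))]
    have h1 := hu.equation _ hmem
    have h2 := hu.equation y hy
    have h3 := hu.mono hle
    linarith

/-- Moving spheres: a positive solution in a planar domain increases away from the boundary. -/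
lemma PositiveSolution.le_sub_smul_of_planar {Ω : Set (Euc n)} {f : ℝ → ℝ} {u : Euc n → ℝ}
    (hu : PositiveSolution Ω f u) (hn : n = 2) {R D d η T : ℝ} (hR : 0 < R) (hRD : R ≤ D)
    (hball : ∀ q ∈ frontier Ω, ∃ ν, TouchingBalls Ω R q ν)
    {x q ν e : Euc n} (hx : x ∈ Ω) (hν : TouchingBalls Ω R q ν)
    (hxq : ‖x - q‖ ≤ d) (he : ‖e‖ = 1) (heν : ‖e - ν‖ ≤ η) (hT : 0 < T)
    (hh : d + D * η + T / 2 ≤ R / 8) : x - T • e ∈ Ω ∧ u x ≤ u (x - T • e) := by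
  have hd0 : 0 ≤ d := (norm_nonneg _).trans hxq
  have hη0 : 0 ≤ η := (norm_nonneg _).trans heν
  have hRη : R * η ≤ D * η := by gcongr
  have hRη0 : 0 ≤ R * η := by positivity
  set z : Euc n := x + R • e with hz
  set s0 : ℝ := R - (d + R * η) with hs0
  set h : ℝ := d + D * η + T / 2 with hhdef
  have hs0R : 7 * R / 8 ≤ s0 := by linarith
  have hs0pos : 0 < s0 := by linarith
  have hh0 : 0 ≤ h := by linarith
  have hxz : ‖x - z‖ = R := by
    rw [hz, sub_add_cancel_left, norm_neg, norm_smul, he, Real.norm_eq_abs, abs_of_pos hR, mul_one]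
  have hlow : ∀ y ∈ Ω, s0 ≤ ‖y - z‖ := by
    intro y hy
    have h1 : R ≤ ‖y - (q + R • ν)‖ := by
      by_contra hcon
      push Not at hcon
      exact Set.disjoint_left.1 hν.2.2 (by rwa [Metric.mem_ball, dist_eq_norm]) hy
    have h2 : ‖z - (q + R • ν)‖ ≤ d + R * η := by
      have : z - (q + R • ν) = (x - q) + R • (e - ν) := by rw [hz, smul_sub]; abel
      rw [this]
      refine (norm_add_le _ _).trans ?_
      rw [norm_smul, Real.norm_eq_abs, abs_of_pos hR]
      gcongr
    have h3 := norm_add_le (y - z) (z - (q + R • ν))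
    rw [sub_add_sub_cancel] at h3
    linarith
  have hlow' : ∀ y ∈ closure Ω, s0 ≤ ‖y - z‖ := fun y hy =>
    closure_minimal (t := {y | s0 ≤ ‖y - z‖}) hlow
      (isClosed_le continuous_const (sphereFamily z).continuous_level) hy
  set s : ℝ := √(R ^ 2 + R * T) with hs
  have hsq : s ^ 2 = R ^ 2 + R * T := Real.sq_sqrt (by positivity)
  have hsR : R < s := Real.lt_sqrt_of_sq_lt (by nlinarith)
  have hsle : s ≤ s0 + h := by
    refine (Real.sqrt_le_left (by positivity)).2 ?_
    have h1 : R + T / 2 ≤ s0 + h := by linarith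
    have h2 : (R + T / 2) ^ 2 ≤ (s0 + h) ^ 2 := by gcongr
    nlinarith [sq_nonneg T]
  have hmm := (sphereFamily z).moving_method hu.isOpen hu.isBounded hu.contDiffAt hu.eq_zero
    hu.pos hu.lapl_nonpos (s0 := s0) (s1 := s0 + h) (R := R) hs0pos hR hlow ?_ ?_ ?_
    s hsle x hx (by rw [hxz]; exact hsR)
  · have : reflMap (fun y => ‖y - z‖) (fun y => ‖y - z‖⁻¹ • (y - z)) (fun s l => s ^ 2 / l - l)
        s x = x - T • e := by
      simp only [reflMap, hxz, hsq]
      have hc : ((R ^ 2 + R * T) / R - R) * R⁻¹ * R = T := by field_simp; ring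
      rw [hz, sub_add_cancel_left, smul_neg, smul_neg, smul_smul, smul_smul, hc, ← sub_eq_add_neg]
    rwa [this] at hmm
  · intro q' hq' hl
    obtain ⟨ν', hν'⟩ := hball q' hq'
    refine ⟨ν', hν'.1, hν'.2.1, ?_⟩
    have hl0 : s0 ≤ ‖q' - z‖ := hlow' q' (frontier_subset_closure hq')
    have hdisj : Disjoint (Metric.ball (q' - R • ν') R) (Metric.ball z s0) := by
      refine Set.disjoint_left.2 fun y hy hyz => ?_
      have h1 := hlow y (hν'.2.1 hy)
      rw [Metric.mem_ball, dist_eq_norm] at hyz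
      linarith
    rw [disjoint_ball_ball_iff hR hs0pos, dist_eq_norm] at hdisj
    have h1 : q' - R • ν' - z = (q' - z) - R • ν' := by abel
    have h2 : (R + s0) ^ 2 ≤ ‖(q' - z) - R • ν'‖ ^ 2 := by rw [← h1]; gcongr
    rw [norm_sub_sq_real, inner_smul_right, norm_smul, hν'.1, Real.norm_eq_abs, mul_one, sq_abs,
      real_inner_comm] at h2
    set l := ‖q' - z‖ with hldef
    have hlpos : 0 < l := by linarith
    rw [inner_smul_right]
    set a := inner ℝ ν' (q' - z) with ha
    have h3 : 2 * R * a ≤ - R * l := by nlinarith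
    have h4 : a ≤ -(1 / 2) * l := by nlinarith
    rw [inv_mul_le_iff₀ hlpos]
    linarith
  · intro l t hl hlt ht
    rw [add_sub_cancel, div_lt_iff₀ (by linarith)]
    have h1 : t ^ 2 ≤ (s0 + h) ^ 2 := by
      have : 0 ≤ t := by linarith
      gcongr
    nlinarith
  · intro t ht y hy hyt hmem hle
    have hy0 : s0 ≤ ‖y - z‖ := hlow y hy
    have hyz : y ≠ z := by
      intro hc; rw [hc] at hy0; simp at hy0; linarith
    have hyp : 0 < ‖y - z‖ := by linarith
    have ht0 : 0 < t := hyp.trans hyt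
    rw [lapl_comp_sphere hn z ht0 hyz (hu.contDiffAt _ (subset_closure hmem))]
    have h1 := hu.lapl_nonpos _ hmem
    have h2 := hu.equation y hy
    have h3 := hu.mono hle
    have h4 := hu.equation _ hmem
    have h5 : 1 ≤ (t ^ 2 / ‖y - z‖ ^ 2) ^ 2 := by
      refine one_le_pow₀ ?_
      rw [one_le_div (by positivity)]
      gcongr
    nlinarith

/-- Near the boundary, the value at a point is controlled by the values on a whole ball. -/
lemma PositiveSolution.exists_ball_le {Ω : Set (Euc n)} {f : ℝ → ℝ} {u : Euc n → ℝ}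
    (hu : PositiveSolution Ω f u) (hcase : n = 2 ∨ Convex ℝ Ω) {R D : ℝ} (hR : 0 < R)
    (hRD : R ≤ D) (hD : ∀ x ∈ Ω, ∀ y ∈ Ω, ‖y - x‖ ≤ D)
    (hball : ∀ q ∈ frontier Ω, ∃ ν, TouchingBalls Ω R q ν)
    {x q : Euc n} (hx : x ∈ Ω) (hq : q ∈ frontier Ω) (hxq : ‖x - q‖ ≤ R / 64) :
    ∃ c, ∀ y ∈ Metric.ball c (R ^ 2 / (2048 * D)), y ∈ Ω ∧ u x ≤ u y := by
  obtain ⟨ν, hν⟩ := hball q hq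
  have hD0 : 0 < D := hR.trans_le hRD
  set r := R ^ 2 / (2048 * D) with hr
  have hrD : 2048 * (D * r) = R ^ 2 := by rw [hr]; field_simp
  have hr0 : 0 < r := by positivity
  have hrR : 2048 * r ≤ R := by
    have h1 : R * (2048 * r) ≤ R * R := by nlinarith
    exact le_of_mul_le_mul_left h1 hR
  refine ⟨x - (R / 8) • ν, fun y hy => ?_⟩
  set w := x - y - (R / 8) • ν with hw
  have hwr : ‖w‖ < r := by
    rw [Metric.mem_ball, dist_comm, dist_eq_norm] at hy
    rwa [hw, sub_right_comm]
  have hxy : x - y = (R / 8) • ν + w := by rw [hw]; abel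
  have hRν : ‖(R / 8) • ν‖ = R / 8 := by
    rw [norm_smul, hν.1, Real.norm_eq_abs, abs_of_pos (by positivity), mul_one]
  set T := ‖x - y‖ with hT
  have hT1 : T ≤ R / 8 + r := by
    rw [hT, hxy]; refine (norm_add_le _ _).trans ?_; linarith
  have hT2 : R / 8 - r ≤ T := by
    have := norm_sub_le (x - y) w
    rw [hxy, add_sub_cancel_right, hRν, ← hxy] at this
    linarith
  have hTpos : 0 < T := by linarith
  set e := T⁻¹ • (x - y) with he
  have he1 : ‖e‖ = 1 := by
    rw [he, norm_smul, norm_inv, Real.norm_eq_abs, abs_of_pos hTpos, ← hT, inv_mul_cancel₀ hTpos.ne']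
  have hye : x - T • e = y := by
    rw [he, smul_smul, mul_inv_cancel₀ hTpos.ne', one_smul, sub_sub_cancel]
  have heν : ‖e - ν‖ ≤ 32 * r / R := by
    have h1 : T • (e - ν) = (R / 8 - T) • ν + w := by
      rw [smul_sub, he, smul_smul, mul_inv_cancel₀ hTpos.ne', one_smul, hxy, sub_smul]; abel
    have h2 : T * ‖e - ν‖ ≤ 2 * r := by
      have h3 : ‖T • (e - ν)‖ ≤ |R / 8 - T| + ‖w‖ := by
        rw [h1]; refine (norm_add_le _ _).trans ?_
        rw [norm_smul, hν.1, mul_one, Real.norm_eq_abs]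
      rw [norm_smul, Real.norm_eq_abs, abs_of_pos hTpos] at h3
      have h4 : |R / 8 - T| ≤ r := abs_le.2 ⟨by linarith, by linarith⟩
      linarith
    rw [le_div_iff₀ hR]
    nlinarith [norm_nonneg (e - ν)]
  have hh : R / 64 + D * (32 * r / R) + T / 2 ≤ R / 8 := by
    have : D * (32 * r / R) = R / 64 := by
      field_simp; linarith
    rw [this]; linarith
  rw [← hye]
  rcases hcase with hn | hconv
  · exact hu.le_sub_smul_of_planar hn hR hRD hball hx hν hxq he1 heν hTpos hh
  · exact hu.le_sub_smul_of_convex hconv hR hD hball hx hq hν hxq he1 heν hTpos hh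

lemma PositiveSolution.integrableOn {Ω : Set (Euc n)} {f : ℝ → ℝ} {u : Euc n → ℝ}
    (hu : PositiveSolution Ω f u) : IntegrableOn u Ω :=
  (ContinuousOn.integrableOn_compact hu.isBounded.isCompact_closure
    fun x hx => (hu.contDiffAt x hx).continuousAt.continuousWithinAt).mono_set subset_closure

/-- `L¹` control of positive solutions near the boundary. -/
lemma PositiveSolution.mul_volume_le_integral {Ω : Set (Euc n)} {f : ℝ → ℝ} {u : Euc n → ℝ}
    (hu : PositiveSolution Ω f u) (hcase : n = 2 ∨ Convex ℝ Ω) {R D : ℝ} (hR : 0 < R)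
    (hRD : R ≤ D) (hD : ∀ x ∈ Ω, ∀ y ∈ Ω, ‖y - x‖ ≤ D)
    (hball : ∀ q ∈ frontier Ω, ∃ ν, TouchingBalls Ω R q ν) (hne : (frontier Ω).Nonempty)
    {x : Euc n} (hx : x ∈ Ω) (hxq : Metric.infDist x (frontier Ω) ≤ R / 64) :
    u x * volume.real (Metric.ball (0 : Euc n) (R ^ 2 / (2048 * D))) ≤ ∫ y in Ω, u y := by
  obtain ⟨q, hq, hxq'⟩ := isClosed_frontier.exists_infDist_eq_dist hne x
  rw [hxq', dist_eq_norm] at hxq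
  obtain ⟨c, hc⟩ := hu.exists_ball_le hcase hR hRD hD hball hx hq hxq
  set r := R ^ 2 / (2048 * D)
  have hsub : Metric.ball c r ⊆ Ω := fun y hy => (hc y hy).1
  have h1 : ∫ y in Metric.ball c r, u x ≤ ∫ y in Metric.ball c r, u y :=
    setIntegral_mono_on (integrableOn_const (by exact measure_ball_lt_top.ne))
      (hu.integrableOn.mono_set hsub) measurableSet_ball fun y hy => (hc y hy).2
  have h2 : ∫ y in Metric.ball c r, u y ≤ ∫ y in Ω, u y :=
    setIntegral_mono_set hu.integrableOn
      ((ae_restrict_iff' hu.isOpen.measurableSet).2 (ae_of_all _ fun y hy => (hu.pos y hy).le))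
      hsub.eventuallyLE
  rw [setIntegral_const, smul_eq_mul, mul_comm] at h1
  have h3 : volume.real (Metric.ball c r) = volume.real (Metric.ball (0 : Euc n) r) := by
    simp only [Measure.real]
    rw [Measure.addHaar_ball_center]
  rw [← h3]
  exact h1.trans h2

end CapLemma

section IntegrationByParts

variable {n : ℕ}

lemma lineDeriv_single_eq_pd {φ : Euc n → ℝ} {x : Euc n} (h : DifferentiableAt ℝ φ x) (i : Fin n) :
    lineDeriv ℝ φ x (EuclideanSpace.single i 1) = pd i φ x :=
  h.lineDeriv_eq_fderiv

lemma hasCompactSupport_pd {φ : Euc n → ℝ} (h : HasCompactSupport φ) (i : Fin n) :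
    HasCompactSupport (pd i φ) := h.fderiv_apply ℝ _

lemma continuous_pd {φ : Euc n → ℝ} (h : ContDiff ℝ 1 φ) (i : Fin n) : Continuous (pd i φ) :=
  (contDiff_pd (k := 0) h (by norm_num) i).continuous

lemma exists_lipschitzWith {φ : Euc n → ℝ} (h : ContDiff ℝ 1 φ) (hc : HasCompactSupport φ) :
    ∃ C, LipschitzWith C φ :=
  h.lipschitzWith_of_hasCompactSupport hc (by norm_num)

lemma integral_pd_eq_zero {φ : Euc n → ℝ} (h : ContDiff ℝ 1 φ) (hc : HasCompactSupport φ)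
    (i : Fin n) : ∫ x, pd i φ x = 0 := by
  obtain ⟨C, hC⟩ := exists_lipschitzWith h hc
  have h1 := LipschitzWith.integral_lineDeriv_mul_eq (μ := volume) (LipschitzWith.const (1 : ℝ)) hC hc
    (-EuclideanSpace.single i 1)
  have h0 : ∀ x v, lineDeriv ℝ (fun _ : Euc n => (1 : ℝ)) x v = 0 := fun x v => by simp [lineDeriv]
  simp only [h0, zero_mul, integral_zero, neg_neg, mul_one] at h1
  rw [h1]
  refine integral_congr_ae (ae_of_all _ fun x => ?_)
  exact (lineDeriv_single_eq_pd (h.differentiable (by norm_num) x) i).symm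

lemma integral_pd_mul_eq_neg {φ w : Euc n → ℝ} (h : ContDiff ℝ 1 φ) (hc : HasCompactSupport φ)
    (hw : ContDiff ℝ 1 w) (i : Fin n) : ∫ x, pd i w x * φ x = - ∫ x, w x * pd i φ x := by
  have h1 : ∫ x, pd i (fun y => w y * φ y) x = 0 := integral_pd_eq_zero (hw.mul h) hc.mul_left i
  have h2 : ∀ x, pd i (fun y => w y * φ y) x = pd i w x * φ x + w x * pd i φ x := fun x =>
    pd_mul (hw.differentiable (by norm_num) x) (h.differentiable (by norm_num) x) i
  simp only [h2] at h1
  rw [integral_add] at h1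
  · linarith
  · exact ((continuous_pd hw i).mul h.continuous).integrable_of_hasCompactSupport hc.mul_left
  · exact (hw.continuous.mul (continuous_pd h i)).integrable_of_hasCompactSupport
      (hasCompactSupport_pd hc i).mul_left

/-- Symmetry of the second distributional derivatives, tested against a `C¹` function. -/
lemma integral_pd_mul_pd_comm {φ w : Euc n → ℝ} (h : ContDiff ℝ 1 φ) (hc : HasCompactSupport φ)
    (hw : ContDiff ℝ 1 w) (hwc : HasCompactSupport w) (i j : Fin n) :
    ∫ x, pd i φ x * pd j w x = ∫ x, pd i w x * pd j φ x := by
  set v : Euc n := EuclideanSpace.single i 1 with hv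
  obtain ⟨C, hC⟩ := exists_lipschitzWith h hc
  obtain ⟨C', hC'⟩ := exists_lipschitzWith hw hwc
  have hφd : Differentiable ℝ φ := h.differentiable (by norm_num)
  have hwd : Differentiable ℝ w := hw.differentiable (by norm_num)
  have cj := continuous_pd hw j
  have cj' := continuous_pd h j
  have hA := LipschitzWith.integral_inv_smul_sub_mul_tendsto_integral_lineDeriv_mul (μ := volume) hC
    (cj.integrable_of_hasCompactSupport (hasCompactSupport_pd hwc j)) v
  have hB := LipschitzWith.integral_inv_smul_sub_mul_tendsto_integral_lineDeriv_mul (μ := volume) hC'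
    (cj'.integrable_of_hasCompactSupport (hasCompactSupport_pd hc j)) (-v)
  have hAB : ∀ t : ℝ, ∫ x, (t⁻¹ • (φ (x + t • v) - φ x)) * pd j w x
      = - ∫ x, (t⁻¹ • (w (x + t • -v) - w x)) * pd j φ x := by
    intro t
    have htr : ContDiff ℝ 1 (fun x => φ (x + t • v)) := h.comp (contDiff_id.add contDiff_const)
    have hDφ : ContDiff ℝ 1 (fun x => t⁻¹ • (φ (x + t • v) - φ x)) := (htr.sub h).const_smul _
    have htrc : HasCompactSupport (fun x => φ (x + t • v)) :=
      hc.comp_homeomorph (Homeomorph.addRight (t • v))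
    have hDc : HasCompactSupport (fun x => t⁻¹ • (φ (x + t • v) - φ x)) := by
      have := htrc.sub hc
      exact this.smul_left (f := fun _ => t⁻¹)
    have hpd : ∀ x, pd j (fun x => t⁻¹ • (φ (x + t • v) - φ x)) x
        = t⁻¹ * (pd j φ (x + t • v) - pd j φ x) := by
      intro x
      have h1 : DifferentiableAt ℝ (fun x => φ (x + t • v)) x := htr.differentiable (by norm_num) x
      simp only [smul_eq_mul]
      rw [pd_const_mul (u := fun x => φ (x + t • v) - φ x) (h1.sub (hφd x)), pd_sub h1 (hφd x)]
      simp only [pd, fderiv_comp_add_right]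
    have h1 := integral_pd_mul_eq_neg hDφ hDc hw j
    simp only [hpd] at h1
    have h2 : ∀ x, (t⁻¹ • (φ (x + t • v) - φ x)) * pd j w x
      = pd j w x * (t⁻¹ • (φ (x + t • v) - φ x)) := fun x => mul_comm _ _
    simp only [h2]
    rw [h1]
    congr 1
    have e1 : Integrable (fun x => w x * pd j φ (x + t • v)) :=
      (hw.continuous.mul (cj'.comp (continuous_id.add continuous_const))).integrable_of_hasCompactSupport
        hwc.mul_right
    have e2 : Integrable (fun x => w x * pd j φ x) :=
      (hw.continuous.mul cj').integrable_of_hasCompactSupport hwc.mul_right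
    have e3 : Integrable (fun x => w (x + t • -v) * pd j φ x) :=
      ((hw.continuous.comp (continuous_id.add continuous_const)).mul cj').integrable_of_hasCompactSupport
        (hasCompactSupport_pd hc j).mul_left
    have h3 : ∀ x, w x * (t⁻¹ * (pd j φ (x + t • v) - pd j φ x))
        = t⁻¹ * (w x * pd j φ (x + t • v) - w x * pd j φ x) := fun x => by ring
    have h4 : ∀ x, (t⁻¹ • (w (x + t • -v) - w x)) * pd j φ x
        = t⁻¹ * (w (x + t • -v) * pd j φ x - w x * pd j φ x) := fun x => by
      simp only [smul_eq_mul]; ring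
    simp only [h3, h4]
    rw [integral_const_mul, integral_const_mul, integral_sub e1 e2, integral_sub e3 e2]
    congr 2
    rw [← integral_add_right_eq_self (fun x => w (x + t • -v) * pd j φ x) (t • v)]
    simp
  have hlim := tendsto_nhds_unique (hA.congr hAB) hB.neg
  have k1 : ∀ x, lineDeriv ℝ φ x v = pd i φ x := fun x => lineDeriv_single_eq_pd (hφd x) i
  have k2 : ∀ x, lineDeriv ℝ w x (-v) = - pd i w x := fun x => by
    rw [lineDeriv_neg, lineDeriv_single_eq_pd (hwd x) i]
  simp only [k1, k2, neg_mul, integral_neg, neg_neg] at hlim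
  exact hlim

lemma norm_gradient_sq (ξ : Euc n → ℝ) (x : Euc n) : ‖gradient ξ x‖ ^ 2 = ∑ i, pd i ξ x ^ 2 := by
  rw [EuclideanSpace.norm_sq_eq]
  refine Finset.sum_congr rfl fun i _ => ?_
  have : pd i ξ x = gradient ξ x i := by
    rw [pd, ← inner_gradient_left]
    rw [EuclideanSpace.inner_single_right]; simp
  rw [this, Real.norm_eq_abs, sq_abs]

end IntegrationByParts

section Stability

variable {n : ℕ}

/-- Squared length of the gradient. -/
def gradSq (U : Euc n → ℝ) (x : Euc n) : ℝ := ∑ i, pd i U x ^ 2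

/-- The Hessian applied to the gradient. -/
def hessGrad (U : Euc n → ℝ) (i : Fin n) (x : Euc n) : ℝ := ∑ j, pd i (pd j U) x * pd j U x

/-- Squared Frobenius norm of the Hessian. -/
def hessSq (U : Euc n → ℝ) (x : Euc n) : ℝ := ∑ i, ∑ j, pd i (pd j U) x ^ 2

/-- The quantity controlled by stability: `|D²U|² - |D²U ∇U|² / (|∇U|² + 1)`. -/
def stabDensity (U : Euc n → ℝ) (x : Euc n) : ℝ :=
  hessSq U x - (∑ i, hessGrad U i x ^ 2) / (gradSq U x + 1)

lemma gradSq_nonneg (U : Euc n → ℝ) (x : Euc n) : 0 ≤ gradSq U x :=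
  Finset.sum_nonneg fun _ _ => sq_nonneg _

lemma continuous_pd_pd {U : Euc n → ℝ} (hU : ContDiff ℝ 2 U) (i j : Fin n) :
    Continuous (pd i (pd j U)) := continuous_pd (contDiff_pd hU (by norm_num) j) i

lemma contDiff_gradSq {U : Euc n → ℝ} (hU : ContDiff ℝ 2 U) : ContDiff ℝ 1 (gradSq U) :=
  ContDiff.sum fun i _ => (contDiff_pd hU (by norm_num) i).pow 2

lemma continuous_hessGrad {U : Euc n → ℝ} (hU : ContDiff ℝ 2 U) (i : Fin n) :
    Continuous (hessGrad U i) :=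
  continuous_finsetSum _ fun j _ => (continuous_pd_pd hU i j).mul
    (contDiff_pd (k := 1) hU (by norm_num) j).continuous

lemma continuous_hessSq {U : Euc n → ℝ} (hU : ContDiff ℝ 2 U) : Continuous (hessSq U) :=
  continuous_finsetSum _ fun i _ => continuous_finsetSum _ fun j _ => (continuous_pd_pd hU i j).pow 2

lemma continuous_stabDensity {U : Euc n → ℝ} (hU : ContDiff ℝ 2 U) :
    Continuous (stabDensity U) :=
  (continuous_hessSq hU).sub ((continuous_finsetSum _ fun i _ => (continuous_hessGrad hU i).pow 2).div
    ((contDiff_gradSq hU).continuous.add continuous_const) fun x => by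
      have := gradSq_nonneg U x; positivity)

lemma pd_pow_two {φ : Euc n → ℝ} {x : Euc n} (h : DifferentiableAt ℝ φ x) (i : Fin n) :
    pd i (fun y => φ y ^ 2) x = 2 * φ x * pd i φ x := by
  simp only [sq]
  rw [pd_mul h h]; ring

lemma pd_gradSq {U : Euc n → ℝ} (hU : ContDiff ℝ 2 U) (i : Fin n) (x : Euc n) :
    pd i (gradSq U) x = 2 * hessGrad U i x := by
  have hd : ∀ j, DifferentiableAt ℝ (pd j U) x := fun j => differentiableAt_pd hU.contDiffAt j
  have : pd i (gradSq U) x = ∑ j, pd i (fun y => pd j U y ^ 2) x :=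
    pd_sum Finset.univ (w := fun j y => pd j U y ^ 2) (fun j _ => (hd j).pow 2) i
  rw [this, hessGrad, Finset.mul_sum]
  refine Finset.sum_congr rfl fun j _ => ?_
  rw [pd_pow_two (hd j)]; ring

lemma integrable_of_zero_off_tsupport {F g : Euc n → ℝ} (hF : Continuous F)
    (hg : HasCompactSupport g) (h : ∀ x, x ∉ tsupport g → F x = 0) : Integrable F :=
  hF.integrable_of_hasCompactSupport (HasCompactSupport.intro hg h)

lemma pd_eq_zero_of_notMem_tsupport {φ : Euc n → ℝ} {x : Euc n} (hx : x ∉ tsupport φ) (i : Fin n) :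
    pd i φ x = 0 := by
  rw [pd_congr (notMem_tsupport_iff_eventuallyEq.1 hx) i]
  exact pd_const 0 i

/-- The equation differentiated and tested against `∇U η²`, in weak form. -/
lemma integral_deriv_mul_gradSq {V : Set (Euc n)} {f : ℝ → ℝ} (hf : ContDiff ℝ 1 f)
    {U : Euc n → ℝ} (hU : ContDiff ℝ 2 U) (hUc : HasCompactSupport U)
    (heq : ∀ x ∈ V, lapl U x + f (U x) = 0) {η : Euc n → ℝ} (hη : ContDiff ℝ 1 η)
    (hηV : tsupport η ⊆ V) :
    ∫ x, deriv f (U x) * gradSq U x * η x ^ 2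
      = ∫ x, (hessSq U x * η x ^ 2 + 2 * η x * ∑ i, hessGrad U i x * pd i η x) := by
  have hp : ∀ i, ContDiff ℝ 1 (pd i U) := fun i => contDiff_pd hU (by norm_num) i
  have hpc : ∀ i, HasCompactSupport (pd i U) := fun i => hasCompactSupport_pd hUc i
  have hφ : ∀ i, ContDiff ℝ 1 (fun x => pd i U x * η x ^ 2) := fun i => (hp i).mul (hη.pow 2)
  have hφc : ∀ i, HasCompactSupport (fun x => pd i U x * η x ^ 2) := fun i =>
    (hpc i).mul_right
  have hηd : Differentiable ℝ η := hη.differentiable (by norm_num)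
  have hpd : ∀ i j x, pd j (fun x => pd i U x * η x ^ 2) x
      = pd j (pd i U) x * η x ^ 2 + pd i U x * (2 * η x * pd j η x) := by
    intro i j x
    rw [pd_mul (v := fun y => η y ^ 2) ((hp i).differentiable (by norm_num) x) ((hηd x).pow 2),
      pd_pow_two (hηd x)]
  have hoff : ∀ i j x, x ∉ V → pd j (fun x => pd i U x * η x ^ 2) x = 0 := by
    intro i j x hx
    have hx' : x ∉ tsupport η := fun h => hx (hηV h)
    rw [hpd, pd_eq_zero_of_notMem_tsupport hx', image_eq_zero_of_notMem_tsupport hx']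
    ring
  have cη := hη.continuous
  have cη' : ∀ i, Continuous (pd i η) := fun i => continuous_pd hη i
  have cU := hU.continuous
  have cp : ∀ i, Continuous (pd i U) := fun i => (hp i).continuous
  have cH : ∀ i j, Continuous (pd i (pd j U)) := fun i j => continuous_pd_pd hU i j
  have cf' : Continuous (fun x => deriv f (U x)) := (hf.continuous_deriv (by norm_num)).comp cU
  have step : ∀ i, ∫ x, deriv f (U x) * pd i U x * (pd i U x * η x ^ 2)
      = ∑ j, ∫ x, pd i (pd j U) x * pd j (fun x => pd i U x * η x ^ 2) x := by
    intro i
    have h1 := integral_pd_mul_eq_neg (hφ i) (hφc i) (w := fun x => f (U x))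
      (hf.comp (hU.of_le (by norm_num))) i
    have h2 : ∀ x, pd i (fun x => f (U x)) x = deriv f (U x) * pd i U x := fun x =>
      pd_comp (hf.differentiable (by norm_num) _).hasDerivAt (hU.differentiable (by norm_num) x) i
    simp only [h2] at h1
    rw [h1, ← integral_neg]
    have h3 : ∀ x, -(f (U x) * pd i (fun x => pd i U x * η x ^ 2) x)
        = ∑ j, pd i (fun x => pd i U x * η x ^ 2) x * pd j (pd j U) x := by
      intro x
      rw [← Finset.mul_sum, ← lapl_eq_sum_pd]
      by_cases hx : x ∈ V
      · rw [← neg_eq_iff_add_eq_zero.2 (heq x hx)]; ring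
      · rw [hoff i i x hx]; simp
    simp only [h3]
    rw [integral_finsetSum]
    · refine Finset.sum_congr rfl fun j _ => ?_
      exact integral_pd_mul_pd_comm (hφ i) (hφc i) (hp j) (hpc j) i j
    · intro j _
      exact ((continuous_pd (hφ i) i).mul (cH j j)).integrable_of_hasCompactSupport
        (hasCompactSupport_pd (hφc i) i).mul_right
  have lhs : ∀ x, deriv f (U x) * gradSq U x * η x ^ 2
      = ∑ i, deriv f (U x) * pd i U x * (pd i U x * η x ^ 2) := by
    intro x
    rw [gradSq, Finset.mul_sum, Finset.sum_mul]
    exact Finset.sum_congr rfl fun i _ => by ring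
  have rhs : ∀ x, hessSq U x * η x ^ 2 + 2 * η x * ∑ i, hessGrad U i x * pd i η x
      = ∑ i, ∑ j, pd i (pd j U) x * pd j (fun x => pd i U x * η x ^ 2) x := by
    intro x
    simp only [hpd, hessSq, hessGrad, Finset.sum_mul, Finset.mul_sum]
    rw [Finset.sum_comm (f := fun i j => 2 * η x * (pd i (pd j U) x * pd j U x * pd i η x)),
      ← Finset.sum_add_distrib]
    refine Finset.sum_congr rfl fun i _ => ?_
    rw [← Finset.sum_add_distrib]
    refine Finset.sum_congr rfl fun j _ => ?_
    rw [pd_comm hU.contDiffAt i j]; ring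
  simp only [lhs, rhs]
  have hI : ∀ i j, Integrable
      (fun x => pd i (pd j U) x * pd j (fun x => pd i U x * η x ^ 2) x) := fun i j =>
    ((cH i j).mul (continuous_pd (hφ i) j)).integrable_of_hasCompactSupport
      (hasCompactSupport_pd (hφc i) j).mul_left
  rw [integral_finsetSum _ fun i _ => ?_, integral_finsetSum _ fun i _ => ?_]
  · refine Finset.sum_congr rfl fun i _ => ?_
    rw [step i, integral_finsetSum _ fun j _ => hI i j]
  · exact integrable_finsetSum _ fun j _ => hI i j
  · exact ((cf'.mul (cp i)).mul (hφ i).continuous).integrable_of_hasCompactSupport (hφc i).mul_left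

/-- The geometric form of the stability inequality. -/
lemma IsSemiStable.integral_stabDensity_le {Ω V : Set (Euc n)} (hΩ : IsOpen Ω) (hVΩ : V ⊆ Ω)
    {f : ℝ → ℝ} (hf : ContDiff ℝ 1 f) (hmono : Monotone f) {u U : Euc n → ℝ}
    (hst : IsSemiStable Ω f u) (huU : ∀ x ∈ V, u x = U x)
    (hU : ContDiff ℝ 2 U) (hUc : HasCompactSupport U)
    (heq : ∀ x ∈ V, lapl U x + f (U x) = 0) {η : Euc n → ℝ} (hη : ContDiff ℝ 1 η)
    (hηc : HasCompactSupport η) (hηV : tsupport η ⊆ V) :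
    ∫ x, stabDensity U x * η x ^ 2 ≤ ∫ x, (gradSq U x + 1) * gradSq η x := by
  have hηd : Differentiable ℝ η := hη.differentiable (by norm_num)
  have hP0 : ∀ x, 0 < gradSq U x + 1 := fun x => by linarith [gradSq_nonneg U x]
  have hP1 : ContDiff ℝ 1 (fun x => gradSq U x + 1) := (contDiff_gradSq hU).add contDiff_const
  have hPd : Differentiable ℝ (fun x => gradSq U x + 1) := hP1.differentiable (by norm_num)
  have hsq : ContDiff ℝ 1 (fun x => √(gradSq U x + 1)) := hP1.sqrt fun x => (hP0 x).ne'
  set ξ : Euc n → ℝ := fun x => √(gradSq U x + 1) * η x with hξ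
  have hξ1 : ContDiff ℝ 1 ξ := hsq.mul hη
  have hξc : HasCompactSupport ξ := hηc.mul_left
  have hξpd : ∀ i x, pd i ξ x = hessGrad U i x / √(gradSq U x + 1) * η x
      + √(gradSq U x + 1) * pd i η x := by
    intro i x
    rw [hξ, pd_mul (hsq.differentiable (by norm_num) x) (hηd x),
      pd_comp (Real.hasDerivAt_sqrt (hP0 x).ne') (hPd x),
      pd_add ((contDiff_gradSq hU).differentiable (by norm_num) x) (by fun_prop), pd_const,
      pd_gradSq hU]
    congr 2
    have : √(gradSq U x + 1) ≠ 0 := (Real.sqrt_pos.2 (hP0 x)).ne'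
    field_simp
    ring
  have hξsq : ∀ x, ‖gradient ξ x‖ ^ 2 = η x ^ 2 * ((∑ i, hessGrad U i x ^ 2) / (gradSq U x + 1))
      + 2 * η x * (∑ i, hessGrad U i x * pd i η x) + (gradSq U x + 1) * gradSq η x := by
    intro x
    rw [norm_gradient_sq, gradSq.eq_def η, Finset.sum_div, Finset.mul_sum, Finset.mul_sum, Finset.mul_sum,
      ← Finset.sum_add_distrib, ← Finset.sum_add_distrib]
    refine Finset.sum_congr rfl fun i _ => ?_
    rw [hξpd]
    have h1 : √(gradSq U x + 1) ≠ 0 := (Real.sqrt_pos.2 (hP0 x)).ne'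
    have h2 := Real.sq_sqrt (hP0 x).le
    have h3 := (hP0 x).ne'
    have h4 : (hessGrad U i x / √(gradSq U x + 1)) ^ 2 = hessGrad U i x ^ 2 / (gradSq U x + 1) := by
      rw [div_pow, h2]
    have h5 : hessGrad U i x / √(gradSq U x + 1) * √(gradSq U x + 1) = hessGrad U i x :=
      div_mul_cancel₀ _ h1
    linear_combination (η x ^ 2) * h4 + (2 * η x * pd i η x) * h5 + (pd i η x ^ 2) * h2
  have hoff : ∀ x, x ∉ V → x ∉ tsupport η := fun x hx h => hx (hηV h)
  have hξ0 : ∀ x, x ∉ tsupport η → ξ x = 0 := fun x hx => by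
    simp only [hξ, image_eq_zero_of_notMem_tsupport hx, mul_zero]
  have hgη0 : ∀ x, x ∉ tsupport η → gradSq η x = 0 := fun x hx => by
    simp [gradSq, pd_eq_zero_of_notMem_tsupport hx]
  have hgξ0 : ∀ x, x ∉ tsupport η → ‖gradient ξ x‖ ^ 2 = 0 := fun x hx => by
    rw [hξsq, image_eq_zero_of_notMem_tsupport hx, hgη0 x hx]; ring
  have hG := hst ξ (exists_lipschitzWith hξ1 hξc) fun x hx => hξ0 x fun h => by
    rw [hΩ.frontier_eq] at hx
    exact hx.2 (hVΩ (hηV h))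
  have hGeq : ∫ x in Ω, (‖gradient ξ x‖ ^ 2 - deriv f (u x) * ξ x ^ 2)
      = ∫ x, (‖gradient ξ x‖ ^ 2 - deriv f (U x) * ξ x ^ 2) := by
    have h1 : ∀ x, ‖gradient ξ x‖ ^ 2 - deriv f (u x) * ξ x ^ 2
        = ‖gradient ξ x‖ ^ 2 - deriv f (U x) * ξ x ^ 2 := by
      intro x
      by_cases hx : x ∈ V
      · rw [huU x hx]
      · rw [hξ0 x (hoff x hx)]; ring
    simp only [h1]
    refine setIntegral_eq_integral_of_forall_compl_eq_zero fun x hx => ?_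
    have hx' := hoff x fun h => hx (hVΩ h)
    rw [hξ0 x hx', hgξ0 x hx']; ring
  rw [hGeq] at hG
  have cη := hη.continuous
  have cη' : ∀ i, Continuous (pd i η) := fun i => continuous_pd hη i
  have cU := hU.continuous
  have cf' : Continuous (fun x => deriv f (U x)) := (hf.continuous_deriv (by norm_num)).comp cU
  have cP := hP1.continuous
  have cg := (contDiff_gradSq hU).continuous
  have cgη : Continuous (gradSq η) := continuous_finsetSum _ fun i _ => (cη' i).pow 2
  have cS := continuous_stabDensity hU
  have cHS := continuous_hessSq hU
  have cq : ∀ i, Continuous (hessGrad U i) := fun i => continuous_hessGrad hU i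
  have cξ : Continuous ξ := hξ1.continuous
  have cqη : Continuous (fun x => ∑ i, hessGrad U i x * pd i η x) :=
    continuous_finsetSum _ fun i _ => (cq i).mul (cη' i)
  have hη0 : ∀ x, x ∉ tsupport η → η x = 0 := fun x hx => image_eq_zero_of_notMem_tsupport hx
  have cqP : Continuous (fun x => (∑ i, hessGrad U i x ^ 2) / (gradSq U x + 1)) :=
    (continuous_finsetSum _ fun i _ => (cq i).pow 2).div cP fun x => (hP0 x).ne'
  have cgξ : Continuous (fun x => ‖gradient ξ x‖ ^ 2) := by
    simp only [hξsq]; fun_prop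
  have i1 : Integrable (fun x => stabDensity U x * η x ^ 2) :=
    integrable_of_zero_off_tsupport (by fun_prop) hηc fun x hx => by simp [hη0 x hx]
  have i2 : Integrable (fun x => (gradSq U x + 1) * gradSq η x) :=
    integrable_of_zero_off_tsupport (by fun_prop) hηc fun x hx => by simp [hgη0 x hx]
  have i3 : Integrable (fun x => ‖gradient ξ x‖ ^ 2 - deriv f (U x) * ξ x ^ 2) :=
    integrable_of_zero_off_tsupport (by fun_prop) hηc fun x hx => by rw [hgξ0 x hx, hξ0 x hx]; ring
  have i4 : Integrable (fun x => deriv f (U x) * gradSq U x * η x ^ 2) :=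
    integrable_of_zero_off_tsupport (by fun_prop) hηc fun x hx => by simp [hη0 x hx]
  have i5 : Integrable
      (fun x => hessSq U x * η x ^ 2 + 2 * η x * ∑ i, hessGrad U i x * pd i η x) :=
    integrable_of_zero_off_tsupport (by fun_prop) hηc fun x hx => by simp [hη0 x hx]
  have i6 : Integrable (fun x => deriv f (U x) * η x ^ 2) :=
    integrable_of_zero_off_tsupport (by fun_prop) hηc fun x hx => by simp [hη0 x hx]
  have h6 : 0 ≤ ∫ x, deriv f (U x) * η x ^ 2 :=
    integral_nonneg fun x => mul_nonneg (hmono.deriv_nonneg) (sq_nonneg _)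
  have h45 := integral_deriv_mul_gradSq hf hU hUc heq hη hηV
  have hpt : ∀ x, (gradSq U x + 1) * gradSq η x = stabDensity U x * η x ^ 2
      + (‖gradient ξ x‖ ^ 2 - deriv f (U x) * ξ x ^ 2)
      + (deriv f (U x) * gradSq U x * η x ^ 2
        - (hessSq U x * η x ^ 2 + 2 * η x * ∑ i, hessGrad U i x * pd i η x))
      + deriv f (U x) * η x ^ 2 := by
    intro x
    rw [hξsq, stabDensity]
    have : ξ x ^ 2 = (gradSq U x + 1) * η x ^ 2 := by
      rw [hξ]; simp only [mul_pow]; rw [Real.sq_sqrt (hP0 x).le]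
    rw [this]; ring
  simp only [hpt]
  have i13 : Integrable (fun x => stabDensity U x * η x ^ 2
      + (‖gradient ξ x‖ ^ 2 - deriv f (U x) * ξ x ^ 2)) := i1.add i3
  have i45 : Integrable (fun x => deriv f (U x) * gradSq U x * η x ^ 2
        - (hessSq U x * η x ^ 2 + 2 * η x * ∑ i, hessGrad U i x * pd i η x)) := i4.sub i5
  have i1345 : Integrable (fun x => stabDensity U x * η x ^ 2
      + (‖gradient ξ x‖ ^ 2 - deriv f (U x) * ξ x ^ 2)
      + (deriv f (U x) * gradSq U x * η x ^ 2
        - (hessSq U x * η x ^ 2 + 2 * η x * ∑ i, hessGrad U i x * pd i η x))) := i13.add i45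
  rw [integral_add i1345 i6, integral_add i13 i45, integral_add i1 i3, integral_sub i4 i5, h45]
  linarith

end Stability

section WeightedInequality

variable {n : ℕ}

lemma sq_hessian_term_le {ι : Type*} [Fintype ι] (hn : Fintype.card ι ≤ 4) (H : ι → ι → ℝ)
    (hH : ∀ i j, H i j = H j i) (p X : ι → ℝ) :
    (∑ i, (∑ j, H i j * p j) * X i - (∑ i, X i * p i) * ∑ i, H i i) ^ 2
      ≤ 3 * (∑ i, X i ^ 2) * ((∑ i, p i ^ 2) * (∑ i, ∑ j, H i j ^ 2)
        - ∑ i, (∑ j, H i j * p j) ^ 2) := by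
  classical
  set q : ι → ℝ := fun i => ∑ j, H i j * p j with hq
  set s := ∑ i, X i * p i with hs
  set P := ∑ i, p i ^ 2 with hP
  set T := ∑ i, H i i with hT
  set Q := ∑ i, X i ^ 2 with hQ
  set S := ∑ i, ∑ j, H i j ^ 2 with hS
  have hP0 : 0 ≤ P := Finset.sum_nonneg fun _ _ => sq_nonneg _
  have hQ0 : 0 ≤ Q := Finset.sum_nonneg fun _ _ => sq_nonneg _
  rcases hP0.eq_or_lt with h0 | hPpos
  · have hp : ∀ i, p i = 0 := fun i => by
      have := (Finset.sum_eq_zero_iff_of_nonneg (fun i _ => sq_nonneg (p i))).1 h0.symm i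
        (Finset.mem_univ i)
      simpa using this
    simp [hs, hP, hp]
  have e1 : ∑ i, q i * ∑ j, H i j * p j = ∑ i, q i ^ 2 :=
    Finset.sum_congr rfl fun i _ => (sq (q i)).symm
  have hM : ∑ i, ∑ j, (P * H i j - q i * p j) ^ 2 = P * (P * S - ∑ i, q i ^ 2) := by
    have : ∀ i j, (P * H i j - q i * p j) ^ 2
        = P ^ 2 * H i j ^ 2 - 2 * P * (q i * (H i j * p j)) + q i ^ 2 * p j ^ 2 := by
      intros; ring
    simp only [this, Finset.sum_add_distrib, Finset.sum_sub_distrib, ← Finset.mul_sum, e1]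
    rw [← Finset.sum_mul]
    simp only [← hS, ← hP]
    ring
  have e2 : ∑ i, ∑ j, H i j * (p i * X j) = ∑ i, q i * X i := by
    rw [Finset.sum_comm]
    refine Finset.sum_congr rfl fun j _ => ?_
    rw [hq, Finset.sum_mul]
    refine Finset.sum_congr rfl fun i _ => ?_
    rw [hH j i]; ring
  have e3 : ∑ i, ∑ j, q i * p j * (p i * X j) = (∑ i, q i * p i) * s := by
    rw [Finset.sum_mul_sum]
    refine Finset.sum_congr rfl fun i _ => Finset.sum_congr rfl fun j _ => by ring
  have hE : ∑ i, ∑ j, (P * H i j - q i * p j) * (p i * X j - if i = j then s else 0)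
      = P * (∑ i, q i * X i - s * T) := by
    have : ∀ i j, (P * H i j - q i * p j) * (p i * X j - if i = j then s else 0)
        = P * (H i j * (p i * X j)) - q i * p j * (p i * X j)
          - if i = j then P * s * H i i - s * (q i * p i) else 0 := by
      intro i j
      split_ifs with h
      · subst h; ring
      · ring
    simp only [this, Finset.sum_sub_distrib, Finset.sum_ite_eq, Finset.mem_univ, if_true,
      ← Finset.mul_sum, e2, e3]
    ring
  have e4 : ∑ i, ∑ j, (p i * X j) ^ 2 = P * Q := by
    rw [hP, hQ, Finset.sum_mul_sum]
    simp only [mul_pow]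
  have hB : ∑ i, ∑ j, (p i * X j - if i = j then s else 0) ^ 2
      = P * Q + (Fintype.card ι - 2) * s ^ 2 := by
    have : ∀ i j, (p i * X j - if i = j then s else 0) ^ 2
        = (p i * X j) ^ 2 - if i = j then 2 * s * (X i * p i) - s ^ 2 else 0 := by
      intro i j
      split_ifs with h
      · subst h; ring
      · ring
    simp only [this, Finset.sum_sub_distrib, Finset.sum_ite_eq, Finset.mem_univ, if_true, e4,
      ← Finset.mul_sum, ← hs]
    simp
    ring
  have hCS := Finset.sum_mul_sq_le_sq_mul_sq (Finset.univ : Finset (ι × ι))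
    (fun x => P * H x.1 x.2 - q x.1 * p x.2) (fun x => p x.1 * X x.2 - if x.1 = x.2 then s else 0)
  simp only [Fintype.sum_prod_type] at hCS
  rw [hE, hM, hB] at hCS
  have hsq : s ^ 2 ≤ Q * P := Finset.sum_mul_sq_le_sq_mul_sq _ _ _
  have hK : 0 ≤ P * S - ∑ i, q i ^ 2 := by
    have : 0 ≤ P * (P * S - ∑ i, q i ^ 2) := by
      rw [← hM]; positivity
    exact nonneg_of_mul_nonneg_right this hPpos
  have hc : (Fintype.card ι : ℝ) ≤ 4 := by exact_mod_cast hn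
  have hB' : P * Q + (Fintype.card ι - 2) * s ^ 2 ≤ 3 * Q * P := by
    nlinarith [sq_nonneg s]
  have h1 : (P * (∑ i, q i * X i - s * T)) ^ 2
      ≤ P * (P * S - ∑ i, q i ^ 2) * (3 * Q * P) :=
    hCS.trans (mul_le_mul_of_nonneg_left hB' (by positivity))
  have h2 : P ^ 2 * (∑ i, q i * X i - s * T) ^ 2
      ≤ P ^ 2 * (3 * Q * (P * S - ∑ i, q i ^ 2)) := by
    nlinarith
  exact le_of_mul_le_mul_left h2 (by positivity)

/-- The radial derivative term `(D²U ∇U)·X - (X·∇U) ΔU`, with `X = x - c`. -/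
def radialHess (U : Euc n → ℝ) (c x : Euc n) : ℝ :=
  ∑ i, hessGrad U i x * (x i - c i) - (∑ i, (x i - c i) * pd i U x) * lapl U x

lemma sq_radialHess_le (hn : n ≤ 4) {U : Euc n → ℝ} (hU : ContDiff ℝ 2 U) (c x : Euc n) :
    radialHess U c x ^ 2 ≤ 3 * ‖x - c‖ ^ 2 * ((gradSq U x + 1) * stabDensity U x) := by
  have h := sq_hessian_term_le (by simpa using hn) (fun i j => pd i (pd j U) x)
    (fun i j => pd_comm hU.contDiffAt i j) (fun i => pd i U x) (fun i => x i - c i)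
  have hP : 0 < gradSq U x + 1 := by linarith [gradSq_nonneg U x]
  have hS : (gradSq U x + 1) * stabDensity U x
      = (gradSq U x + 1) * hessSq U x - ∑ i, hessGrad U i x ^ 2 := by
    rw [stabDensity, mul_sub, mul_div_cancel₀ _ hP.ne']
  have hH : 0 ≤ hessSq U x :=
    Finset.sum_nonneg fun _ _ => Finset.sum_nonneg fun _ _ => sq_nonneg _
  rw [hS, norm_sub_sq_eq_sum, radialHess, lapl_eq_sum_pd]
  refine h.trans (mul_le_mul_of_nonneg_left ?_ (by positivity))
  simp only [gradSq, hessSq, hessGrad] at hH ⊢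
  linarith

lemma stabDensity_nonneg {U : Euc n → ℝ} (x : Euc n) : 0 ≤ stabDensity U x := by
  have hP := gradSq_nonneg U x
  have hH : 0 ≤ hessSq U x :=
    Finset.sum_nonneg fun _ _ => Finset.sum_nonneg fun _ _ => sq_nonneg _
  have : ∑ i, hessGrad U i x ^ 2 ≤ hessSq U x * gradSq U x := by
    rw [hessSq, Finset.sum_mul]
    exact Finset.sum_le_sum fun i _ => Finset.sum_mul_sq_le_sq_mul_sq _ _ _
  rw [stabDensity, sub_nonneg, div_le_iff₀ (by linarith)]
  nlinarith

/-- Pohozaev-type identity obtained from the field `|∇U|² X - (X·∇U) ∇U`. -/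
lemma integral_radial_identity {U W : Euc n → ℝ} (hU : ContDiff ℝ 2 U) (hW : ContDiff ℝ 1 W)
    (hWc : HasCompactSupport W) (c : Euc n) :
    ∫ x, (W x * ((n - 1) * gradSq U x + radialHess U c x)
      + (gradSq U x * (∑ i, (x i - c i) * pd i W x)
        - (∑ i, (x i - c i) * pd i U x) * ∑ i, pd i U x * pd i W x)) = 0 := by
  have hp : ∀ i, ContDiff ℝ 1 (pd i U) := fun i => contDiff_pd hU (by norm_num) i
  have hc : ∀ i, ContDiff ℝ 1 (fun y : Euc n => y i - c i) := fun i => by fun_prop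
  have hs : ContDiff ℝ 1 (fun y : Euc n => ∑ j, (y j - c j) * pd j U y) :=
    ContDiff.sum fun j _ => (hc j).mul (hp j)
  have hg := contDiff_gradSq hU
  have hF : ∀ i, ContDiff ℝ 1 (fun y : Euc n =>
      W y * (gradSq U y * (y i - c i) - (∑ j, (y j - c j) * pd j U y) * pd i U y)) := fun i =>
    hW.mul ((hg.mul (hc i)).sub (hs.mul (hp i)))
  have h0 : ∀ i, ∫ x, pd i (fun y : Euc n =>
      W y * (gradSq U y * (y i - c i) - (∑ j, (y j - c j) * pd j U y) * pd i U y)) x = 0 :=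
    fun i => integral_pd_eq_zero (hF i) hWc.mul_right i
  have hint : ∀ i, Integrable (pd i (fun y : Euc n =>
      W y * (gradSq U y * (y i - c i) - (∑ j, (y j - c j) * pd j U y) * pd i U y))) := fun i =>
    (continuous_pd (hF i) i).integrable_of_hasCompactSupport
      (hasCompactSupport_pd hWc.mul_right i)
  have hsum : ∫ x, ∑ i, pd i (fun y : Euc n =>
      W y * (gradSq U y * (y i - c i) - (∑ j, (y j - c j) * pd j U y) * pd i U y)) x = 0 := by
    rw [integral_finsetSum _ fun i _ => hint i]
    exact Finset.sum_eq_zero fun i _ => h0 i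
  rw [← hsum]
  congr 1
  ext x
  have d1 : ∀ {φ : Euc n → ℝ}, ContDiff ℝ 1 φ → DifferentiableAt ℝ φ x := fun h =>
    h.differentiable (by norm_num) x
  have hps : ∀ i, pd i (fun y : Euc n => ∑ j, (y j - c j) * pd j U y) x
      = pd i U x + ∑ j, (x j - c j) * pd i (pd j U) x := by
    intro i
    have : pd i (fun y : Euc n => ∑ j, (y j - c j) * pd j U y) x
        = ∑ j, pd i (fun y : Euc n => (y j - c j) * pd j U y) x :=
      pd_sum Finset.univ (w := fun j (y : Euc n) => (y j - c j) * pd j U y)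
        (fun j _ => (d1 (hc j)).mul (d1 (hp j))) i
    rw [this]
    have h2 : ∀ j, pd i (fun y : Euc n => (y j - c j) * pd j U y) x
        = (if i = j then pd j U x else 0) + (x j - c j) * pd i (pd j U) x := fun j => by
      rw [pd_mul (d1 (hc j)) (d1 (hp j)), pd_coord_sub]
      split_ifs <;> ring
    simp only [h2, Finset.sum_add_distrib]
    simp
  have key : ∀ i, pd i (fun y : Euc n =>
      W y * (gradSq U y * (y i - c i) - (∑ j, (y j - c j) * pd j U y) * pd i U y)) x
      = gradSq U x * ((x i - c i) * pd i W x)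
        - (∑ j, (x j - c j) * pd j U x) * (pd i U x * pd i W x)
        + W x * (2 * (hessGrad U i x * (x i - c i)) + gradSq U x - pd i U x ^ 2
          - pd i U x * (∑ j, (x j - c j) * pd i (pd j U) x)
          - (∑ j, (x j - c j) * pd j U x) * pd i (pd i U) x) := by
    intro i
    rw [pd_mul (d1 hW) (d1 ((hg.mul (hc i)).sub (hs.mul (hp i)))),
      pd_sub (d1 (hg.mul (hc i))) (d1 (hs.mul (hp i))), pd_mul (d1 hg) (d1 (hc i)),
      pd_mul (d1 hs) (d1 (hp i)), pd_coord_sub, pd_gradSq hU, hps, if_pos rfl]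
    ring
  simp only [key]
  have e1 : ∑ i, pd i U x * (∑ j, (x j - c j) * pd i (pd j U) x)
      = ∑ i, hessGrad U i x * (x i - c i) := by
    simp only [hessGrad, Finset.mul_sum, Finset.sum_mul]
    rw [Finset.sum_comm]
    refine Finset.sum_congr rfl fun j _ => Finset.sum_congr rfl fun i _ => ?_
    rw [pd_comm hU.contDiffAt j i]; ring
  simp only [Finset.sum_add_distrib, Finset.sum_sub_distrib, ← Finset.mul_sum, e1]
  have e2 : ∑ i, pd i U x ^ 2 = gradSq U x := rfl
  rw [e2, ← lapl_eq_sum_pd, radialHess]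
  simp
  ring

end WeightedInequality

section WeightedGradient

variable {n : ℕ}

lemma gradSq_mul_le {v ζ : Euc n → ℝ} {x : Euc n} (hv : DifferentiableAt ℝ v x)
    (hζ : DifferentiableAt ℝ ζ x) :
    gradSq (fun y => v y * ζ y) x ≤ 2 * ζ x ^ 2 * gradSq v x + 2 * v x ^ 2 * gradSq ζ x := by
  simp only [gradSq, Finset.mul_sum, ← Finset.sum_add_distrib]
  refine Finset.sum_le_sum fun i _ => ?_
  rw [pd_mul hv hζ]
  nlinarith [sq_nonneg (pd i v x * ζ x - v x * pd i ζ x)]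

lemma abs_sum_mul_le {ι : Type*} {t : Finset ι} {f g : ι → ℝ} {a b : ℝ} (ha : 0 ≤ a) (hb : 0 ≤ b)
    (hf : ∑ i ∈ t, f i ^ 2 ≤ a ^ 2) (hg : ∑ i ∈ t, g i ^ 2 ≤ b ^ 2) :
    |∑ i ∈ t, f i * g i| ≤ a * b := by
  refine abs_le_of_sq_le_sq ?_ (mul_nonneg ha hb)
  calc (∑ i ∈ t, f i * g i) ^ 2 ≤ (∑ i ∈ t, f i ^ 2) * ∑ i ∈ t, g i ^ 2 :=
        Finset.sum_mul_sq_le_sq_mul_sq _ _ _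
    _ ≤ a ^ 2 * b ^ 2 := mul_le_mul hf hg (Finset.sum_nonneg fun _ _ => sq_nonneg _) (sq_nonneg _)
    _ = (a * b) ^ 2 := by ring

/-- The algebra behind the weighted gradient estimate. -/
lemma weighted_gradient_algebra {d b a L μ C P S w v z G X E s D t m Q g : ℝ}
    (hP : 0 ≤ P) (hS : 0 ≤ S) (hw : 0 ≤ w) (hz0 : 0 ≤ z) (hz1 : z ≤ 1) (hG : 0 ≤ G) (hX : 0 ≤ X)
    (hm : 0 ≤ m) (hL : 0 ≤ L) (hμ : 0 < μ)
    (hE : E ^ 2 ≤ 3 * X ^ 2 * ((P + 1) * S)) (hmb : m * X ^ 2 ≤ b * w) (hLv : w * X ^ 2 ≤ L * v ^ 2)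
    (hst : |s * t| ≤ P * (X * G)) (hD : |D| ≤ X * G)
    (hQ : Q ≤ 2 * z ^ 2 * g + 2 * v ^ 2 * G ^ 2) (hg : g ≤ a * w)
    (hδ : 3 / 2 * (2 * a * μ + L / μ) ≤ (d - b) / 2)
    (hC : 3 * μ * v ^ 2 * G ^ 2 + 4 * w * X * G ≤ (d - b) / 2 * C) :
    (d - b) / 2 * (w * z ^ 2 * P - w * z ^ 2 - C * (P + 1))
      ≤ (w * z ^ 2 * (d * P + E) + (P * (-m * z ^ 2 * X ^ 2 + 2 * w * z * D)
          - (-m * z ^ 2 * s ^ 2 + 2 * w * z * (s * t))))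
        + 3 / 2 * μ * (S * (v * z) ^ 2 - (P + 1) * Q) := by
  have hz2 : 0 ≤ z ^ 2 := sq_nonneg z
  have hwE : |w * E| ≤ 3 / 2 * (μ * (v ^ 2 * S) + L / μ * (w * (P + 1))) := by
    have h1 : 0 ≤ L / μ := by positivity
    refine abs_le_of_sq_le_sq ?_ (by positivity)
    have e : L / μ * μ = L := div_mul_cancel₀ _ hμ.ne'
    have h2 : (w * E) ^ 2 ≤ 3 * (L * v ^ 2 * w * ((P + 1) * S)) := by
      calc (w * E) ^ 2 = w ^ 2 * E ^ 2 := by ring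
        _ ≤ w ^ 2 * (3 * X ^ 2 * ((P + 1) * S)) := mul_le_mul_of_nonneg_left hE (sq_nonneg _)
        _ = (w * X ^ 2) * (3 * w * ((P + 1) * S)) := by ring
        _ ≤ (L * v ^ 2) * (3 * w * ((P + 1) * S)) :=
            mul_le_mul_of_nonneg_right hLv (by positivity)
        _ = _ := by ring
    have h3 : 9 * (L * v ^ 2 * w * ((P + 1) * S))
        ≤ (3 / 2 * (μ * (v ^ 2 * S) + L / μ * (w * (P + 1)))) ^ 2 := by
      have : 9 * (L * v ^ 2 * w * ((P + 1) * S))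
          = 9 * ((μ * (v ^ 2 * S)) * (L / μ * (w * (P + 1)))) := by
        rw [← e]
        field_simp
      rw [this]
      nlinarith [sq_nonneg (μ * (v ^ 2 * S) - L / μ * (w * (P + 1)))]
    have h4 : 0 ≤ L * v ^ 2 * w * ((P + 1) * S) := by positivity
    linarith
  have a1 : -(3 / 2 * (μ * (v ^ 2 * S) + L / μ * (w * (P + 1)))) * z ^ 2 ≤ w * E * z ^ 2 :=
    mul_le_mul_of_nonneg_right (abs_le.1 hwE).1 hz2
  have a2 : P * (m * X ^ 2) * z ^ 2 ≤ P * (b * w) * z ^ 2 :=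
    mul_le_mul_of_nonneg_right (mul_le_mul_of_nonneg_left hmb hP) hz2
  have a3 : 0 ≤ m * z ^ 2 * s ^ 2 := by positivity
  have hwz : 0 ≤ 2 * w * z := by positivity
  have a4 : 2 * w * z * (-(P * (X * G))) ≤ 2 * w * z * (P * D) := by
    refine mul_le_mul_of_nonneg_left ?_ hwz
    have := mul_le_mul_of_nonneg_left (abs_le.1 hD).1 hP
    linarith
  have a5 : 2 * w * z * (s * t) ≤ 2 * w * z * (P * (X * G)) :=
    mul_le_mul_of_nonneg_left (abs_le.1 hst).2 hwz
  have a6 : 4 * w * z * (P * (X * G)) ≤ 4 * w * X * G * (P + 1) := by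
    have h1 : 0 ≤ 4 * w * X * G := by positivity
    have h2 : z * P ≤ P + 1 := by nlinarith
    have := mul_le_mul_of_nonneg_left h2 h1
    linarith
  have a7 : μ * ((P + 1) * Q) ≤ μ * ((P + 1) * (2 * z ^ 2 * (a * w) + 2 * v ^ 2 * G ^ 2)) := by
    refine mul_le_mul_of_nonneg_left (mul_le_mul_of_nonneg_left (hQ.trans ?_) (by positivity)) hμ.le
    have := mul_le_mul_of_nonneg_left hg (show 0 ≤ 2 * z ^ 2 by positivity)
    linarith
  have a8 := mul_le_mul_of_nonneg_right hδ (show 0 ≤ w * z ^ 2 * (P + 1) by positivity)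
  have a9 := mul_le_mul_of_nonneg_right hC (show 0 ≤ P + 1 by positivity)
  linarith

/-- Weighted gradient estimate for stable solutions. -/
lemma IsSemiStable.integral_weighted_gradSq_le {Ω V : Set (Euc n)} (hΩ : IsOpen Ω) (hVΩ : V ⊆ Ω)
    {f : ℝ → ℝ} (hf : ContDiff ℝ 1 f) (hmono : Monotone f) {u U : Euc n → ℝ}
    (hst : IsSemiStable Ω f u) (huU : ∀ x ∈ V, u x = U x)
    (hU : ContDiff ℝ 2 U) (hUc : HasCompactSupport U)
    (heq : ∀ x ∈ V, lapl U x + f (U x) = 0) (hn : n ≤ 4) {c : Euc n}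
    {w v ζ χ m : Euc n → ℝ} {a b L μ C : ℝ}
    (hw : ContDiff ℝ 1 w) (hv : ContDiff ℝ 1 v) (hζ : ContDiff ℝ 1 ζ)
    (hζc : HasCompactSupport ζ) (hζV : tsupport ζ ⊆ V) (hζ0 : ∀ x, 0 ≤ ζ x) (hζ1 : ∀ x, ζ x ≤ 1)
    (hχ : Continuous χ) (hχc : HasCompactSupport χ)
    (hw0 : ∀ x, 0 ≤ w x) (hm : ∀ x, 0 ≤ m x) (hwd : ∀ i x, pd i w x = -m x * (x i - c i))
    (hmb : ∀ x, m x * ‖x - c‖ ^ 2 ≤ b * w x) (hva : ∀ x, gradSq v x ≤ a * w x)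
    (hL : 0 ≤ L) (hLv : ∀ x ∈ V, w x * ‖x - c‖ ^ 2 ≤ L * v x ^ 2) (hμ : 0 < μ) (hC0 : 0 ≤ C)
    (hb : b < n - 1) (hδ : 3 / 2 * (2 * a * μ + L / μ) ≤ (n - 1 - b) / 2)
    (hC : ∀ x ∈ V, ∃ G, 0 ≤ G ∧ gradSq ζ x ≤ G ^ 2 ∧
      3 * μ * v x ^ 2 * G ^ 2 + 4 * w x * ‖x - c‖ * G ≤ (n - 1 - b) / 2 * (C * χ x ^ 2)) :
    ∫ x, w x * ζ x ^ 2 * gradSq U x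
      ≤ (∫ x, w x * ζ x ^ 2) + C * ∫ x, χ x ^ 2 * (gradSq U x + 1) := by
  have hvζ : ContDiff ℝ 1 (fun x => v x * ζ x) := hv.mul hζ
  have hstab := hst.integral_stabDensity_le hΩ hVΩ hf hmono huU hU hUc heq hvζ hζc.mul_left
    ((tsupport_mul_subset_right).trans hζV)
  have hW : ContDiff ℝ 1 (fun x => w x * ζ x ^ 2) := hw.mul (hζ.pow 2)
  have hWc : HasCompactSupport (fun x => w x * ζ x ^ 2) :=
    (hζc.comp_left (g := fun s => s ^ 2) (by norm_num)).mul_left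
  have hid := integral_radial_identity hU hW hWc c
  have hζd : Differentiable ℝ ζ := hζ.differentiable (by norm_num)
  have hpW : ∀ i x, pd i (fun x => w x * ζ x ^ 2) x
      = -m x * ζ x ^ 2 * (x i - c i) + 2 * w x * ζ x * pd i ζ x := by
    intro i x
    rw [pd_mul (v := fun y => ζ y ^ 2) (hw.differentiable (by norm_num) x) ((hζd x).pow 2), hwd,
      pd_pow_two (hζd x)]
    ring
  set A : Euc n → ℝ := fun x => w x * ζ x ^ 2 * ((n - 1) * gradSq U x + radialHess U c x)
      + (gradSq U x * (∑ i, (x i - c i) * pd i (fun x => w x * ζ x ^ 2) x)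
        - (∑ i, (x i - c i) * pd i U x) * ∑ i, pd i U x * pd i (fun x => w x * ζ x ^ 2) x) with hA
  have hAeq : ∀ x, A x = w x * ζ x ^ 2 * ((n - 1) * gradSq U x + radialHess U c x)
      + (gradSq U x * (-m x * ζ x ^ 2 * ‖x - c‖ ^ 2
          + 2 * w x * ζ x * ∑ i, (x i - c i) * pd i ζ x)
        - (-m x * ζ x ^ 2 * (∑ i, (x i - c i) * pd i U x) ^ 2
          + 2 * w x * ζ x * ((∑ i, (x i - c i) * pd i U x) * ∑ i, pd i U x * pd i ζ x))) := by
    intro x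
    have e1 : ∑ i, (x i - c i) * pd i (fun x => w x * ζ x ^ 2) x
        = -m x * ζ x ^ 2 * ‖x - c‖ ^ 2 + 2 * w x * ζ x * ∑ i, (x i - c i) * pd i ζ x := by
      rw [norm_sub_sq_eq_sum, Finset.mul_sum, Finset.mul_sum, ← Finset.sum_add_distrib]
      refine Finset.sum_congr rfl fun i _ => ?_
      rw [hpW]; ring
    have e2 : ∑ i, pd i U x * pd i (fun x => w x * ζ x ^ 2) x
        = -m x * ζ x ^ 2 * (∑ i, (x i - c i) * pd i U x)
          + 2 * w x * ζ x * ∑ i, pd i U x * pd i ζ x := by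
      rw [Finset.mul_sum, Finset.mul_sum, ← Finset.sum_add_distrib]
      refine Finset.sum_congr rfl fun i _ => ?_
      rw [hpW]; ring
    rw [hA]
    simp only [e1, e2]
    ring
  set δ : ℝ := (n - 1 - b) / 2 with hδd
  have hδ0 : 0 < δ := by rw [hδd]; linarith
  have hpt : ∀ x, δ * (w x * ζ x ^ 2 * gradSq U x - w x * ζ x ^ 2
      - C * (χ x ^ 2 * (gradSq U x + 1)))
      ≤ A x + 3 / 2 * μ * (stabDensity U x * (v x * ζ x) ^ 2
        - (gradSq U x + 1) * gradSq (fun x => v x * ζ x) x) := by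
    intro x
    have hP := gradSq_nonneg U x
    by_cases hx : x ∈ tsupport ζ
    · obtain ⟨G, hG, hζG, hGC⟩ := hC x (hζV hx)
      have hX2 : ∑ i, (x i - c i) ^ 2 ≤ ‖x - c‖ ^ 2 := (norm_sub_sq_eq_sum x c).ge
      have hs := abs_sum_mul_le (norm_nonneg (x - c)) (Real.sqrt_nonneg (gradSq U x)) hX2
        (Real.sq_sqrt hP).ge
      have ht := abs_sum_mul_le (Real.sqrt_nonneg (gradSq U x)) hG (Real.sq_sqrt hP).ge hζG
      have hst' : |(∑ i, (x i - c i) * pd i U x) * ∑ i, pd i U x * pd i ζ x|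
          ≤ gradSq U x * (‖x - c‖ * G) := by
        rw [abs_mul]
        calc _ ≤ (‖x - c‖ * √(gradSq U x)) * (√(gradSq U x) * G) :=
              mul_le_mul hs ht (abs_nonneg _) (by positivity)
          _ = √(gradSq U x) ^ 2 * (‖x - c‖ * G) := by ring
          _ = _ := by rw [Real.sq_sqrt hP]
      have hQ : gradSq (fun x => v x * ζ x) x
          ≤ 2 * ζ x ^ 2 * gradSq v x + 2 * v x ^ 2 * G ^ 2 := by
        refine (gradSq_mul_le (hv.differentiable (by norm_num) x) (hζd x)).trans ?_
        have := mul_le_mul_of_nonneg_left hζG (show 0 ≤ 2 * v x ^ 2 by positivity)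
        linarith
      have := weighted_gradient_algebra (d := n - 1) hP (stabDensity_nonneg x) (hw0 x) (hζ0 x)
        (hζ1 x) hG (norm_nonneg (x - c)) (hm x) hL hμ (sq_radialHess_le hn hU c x) (hmb x)
        (hLv x (hζV hx)) hst' (abs_sum_mul_le (norm_nonneg (x - c)) hG hX2 hζG) hQ (hva x) hδ hGC
      rw [hAeq]
      rw [mul_assoc C] at this
      exact this
    · have h0 : ζ x = 0 := image_eq_zero_of_notMem_tsupport hx
      have hpz : ∀ i, pd i (fun x => v x * ζ x) x = 0 :=
        pd_eq_zero_of_notMem_tsupport fun h => hx (tsupport_mul_subset_right h)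
      have hg0 : gradSq (fun x => v x * ζ x) x = 0 := by simp [gradSq, hpz]
      rw [hAeq, h0, hg0]
      have : 0 ≤ C * (χ x ^ 2 * (gradSq U x + 1)) := by positivity
      nlinarith
  have cw := hw.continuous
  have cv := hv.continuous
  have cζ := hζ.continuous
  have cP := (contDiff_gradSq hU).continuous
  have cS := continuous_stabDensity hU
  have hz : ∀ x, x ∉ tsupport ζ → ζ x = 0 := fun x hx => image_eq_zero_of_notMem_tsupport hx
  have i1 : Integrable (fun x => w x * ζ x ^ 2 * gradSq U x) :=
    integrable_of_zero_off_tsupport (by fun_prop) hζc fun x hx => by simp [hz x hx]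
  have i2 : Integrable (fun x => w x * ζ x ^ 2) :=
    integrable_of_zero_off_tsupport (by fun_prop) hζc fun x hx => by simp [hz x hx]
  have i3 : Integrable (fun x => χ x ^ 2 * (gradSq U x + 1)) :=
    integrable_of_zero_off_tsupport (by fun_prop) hχc fun x hx => by
      simp [image_eq_zero_of_notMem_tsupport hx]
  have i4 : Integrable (fun x => stabDensity U x * (v x * ζ x) ^ 2) :=
    integrable_of_zero_off_tsupport (by fun_prop) hζc fun x hx => by simp [hz x hx]
  have cQ : Continuous (gradSq (fun x => v x * ζ x)) :=
    continuous_finsetSum _ fun i _ => (continuous_pd hvζ i).pow 2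
  have i5 : Integrable (fun x => (gradSq U x + 1) * gradSq (fun x => v x * ζ x) x) :=
    integrable_of_zero_off_tsupport (by fun_prop) hζc fun x hx => by
      have hpz : ∀ i, pd i (fun x => v x * ζ x) x = 0 :=
        pd_eq_zero_of_notMem_tsupport fun h => hx (tsupport_mul_subset_right h)
      simp [gradSq, hpz]
  have cA : Continuous A := by
    have c1 : ∀ i, Continuous (pd i (fun x => w x * ζ x ^ 2)) := fun i => continuous_pd hW i
    have c2 : ∀ i, Continuous (pd i U) := fun i => continuous_pd (hU.of_le (by norm_num)) i
    have c3 : Continuous (radialHess U c) :=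
      (continuous_finsetSum _ fun i _ => (continuous_hessGrad hU i).mul (by fun_prop)).sub
        ((continuous_finsetSum _ fun i _ => (by fun_prop : Continuous fun y : Euc n => y i - c i).mul
          (c2 i)).mul (continuous_finsetSum _ fun i _ => continuous_pd_pd hU i i))
    rw [hA]
    fun_prop
  have i6 : Integrable A :=
    integrable_of_zero_off_tsupport cA hζc fun x hx => by rw [hAeq, hz x hx]; ring
  have i12 : Integrable (fun x => w x * ζ x ^ 2 * gradSq U x - w x * ζ x ^ 2) := i1.sub i2
  have i123 : Integrable (fun x => w x * ζ x ^ 2 * gradSq U x - w x * ζ x ^ 2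
      - C * (χ x ^ 2 * (gradSq U x + 1))) := i12.sub (i3.const_mul C)
  have i45 : Integrable (fun x => 3 / 2 * μ * (stabDensity U x * (v x * ζ x) ^ 2
        - (gradSq U x + 1) * gradSq (fun x => v x * ζ x) x)) := (i4.sub i5).const_mul _
  have hle := integral_mono (i123.const_mul δ) (i6.add i45) hpt
  have hAz : ∫ x, A x = 0 := hid
  have hr : ∫ x, (A x + 3 / 2 * μ * (stabDensity U x * (v x * ζ x) ^ 2
        - (gradSq U x + 1) * gradSq (fun x => v x * ζ x) x)) ≤ 0 := by
    rw [integral_add i6 i45, hAz, integral_const_mul, integral_sub i4 i5, zero_add]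
    exact mul_nonpos_of_nonneg_of_nonpos (by positivity) (by linarith)
  have hl : δ * ∫ x, (w x * ζ x ^ 2 * gradSq U x - w x * ζ x ^ 2
      - C * (χ x ^ 2 * (gradSq U x + 1))) ≤ 0 := by
    rw [← integral_const_mul]
    exact hle.trans hr
  have hl' := nonpos_of_mul_nonpos_right hl hδ0
  rw [integral_sub i12 (i3.const_mul C), integral_sub i1 i2, integral_const_mul] at hl'
  linarith

end WeightedGradient

section ConcreteWeights

variable {n : ℕ}

/-- Regularised squared distance to `c`. -/
def regSq (c : Euc n) (e : ℝ) (x : Euc n) : ℝ := ‖x - c‖ ^ 2 + e ^ 2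

lemma regSq_pos (c : Euc n) {e : ℝ} (he : 0 < e) (x : Euc n) : 0 < regSq c e x := by
  rw [regSq]; positivity

lemma contDiff_regSq_rpow {m : WithTop ℕ∞} (c : Euc n) {e : ℝ} (he : 0 < e) (s : ℝ) :
    ContDiff ℝ m (fun x => regSq c e x ^ s) :=
  ((contDiff_norm_sub_sq c).add contDiff_const).rpow_const_of_ne fun x => (regSq_pos c he x).ne'

lemma pd_regSq_rpow (c : Euc n) {e : ℝ} (he : 0 < e) (s : ℝ) (i : Fin n) (x : Euc n) :
    pd i (fun y => regSq c e y ^ s) x = 2 * s * regSq c e x ^ (s - 1) * (x i - c i) := by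
  have hd : DifferentiableAt ℝ (fun y : Euc n => ‖y - c‖ ^ 2) x :=
    (contDiff_norm_sub_sq (m := 1) c).differentiable (by norm_num) x
  have hd' : DifferentiableAt ℝ (regSq c e) x := hd.add (by fun_prop)
  have hr : pd i (regSq c e) x = 2 * (x i - c i) := by
    have : pd i (fun y => ‖y - c‖ ^ 2 + e ^ 2) x = 2 * (x i - c i) := by
      rw [pd_add hd (by fun_prop), pd_const, pd_norm_sub_sq, add_zero]
    exact this
  rw [pd_comp (F := fun r => r ^ s) (Real.hasDerivAt_rpow_const (Or.inl (regSq_pos c he x).ne')) hd',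
    hr]
  ring

lemma norm_sq_le_regSq (c : Euc n) (e : ℝ) (x : Euc n) : ‖x - c‖ ^ 2 ≤ regSq c e x := by
  rw [regSq]; linarith [sq_nonneg e]

lemma regSq_le {c : Euc n} {e D : ℝ} (he : 0 < e) (he1 : e ≤ 1) {x : Euc n} (hx : ‖x - c‖ ≤ D) :
    regSq c e x ≤ D ^ 2 + 1 := by
  have h1 : ‖x - c‖ ^ 2 ≤ D ^ 2 := pow_le_pow_left₀ (norm_nonneg _) hx 2
  have h2 : e ^ 2 ≤ 1 := pow_le_one₀ he.le he1
  rw [regSq]; linarith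

lemma gradSq_regSq_rpow_le (c : Euc n) {e : ℝ} (he : 0 < e) (s : ℝ) (x : Euc n) :
    gradSq (fun y => regSq c e y ^ (-s)) x ≤ 4 * s ^ 2 * regSq c e x ^ (-(2 * s) - 1) := by
  have hr := regSq_pos c he x
  have h1 : gradSq (fun y => regSq c e y ^ (-s)) x
      = 4 * s ^ 2 * (regSq c e x ^ (-s - 1)) ^ 2 * ‖x - c‖ ^ 2 := by
    rw [gradSq, norm_sub_sq_eq_sum, Finset.mul_sum]
    refine Finset.sum_congr rfl fun i _ => ?_
    rw [pd_regSq_rpow c he]; ring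
  have h2 : (regSq c e x ^ (-s - 1)) ^ 2 * regSq c e x = regSq c e x ^ (-(2 * s) - 1) := by
    rw [← Real.rpow_natCast, ← Real.rpow_mul hr.le]
    nth_rewrite 2 [← Real.rpow_one (regSq c e x)]
    rw [← Real.rpow_add hr]
    congr 1
    push_cast; ring
  rw [h1, ← h2]
  have := mul_le_mul_of_nonneg_left (norm_sq_le_regSq c e x)
    (show 0 ≤ 4 * s ^ 2 * (regSq c e x ^ (-s - 1)) ^ 2 by positivity)
  linarith

/-- A solution `u` of `-Δu = f(u)` stable in `Ω`, with a globally defined `C²` model `U` of `u`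
on `V`. -/
structure StableModel (Ω V : Set (Euc n)) (f : ℝ → ℝ) (u U : Euc n → ℝ) : Prop where
  isOpen : IsOpen Ω
  subset : V ⊆ Ω
  contDiff_f : ContDiff ℝ 1 f
  mono : Monotone f
  stable : IsSemiStable Ω f u
  eqOn : ∀ x ∈ V, u x = U x
  contDiff : ContDiff ℝ 2 U
  hasCompactSupport : HasCompactSupport U
  equation : ∀ x ∈ V, lapl U x + f (U x) = 0

lemma exists_weight_parameters (hn : n = 2 ∨ n = 3 ∨ n = 4) : ∃ t s : ℝ, 0 < t ∧ 0 ≤ s ∧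
    (n : ℝ) - 2 < 2 * t ∧ 2 * t < n - 1 ∧
    (∀ r : ℝ, 0 < r → 4 * s ^ 2 * r ^ (-(2 * s) - 1) ≤ 4 * s ^ 2 * r ^ (-t)) ∧
    ∀ D : ℝ, ∃ L μ : ℝ, 0 ≤ L ∧ 0 < μ ∧
      (∀ r : ℝ, 0 < r → r ≤ D ^ 2 + 1 → r ^ (-t) * r ≤ L * (r ^ (-s)) ^ 2) ∧
      3 / 2 * (2 * (4 * s ^ 2) * μ + L / μ) ≤ (n - 1 - 2 * t) / 2 := by
  have key : ∀ t : ℝ, 0 < t → t ≤ 1 → 2 * t < n - 1 → ∀ D : ℝ, ∃ L μ : ℝ, 0 ≤ L ∧ 0 < μ ∧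
      (∀ r : ℝ, 0 < r → r ≤ D ^ 2 + 1 → r ^ (-t) * r ≤ L * (r ^ (-(0 : ℝ))) ^ 2) ∧
      3 / 2 * (2 * (4 * (0 : ℝ) ^ 2) * μ + L / μ) ≤ (n - 1 - 2 * t) / 2 := by
    intro t ht ht1 htn D
    set L : ℝ := (D ^ 2 + 1) ^ (1 - t) with hL
    have hLpos : 0 < L := Real.rpow_pos_of_pos (by positivity) _
    have hδ : 0 < (n - 1 - 2 * t) / 2 := by linarith
    refine ⟨L, 3 / 2 * L / ((n - 1 - 2 * t) / 2), hLpos.le, by positivity, ?_, ?_⟩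
    · intro r hr hrD
      have : r ^ (-t) * r = r ^ (1 - t) := by
        nth_rewrite 2 [← Real.rpow_one r]
        rw [← Real.rpow_add hr]
        congr 1; ring
      rw [this, neg_zero, Real.rpow_zero, one_pow, mul_one]
      exact Real.rpow_le_rpow hr.le hrD (by linarith)
    · have : 3 / 2 * (2 * (4 * (0 : ℝ) ^ 2) * (3 / 2 * L / ((n - 1 - 2 * t) / 2))
          + L / (3 / 2 * L / ((n - 1 - 2 * t) / 2))) = (n - 1 - 2 * t) / 2 := by
        have h2 : (n - 1 - 2 * t : ℝ) ≠ 0 := by linarith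
        field_simp
        ring
      exact this.le
  rcases hn with rfl | rfl | rfl
  · refine ⟨1 / 4, 0, by norm_num, le_rfl, by norm_num, by norm_num, ?_, key _ (by norm_num)
      (by norm_num) (by norm_num)⟩
    intro r _; simp
  · refine ⟨3 / 4, 0, by norm_num, le_rfl, by norm_num, by norm_num, ?_, key _ (by norm_num)
      (by norm_num) (by norm_num)⟩
    intro r _; simp
  · refine ⟨21 / 20, 1 / 40, by norm_num, by norm_num, by norm_num, by norm_num, ?_, ?_⟩
    · intro r _
      norm_num
    · refine fun D => ⟨1, 20, by norm_num, by norm_num, ?_, by norm_num⟩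
      intro r hr _
      have h1 : r ^ (-(21 / 20) : ℝ) * r = r ^ (-(1 / 20) : ℝ) := by
        nth_rewrite 2 [← Real.rpow_one r]
        rw [← Real.rpow_add hr]
        congr 1; norm_num
      rw [h1, one_mul, ← Real.rpow_natCast, ← Real.rpow_mul hr.le]
      refine le_of_eq ?_
      congr 1; norm_num

lemma exists_weighted_gradient_const (hn : n = 2 ∨ n = 3 ∨ n = 4) : ∃ t : ℝ, 0 < t ∧
    (n : ℝ) - 2 < 2 * t ∧ 2 * t < n - 1 ∧ ∀ D r G : ℝ, 0 < D → 0 < r → 0 ≤ G →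
    ∃ C : ℝ, 0 ≤ C ∧ ∀ (Ω V : Set (Euc n)) (f : ℝ → ℝ) (u U ζ χ : Euc n → ℝ) (c : Euc n) (e : ℝ),
      StableModel Ω V f u U → ContDiff ℝ 1 ζ → HasCompactSupport ζ → tsupport ζ ⊆ V →
      (∀ x, 0 ≤ ζ x) → (∀ x, ζ x ≤ 1) → Continuous χ → HasCompactSupport χ →
      (∀ x ∈ V, ‖x - c‖ ≤ D) →
      (∀ x, gradSq ζ x = 0 ∨ (gradSq ζ x ≤ G ^ 2 ∧ r ≤ ‖x - c‖ ∧ χ x = 1)) →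
      0 < e → e ≤ 1 →
      ∫ x, regSq c e x ^ (-t) * ζ x ^ 2 * gradSq U x
        ≤ (∫ x, regSq c e x ^ (-t) * ζ x ^ 2) + C * ∫ x, χ x ^ 2 * (gradSq U x + 1) := by
  obtain ⟨t, s, ht, hs, ht2, htn, hst, hD⟩ := exists_weight_parameters hn
  refine ⟨t, ht, ht2, htn, fun D r G hD0 hr hG => ?_⟩
  obtain ⟨L, μ, hL, hμ, hLr, hδ⟩ := hD D
  have hδ0 : 0 < (n - 1 - 2 * t) / 2 := by linarith
  set C0 : ℝ := 3 * μ * ((r ^ 2) ^ (-s)) ^ 2 * G ^ 2 + 4 * (r ^ 2) ^ (-t) * D * G with hC0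
  have hC0' : 0 ≤ C0 := by positivity
  refine ⟨C0 / ((n - 1 - 2 * t) / 2), by positivity, ?_⟩
  intro Ω V f u U ζ χ c e h hζ hζc hζV hζ0 hζ1 hχ hχc hVD hgr he he1
  have hw0 : ∀ x, 0 < regSq c e x := fun x => regSq_pos c he x
  refine h.stable.integral_weighted_gradSq_le (m := fun x => 2 * t * regSq c e x ^ (-t - 1))
    (v := fun x => regSq c e x ^ (-s)) (a := 4 * s ^ 2) (b := 2 * t) (L := L) (μ := μ) (c := c)
    h.isOpen h.subset h.contDiff_f h.mono h.eqOn h.contDiff h.hasCompactSupport h.equation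
    (by omega) (contDiff_regSq_rpow c he _) (contDiff_regSq_rpow c he _) hζ hζc hζV hζ0 hζ1 hχ hχc
    (fun x => (Real.rpow_pos_of_pos (hw0 x) _).le)
    (fun x => by have := hw0 x; positivity) ?_ ?_ ?_ hL ?_ hμ (by positivity) htn hδ ?_
  · intro i x
    rw [pd_regSq_rpow c he]; ring
  · intro x
    have h1 : regSq c e x ^ (-t - 1) * regSq c e x = regSq c e x ^ (-t) := by
      nth_rewrite 2 [← Real.rpow_one (regSq c e x)]
      rw [← Real.rpow_add (hw0 x)]
      congr 1; ring
    have := mul_le_mul_of_nonneg_left (norm_sq_le_regSq c e x)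
      (show 0 ≤ 2 * t * regSq c e x ^ (-t - 1) by have := hw0 x; positivity)
    calc _ ≤ _ := this
      _ = _ := by rw [mul_assoc, h1]
  · intro x
    exact (gradSq_regSq_rpow_le c he s x).trans (hst _ (hw0 x))
  · intro x hx
    refine le_trans ?_ (hLr _ (hw0 x) (regSq_le he he1 (hVD x hx)))
    exact mul_le_mul_of_nonneg_left (norm_sq_le_regSq c e x) (Real.rpow_nonneg (hw0 x).le _)
  · intro x hx
    rcases hgr x with h0 | ⟨hG', hrx, hχx⟩
    · refine ⟨0, le_rfl, by rw [h0]; simp, ?_⟩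
      have : 0 ≤ (n - 1 - 2 * t) / 2 * (C0 / ((n - 1 - 2 * t) / 2) * χ x ^ 2) := by positivity
      simpa using this
    · refine ⟨G, hG, hG', ?_⟩
      have e1 : (n - 1 - 2 * t) / 2 * (C0 / ((n - 1 - 2 * t) / 2) * χ x ^ 2) = C0 := by
        rw [hχx, one_pow, mul_one, mul_div_cancel₀ _ hδ0.ne']
      rw [e1, hC0]
      have hr2 : r ^ 2 ≤ regSq c e x :=
        (pow_le_pow_left₀ hr.le hrx 2).trans (norm_sq_le_regSq c e x)
      have h1 : regSq c e x ^ (-s) ≤ (r ^ 2) ^ (-s) :=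
        Real.rpow_le_rpow_of_nonpos (by positivity) hr2 (by linarith)
      have h2 : regSq c e x ^ (-t) ≤ (r ^ 2) ^ (-t) :=
        Real.rpow_le_rpow_of_nonpos (by positivity) hr2 (by linarith)
      have h3 := hVD x hx
      have := hw0 x
      gcongr

end ConcreteWeights

section InteriorBound

variable {n : ℕ}

lemma continuous_regSq_rpow (c : Euc n) {e : ℝ} (he : 0 < e) (s : ℝ) :
    Continuous (fun x => regSq c e x ^ s) := (contDiff_regSq_rpow (m := 0) c he s).continuous

lemma exists_integral_regSq_rpow_le (hn : 1 ≤ n) {s : ℝ} (hs : 0 ≤ s) (hsn : 2 * s < n) (D : ℝ) :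
    ∃ K : ℝ, ∀ (c : Euc n) (e : ℝ), 0 < e →
      ∫ x in Metric.ball c D, regSq c e x ^ (-s) ≤ K := by
  have : Nonempty (Fin n) := ⟨⟨0, hn⟩⟩
  have hnt : Nontrivial (Euc n) := inferInstance
  have hint : IntegrableOn (fun y : Euc n => ‖y‖ ^ (-(2 * s))) (Metric.ball 0 D) := by
    refine integrableOn_ball_of_norm_le_rpow (C := 1) (α := 2 * s) (by simpa using hn)
      (by simpa using hsn) (Eventually.of_forall fun y => ?_) ?_
    · rw [one_mul, Real.norm_of_nonneg (by positivity)]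
    · exact (measurable_norm.pow_const _).aestronglyMeasurable
  refine ⟨∫ y in Metric.ball (0 : Euc n) D, ‖y‖ ^ (-(2 * s)), fun c e he => ?_⟩
  have h1 : ∫ x in Metric.ball c D, regSq c e x ^ (-s)
      = ∫ y in Metric.ball (0 : Euc n) D, regSq 0 e y ^ (-s) := by
    rw [← integral_indicator Metric.isOpen_ball.measurableSet,
      ← integral_indicator Metric.isOpen_ball.measurableSet,
      ← integral_sub_right_eq_self (μ := (volume : Measure (Euc n)))
        ((Metric.ball (0 : Euc n) D).indicator fun y => regSq 0 e y ^ (-s)) c]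
    congr 1
    ext x
    simp only [Set.indicator, Metric.mem_ball, dist_eq_norm, sub_zero, regSq]
  rw [h1]
  refine setIntegral_mono_ae_restrict ?_ hint ?_
  · exact ((continuous_regSq_rpow 0 he _).continuousOn.integrableOn_compact
      (isCompact_closedBall 0 D)).mono_set Metric.ball_subset_closedBall
  · have h0 : ∀ᵐ y : Euc n, y ≠ 0 := by
      rw [ae_iff]; simp
    filter_upwards [ae_restrict_of_ae h0] with y hy
    have hy' : 0 < ‖y‖ := norm_pos_iff.2 hy
    have h2 : ‖y‖ ^ (-(2 * s)) = (‖y‖ ^ 2) ^ (-s) := by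
      rw [← Real.rpow_natCast, ← Real.rpow_mul hy'.le]
      congr 1; push_cast; ring
    rw [h2]
    refine Real.rpow_le_rpow_of_nonpos (by positivity) ?_ (by linarith)
    have := norm_sq_le_regSq 0 e y
    rwa [sub_zero] at this

/-- Caccioppoli inequality. -/
lemma integral_sq_mul_gradSq_le {χ U : Euc n → ℝ} {M B : ℝ} (hχ : ContDiff ℝ 1 χ)
    (hχc : HasCompactSupport χ) (hU : ContDiff ℝ 2 U) (hU0 : ∀ x ∈ tsupport χ, 0 ≤ U x)
    (hUM : ∀ x ∈ tsupport χ, U x ≤ M) (hB : ∀ x ∈ tsupport χ, |lapl U x| ≤ B) :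
    ∫ x, χ x ^ 2 * gradSq U x ≤ 2 * M * B * (∫ x, χ x ^ 2) + 4 * M ^ 2 * ∫ x, gradSq χ x := by
  have hp : ∀ i, ContDiff ℝ 1 (pd i U) := fun i => contDiff_pd hU (by norm_num) i
  have hU1 : ContDiff ℝ 1 U := hU.of_le (by norm_num)
  have hF : ∀ i, ContDiff ℝ 1 (fun y : Euc n => χ y ^ 2 * (U y * pd i U y)) := fun i =>
    (hχ.pow 2).mul (hU1.mul (hp i))
  have hχ2c : HasCompactSupport (fun y => χ y ^ 2) :=
    hχc.comp_left (g := fun s => s ^ 2) (by norm_num)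
  have h0 : ∀ i, ∫ x, pd i (fun y : Euc n => χ y ^ 2 * (U y * pd i U y)) x = 0 :=
    fun i => integral_pd_eq_zero (hF i) hχ2c.mul_right i
  have hint : ∀ i, Integrable (pd i (fun y : Euc n => χ y ^ 2 * (U y * pd i U y))) := fun i =>
    (continuous_pd (hF i) i).integrable_of_hasCompactSupport
      (hasCompactSupport_pd hχ2c.mul_right i)
  have hsum : ∫ x, ∑ i, pd i (fun y : Euc n => χ y ^ 2 * (U y * pd i U y)) x = 0 := by
    rw [integral_finsetSum _ fun i _ => hint i]
    exact Finset.sum_eq_zero fun i _ => h0 i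
  have hA : ∀ x, ∑ i, pd i (fun y : Euc n => χ y ^ 2 * (U y * pd i U y)) x
      = χ x ^ 2 * gradSq U x + χ x ^ 2 * (U x * lapl U x)
        + 2 * χ x * U x * ∑ i, pd i χ x * pd i U x := by
    intro x
    rw [gradSq, lapl_eq_sum_pd]
    simp only [Finset.mul_sum, ← Finset.sum_add_distrib]
    refine Finset.sum_congr rfl fun i _ => ?_
    have dχ := hχ.differentiable (by norm_num) x
    have dU := hU1.differentiable (by norm_num) x
    have dp := (hp i).differentiable (by norm_num) x
    rw [pd_mul (u := fun y => χ y ^ 2) (v := fun y => U y * pd i U y) (dχ.pow 2) (dU.mul dp),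
      pd_pow_two dχ, pd_mul dU dp]
    ring
  have hpt : ∀ x, 1 / 2 * (χ x ^ 2 * gradSq U x) ≤
      ∑ i, pd i (fun y : Euc n => χ y ^ 2 * (U y * pd i U y)) x
        + (M * B * χ x ^ 2 + 2 * M ^ 2 * gradSq χ x) := by
    intro x
    rw [hA]
    by_cases hx : x ∈ tsupport χ
    · have h1 : -(χ x ^ 2 * (U x * lapl U x)) ≤ M * B * χ x ^ 2 := by
        have h2 : |U x * lapl U x| ≤ M * B := by
          rw [abs_mul, abs_of_nonneg (hU0 x hx)]
          exact mul_le_mul (hUM x hx) (hB x hx) (abs_nonneg _) ((hU0 x hx).trans (hUM x hx))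
        have := mul_le_mul_of_nonneg_left (abs_le.1 h2).1 (sq_nonneg (χ x))
        linarith
      have h3 : -(2 * χ x * U x * ∑ i, pd i χ x * pd i U x)
          ≤ 1 / 2 * (χ x ^ 2 * gradSq U x) + 2 * U x ^ 2 * gradSq χ x := by
        simp only [gradSq, Finset.mul_sum, ← Finset.sum_add_distrib, ← Finset.sum_neg_distrib]
        refine Finset.sum_le_sum fun i _ => ?_
        nlinarith [sq_nonneg (χ x * pd i U x + 2 * (U x * pd i χ x))]
      have h4 : 2 * U x ^ 2 * gradSq χ x ≤ 2 * M ^ 2 * gradSq χ x := by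
        have := pow_le_pow_left₀ (hU0 x hx) (hUM x hx) 2
        have h5 := gradSq_nonneg χ x
        nlinarith
      linarith
    · have h1 : χ x = 0 := image_eq_zero_of_notMem_tsupport hx
      have := gradSq_nonneg χ x
      rw [h1]
      have : 0 ≤ 2 * M ^ 2 * gradSq χ x := by positivity
      simpa using this
  have cχ := hχ.continuous
  have cP := (contDiff_gradSq hU).continuous
  have cgχ : Continuous (gradSq χ) := continuous_finsetSum _ fun i _ => (continuous_pd hχ i).pow 2
  have i1 : Integrable (fun x => χ x ^ 2 * gradSq U x) :=
    integrable_of_zero_off_tsupport (by fun_prop) hχc fun x hx => by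
      simp [image_eq_zero_of_notMem_tsupport hx]
  have i2 : Integrable (fun x => χ x ^ 2) :=
    integrable_of_zero_off_tsupport (by fun_prop) hχc fun x hx => by
      simp [image_eq_zero_of_notMem_tsupport hx]
  have i3 : Integrable (gradSq χ) :=
    integrable_of_zero_off_tsupport cgχ hχc fun x hx => by
      simp [gradSq, pd_eq_zero_of_notMem_tsupport hx]
  have i4 : Integrable
      (fun x => ∑ i, pd i (fun y : Euc n => χ y ^ 2 * (U y * pd i U y)) x) :=
    integrable_finsetSum _ fun i _ => hint i
  have i5 : Integrable (fun x => M * B * χ x ^ 2 + 2 * M ^ 2 * gradSq χ x) :=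
    (i2.const_mul _).add (i3.const_mul _)
  have := integral_mono (i1.const_mul (1 / 2)) (i4.add i5) hpt
  have e : ∫ x, (∑ i, pd i (fun y : Euc n => χ y ^ 2 * (U y * pd i U y)) x
        + (M * B * χ x ^ 2 + 2 * M ^ 2 * gradSq χ x))
      = M * B * (∫ x, χ x ^ 2) + 2 * M ^ 2 * ∫ x, gradSq χ x := by
    rw [integral_add i4 i5, hsum, integral_add (i2.const_mul _) (i3.const_mul _),
      integral_const_mul, integral_const_mul, zero_add]
  have h := this.trans_eq e
  rw [integral_const_mul] at h
  linarith

/-- Regularised representation formula. -/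
lemma integral_mul_regSq_rpow {φ : Euc n → ℝ} (hφ : ContDiff ℝ 1 φ) (hφc : HasCompactSupport φ)
    (c : Euc n) {e : ℝ} (he : 0 < e) :
    ∫ x, φ x * (n * e ^ 2 * regSq c e x ^ (-(n / 2 : ℝ) - 1))
      = ∫ x, -((∑ i, (x i - c i) * pd i φ x) * regSq c e x ^ (-(n / 2 : ℝ))) := by
  have hw : ∀ i, ContDiff ℝ 1 (fun y : Euc n => (y i - c i) * regSq c e y ^ (-(n / 2 : ℝ))) :=
    fun i => (by fun_prop : ContDiff ℝ 1 fun y : Euc n => y i - c i).mul (contDiff_regSq_rpow c he _)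
  have h := fun i => integral_pd_mul_eq_neg hφ hφc (hw i) i
  have i1 : ∀ i, Integrable (fun x =>
      pd i (fun y : Euc n => (y i - c i) * regSq c e y ^ (-(n / 2 : ℝ))) x * φ x) := fun i =>
    ((continuous_pd (hw i) i).mul hφ.continuous).integrable_of_hasCompactSupport hφc.mul_left
  have i2 : ∀ i, Integrable (fun x : Euc n =>
      ((x i - c i) * regSq c e x ^ (-(n / 2 : ℝ))) * pd i φ x) := fun i =>
    ((hw i).continuous.mul (continuous_pd hφ i)).integrable_of_hasCompactSupport
      (hasCompactSupport_pd hφc i).mul_left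
  have hL : ∀ x, φ x * (n * e ^ 2 * regSq c e x ^ (-(n / 2 : ℝ) - 1))
      = ∑ i, pd i (fun y : Euc n => (y i - c i) * regSq c e y ^ (-(n / 2 : ℝ))) x * φ x := by
    intro x
    have hr := regSq_pos c he x
    have h1 : ∀ i, pd i (fun y : Euc n => (y i - c i) * regSq c e y ^ (-(n / 2 : ℝ))) x
        = regSq c e x ^ (-(n / 2 : ℝ)) - n * regSq c e x ^ (-(n / 2 : ℝ) - 1) * (x i - c i) ^ 2 := by
      intro i
      rw [pd_mul (by fun_prop)
        ((contDiff_regSq_rpow (m := 1) c he _).differentiable (by norm_num) x), pd_coord_sub,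
        pd_regSq_rpow c he, if_pos rfl]
      ring
    have h2 : regSq c e x ^ (-(n / 2 : ℝ)) = regSq c e x ^ (-(n / 2 : ℝ) - 1) * regSq c e x := by
      nth_rewrite 3 [← Real.rpow_one (regSq c e x)]
      rw [← Real.rpow_add hr]
      congr 1; ring
    rw [← Finset.sum_mul]
    simp only [h1, Finset.sum_sub_distrib, ← Finset.mul_sum, ← norm_sub_sq_eq_sum]
    rw [h2]
    simp only [Finset.sum_const, Finset.card_univ, Fintype.card_fin, nsmul_eq_mul]
    rw [regSq]
    ring
  have hR : ∀ x, -((∑ i, (x i - c i) * pd i φ x) * regSq c e x ^ (-(n / 2 : ℝ)))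
      = -∑ i, ((x i - c i) * regSq c e x ^ (-(n / 2 : ℝ))) * pd i φ x := by
    intro x
    rw [Finset.sum_mul]
    congr 1
    refine Finset.sum_congr rfl fun i _ => by ring
  simp only [hL, hR]
  rw [integral_finsetSum _ fun i _ => i1 i, integral_neg, integral_finsetSum _ fun i _ => i2 i,
    ← Finset.sum_neg_distrib]
  exact Finset.sum_congr rfl fun i _ => h i

end InteriorBound

section PointwiseBound

variable {n : ℕ}

lemma exists_gradSq_le {ζ : Euc n → ℝ} (hζ : ContDiff ℝ 1 ζ) (hζc : HasCompactSupport ζ) :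
    ∃ G : ℝ, 0 ≤ G ∧ ∀ x, gradSq ζ x ≤ G ^ 2 := by
  have cg : Continuous (gradSq ζ) := continuous_finsetSum _ fun i _ => (continuous_pd hζ i).pow 2
  have hc : HasCompactSupport (gradSq ζ) := HasCompactSupport.intro hζc fun x hx => by
    simp [gradSq, pd_eq_zero_of_notMem_tsupport hx]
  obtain ⟨K, hK⟩ := hc.exists_bound_of_continuous cg
  refine ⟨√K, Real.sqrt_nonneg _, fun x => ?_⟩
  have h := (le_abs_self _).trans (hK x)
  rwa [Real.sq_sqrt ((gradSq_nonneg ζ x).trans h)]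

lemma integral_mul_le_integral_ball {ζ F : Euc n → ℝ} {c : Euc n} {D : ℝ} (hζ : Continuous ζ)
    (hζ1 : ∀ x, |ζ x| ≤ 1) (hsupp : ∀ x, ζ x ≠ 0 → x ∈ Metric.ball c D) (hF : Continuous F)
    (hF0 : ∀ x, 0 ≤ F x) : ∫ x, F x * ζ x ^ 2 ≤ ∫ x in Metric.ball c D, F x := by
  have hi : IntegrableOn F (Metric.ball c D) :=
    (hF.continuousOn.integrableOn_compact (isCompact_closedBall c D)).mono_set
      Metric.ball_subset_closedBall
  rw [← setIntegral_eq_integral_of_forall_compl_eq_zero (s := Metric.ball c D) fun x hx => by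
    have : ζ x = 0 := by by_contra h; exact hx (hsupp x h)
    simp [this]]
  have hle : ∀ x, F x * ζ x ^ 2 ≤ F x := fun x => by
    have h1 : ζ x ^ 2 ≤ 1 := by rw [← sq_abs]; exact pow_le_one₀ (abs_nonneg _) (hζ1 x)
    nlinarith [hF0 x]
  refine setIntegral_mono ?_ hi hle
  exact ((hF.mul (hζ.pow 2)).continuousOn.integrableOn_compact (isCompact_closedBall c D)).mono_set
      Metric.ball_subset_closedBall

/-- On a small ball the regularised kernel has mass bounded below. -/
lemma ball_mass_eq {e : ℝ} (he : 0 < e) (c : Euc n) :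
    volume.real (Metric.ball c e) * (n * e ^ 2 * (2 * e ^ 2) ^ (-(n / 2 : ℝ) - 1))
      = n * 2 ^ (-(n / 2 : ℝ) - 1) * volume.real (Metric.ball (0 : Euc n) 1) := by
  have h1 : volume.real (Metric.ball c e) = e ^ n * volume.real (Metric.ball (0 : Euc n) 1) := by
    rw [Measure.real, Measure.addHaar_ball_of_pos volume c he, ENNReal.toReal_mul,
      ENNReal.toReal_ofReal (by positivity), finrank_euclideanSpace_fin, Measure.real]
  have h2 : (e ^ 2) ^ (-(n / 2 : ℝ) - 1) = (e ^ n * e ^ 2)⁻¹ := by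
    rw [← pow_add, ← Real.rpow_natCast, ← Real.rpow_natCast, ← Real.rpow_mul he.le,
      ← Real.rpow_neg he.le]
    congr 1; push_cast; ring
  rw [h1, Real.mul_rpow (by norm_num) (by positivity), h2]
  field_simp

lemma kernel_gradient_le {c x : Euc n} {e t z : ℝ} (he : 0 < e) (p : Fin n → ℝ) (hz : 0 ≤ z) :
    z * |∑ i, (x i - c i) * p i| * regSq c e x ^ (-(n / 2 : ℝ))
      ≤ 1 / 2 * (regSq c e x ^ (-t) * z ^ 2 * ∑ i, p i ^ 2)
        + 1 / 2 * regSq c e x ^ (-(n - 1 - t)) := by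
  have hr := regSq_pos c he x
  set P := ∑ i, p i ^ 2 with hP
  have hP0 : 0 ≤ P := Finset.sum_nonneg fun _ _ => sq_nonneg _
  have h1 : |∑ i, (x i - c i) * p i| ≤ ‖x - c‖ * √P :=
    abs_sum_mul_le (norm_nonneg _) (Real.sqrt_nonneg _) (norm_sub_sq_eq_sum x c).ge
      (Real.sq_sqrt hP0).ge
  have h2 : regSq c e x ^ (t - n) * regSq c e x = regSq c e x ^ (-(n - 1 - t)) := by
    nth_rewrite 2 [← Real.rpow_one (regSq c e x)]
    rw [← Real.rpow_add hr]
    congr 1; ring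
  have h3 : (regSq c e x ^ (-(n / 2 : ℝ))) ^ 2 = regSq c e x ^ (-t) * regSq c e x ^ (t - n) := by
    rw [← Real.rpow_natCast, ← Real.rpow_mul hr.le, ← Real.rpow_add hr]
    congr 1; push_cast; ring
  have h4 : regSq c e x ^ (t - n) * ‖x - c‖ ^ 2 ≤ regSq c e x ^ (-(n - 1 - t)) := by
    rw [← h2]
    exact mul_le_mul_of_nonneg_left (norm_sq_le_regSq c e x) (by positivity)
  refine le_trans ?_ (add_le_add_right (mul_le_mul_of_nonneg_left h4 (by norm_num)) _)
  refine le_trans (mul_le_mul_of_nonneg_right (mul_le_mul_of_nonneg_left h1 hz) (by positivity)) ?_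
  refine (abs_le_of_sq_le_sq (b := _) ?_ (by positivity)).trans' (le_abs_self _)
  have e1 : (z * (‖x - c‖ * √P) * regSq c e x ^ (-(n / 2 : ℝ))) ^ 2
      = (regSq c e x ^ (-t) * z ^ 2 * P) * (regSq c e x ^ (t - n) * ‖x - c‖ ^ 2) := by
    rw [mul_pow, mul_pow, mul_pow, h3, Real.sq_sqrt hP0]; ring
  rw [e1]
  nlinarith [sq_nonneg (regSq c e x ^ (-t) * z ^ 2 * P - regSq c e x ^ (t - n) * ‖x - c‖ ^ 2)]

/-- Interior `L∞` bound for stable solutions in low dimensions, given control of the solution in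
the region where the cutoff is not constant. -/
lemma exists_interior_bound (hn : n = 2 ∨ n = 3 ∨ n = 4) {D r M B : ℝ} (hD : 0 < D) (hr : 0 < r)
    (hM : 0 ≤ M) {ζ χ : Euc n → ℝ} (hζ : ContDiff ℝ 1 ζ) (hζc : HasCompactSupport ζ)
    (hζ0 : ∀ x, 0 ≤ ζ x) (hζ1 : ∀ x, ζ x ≤ 1) (hχ : ContDiff ℝ 1 χ) (hχc : HasCompactSupport χ) :
    ∃ K : ℝ, ∀ (Ω V : Set (Euc n)) (f : ℝ → ℝ) (u U : Euc n → ℝ) (c : Euc n),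
      StableModel Ω V f u U → tsupport ζ ⊆ V → (∀ x ∈ V, ‖x - c‖ ≤ D) →
      (∀ x, gradSq ζ x = 0 ∨ (r ≤ ‖x - c‖ ∧ χ x = 1)) → (∀ᶠ x in nhds c, ζ x = 1) →
      (∀ x ∈ V, 0 ≤ U x) → tsupport χ ⊆ V → (∀ x ∈ tsupport χ, U x ≤ M) →
      (∀ x ∈ tsupport χ, |lapl U x| ≤ B) → U c ≤ K := by
  obtain ⟨t, ht, ht2, htn, hC⟩ := exists_weighted_gradient_const hn
  obtain ⟨G, hG, hζG⟩ := exists_gradSq_le hζ hζc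
  obtain ⟨C, hC0, hC⟩ := hC D r G hD hr hG
  have hn1 : 1 ≤ n := by omega
  have hn0 : (1 : ℝ) ≤ n := by exact_mod_cast hn1
  obtain ⟨K1, hK1⟩ := exists_integral_regSq_rpow_le hn1 ht.le (by linarith) (D + 1)
  obtain ⟨K2, hK2⟩ := exists_integral_regSq_rpow_le (n := n) hn1 (s := n - 1 - t) (by linarith)
    (by linarith) (D + 1)
  set I1 := ∫ x, χ x ^ 2 with hI1
  set I2 := 2 * M * B * I1 + 4 * M ^ 2 * ∫ x, gradSq χ x with hI2
  set T := 1 / 2 * (K1 + C * (I2 + I1)) + 1 / 2 * K2 + M * D * G * (r ^ 2) ^ (-(n / 2 : ℝ)) * I1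
    with hT
  set κ := n * 2 ^ (-(n / 2 : ℝ) - 1) * volume.real (Metric.ball (0 : Euc n) 1) with hκ
  have hκ0 : 0 < κ := by
    have : 0 < volume.real (Metric.ball (0 : Euc n) 1) :=
      ENNReal.toReal_pos (Metric.measure_ball_pos volume 0 one_pos).ne' measure_ball_lt_top.ne
    positivity
  refine ⟨max 0 (2 * T / κ), ?_⟩
  intro Ω V f u U c h hζV hVD hgr hζc1 hU0 hχV hUM hUB
  by_contra! hlt
  have hUc0 : 0 < U c := (le_max_left _ _).trans_lt hlt
  have hUcT := (le_max_right _ _).trans_lt hlt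
  have hU := h.contDiff
  have hU1 : ContDiff ℝ 1 U := hU.of_le (by norm_num)
  set φ : Euc n → ℝ := fun x => ζ x * U x with hφ
  have hφ1 : ContDiff ℝ 1 φ := hζ.mul hU1
  have hφc : HasCompactSupport φ := hζc.mul_right
  have hz : ∀ x, x ∉ tsupport ζ → ζ x = 0 := fun x hx => image_eq_zero_of_notMem_tsupport hx
  have hzV : ∀ x, ζ x ≠ 0 → x ∈ V := fun x hx => hζV (by by_contra h'; exact hx (hz x h'))
  have hφ0 : ∀ x, 0 ≤ φ x := fun x => by
    by_cases hx : ζ x = 0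
    · simp [hφ, hx]
    · exact mul_nonneg (hζ0 x) (hU0 x (hzV x hx))
  have hnear : ∀ᶠ x in nhds c, U c / 2 ≤ φ x := by
    have h1 : ∀ᶠ x in nhds c, U c / 2 < U x :=
      hU.continuous.continuousAt.eventually (lt_mem_nhds (by linarith))
    filter_upwards [h1, hζc1] with x hx1 hx2
    simp only [hφ, hx2, one_mul]
    exact hx1.le
  obtain ⟨e0, he0, hball⟩ := Metric.eventually_nhds_iff_ball.1 hnear
  set e := min e0 1 with hedef
  have he : 0 < e := lt_min he0 one_pos
  have he1 : e ≤ 1 := min_le_right _ _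
  have hball' : ∀ x ∈ Metric.ball c e, U c / 2 ≤ φ x := fun x hx =>
    hball x (Metric.ball_subset_ball (min_le_left _ _) hx)
  have hw0 : ∀ x, 0 < regSq c e x := fun x => regSq_pos c he x
  have crho : ∀ s : ℝ, Continuous (fun x => regSq c e x ^ s) := continuous_regSq_rpow c he
  have cζ := hζ.continuous
  have cχ := hχ.continuous
  have cP := (contDiff_gradSq hU).continuous
  have hrep := integral_mul_regSq_rpow hφ1 hφc c he
  -- lower bound
  have hlow : U c / 2 * κ ≤ ∫ x, φ x * (n * e ^ 2 * regSq c e x ^ (-(n / 2 : ℝ) - 1)) := by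
    have ck := crho (-(n / 2 : ℝ) - 1)
    have hint : Integrable (fun x => φ x * (n * e ^ 2 * regSq c e x ^ (-(n / 2 : ℝ) - 1))) :=
      (hφ1.continuous.mul (by fun_prop)).integrable_of_hasCompactSupport hφc.mul_right
    have h1 : ∫ x in Metric.ball c e, U c / 2 * (n * e ^ 2 * (2 * e ^ 2) ^ (-(n / 2 : ℝ) - 1))
        ≤ ∫ x in Metric.ball c e, φ x * (n * e ^ 2 * regSq c e x ^ (-(n / 2 : ℝ) - 1)) := by
      refine setIntegral_mono_on (integrableOn_const measure_ball_lt_top.ne) hint.integrableOn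
        Metric.isOpen_ball.measurableSet fun x hx => ?_
      have h2 : regSq c e x ≤ 2 * e ^ 2 := by
        have : ‖x - c‖ ≤ e := by rw [← dist_eq_norm]; exact (Metric.mem_ball.1 hx).le
        have := pow_le_pow_left₀ (norm_nonneg _) this 2
        rw [regSq]; linarith
      have h3 : (2 * e ^ 2) ^ (-(n / 2 : ℝ) - 1) ≤ regSq c e x ^ (-(n / 2 : ℝ) - 1) :=
        Real.rpow_le_rpow_of_nonpos (hw0 x) h2 (by linarith)
      exact mul_le_mul (hball' x hx) (mul_le_mul_of_nonneg_left h3 (by positivity))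
        (by positivity) (hφ0 x)
    rw [setIntegral_const, smul_eq_mul] at h1
    have h4 : volume.real (Metric.ball c e)
          * (U c / 2 * (n * e ^ 2 * (2 * e ^ 2) ^ (-(n / 2 : ℝ) - 1))) = U c / 2 * κ := by
      rw [hκ, ← ball_mass_eq he c]; ring
    rw [← h4]
    refine h1.trans (setIntegral_le_integral hint (Eventually.of_forall fun x => ?_))
    have := hφ0 x
    have := (hw0 x).le
    show 0 ≤ φ x * (n * e ^ 2 * regSq c e x ^ (-(n / 2 : ℝ) - 1))
    positivity
  -- upper bound
  set Fk : Euc n → ℝ := (Metric.ball c (D + 1)).indicator fun x => regSq c e x ^ (-(n - 1 - t))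
    with hFk
  have hpt : ∀ x, -((∑ i, (x i - c i) * pd i φ x) * regSq c e x ^ (-(n / 2 : ℝ)))
      ≤ 1 / 2 * (regSq c e x ^ (-t) * ζ x ^ 2 * gradSq U x) + 1 / 2 * Fk x
        + M * D * G * (r ^ 2) ^ (-(n / 2 : ℝ)) * χ x ^ 2 := by
    intro x
    have hpd : ∑ i, (x i - c i) * pd i φ x = ζ x * (∑ i, (x i - c i) * pd i U x)
        + U x * ∑ i, (x i - c i) * pd i ζ x := by
      rw [Finset.mul_sum, Finset.mul_sum, ← Finset.sum_add_distrib]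
      refine Finset.sum_congr rfl fun i _ => ?_
      rw [hφ, pd_mul (hζ.differentiable (by norm_num) x) (hU1.differentiable (by norm_num) x)]
      ring
    have hρ : 0 ≤ regSq c e x ^ (-(n / 2 : ℝ)) := Real.rpow_nonneg (hw0 x).le _
    have hr2 : 0 ≤ (r ^ 2) ^ (-(n / 2 : ℝ)) := by positivity
    have hfirst : -(ζ x * (∑ i, (x i - c i) * pd i U x) * regSq c e x ^ (-(n / 2 : ℝ)))
        ≤ 1 / 2 * (regSq c e x ^ (-t) * ζ x ^ 2 * gradSq U x) + 1 / 2 * Fk x := by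
      by_cases hx : ζ x = 0
      · have hF0 : 0 ≤ Fk x := Set.indicator_nonneg (fun y _ => Real.rpow_nonneg (hw0 y).le _) x
        rw [hx]; simpa using hF0
      · have hxb : x ∈ Metric.ball c (D + 1) := by
          rw [Metric.mem_ball, dist_eq_norm]
          linarith [hVD x (hzV x hx)]
        have hk := kernel_gradient_le (c := c) (x := x) (t := t) he (fun i => pd i U x) (hζ0 x)
        have h1 := mul_le_mul_of_nonneg_right (mul_le_mul_of_nonneg_left
          (neg_le_abs (∑ i, (x i - c i) * pd i U x)) (hζ0 x)) hρ
        rw [hFk, Set.indicator_of_mem hxb]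
        have h2 : gradSq U x = ∑ i, pd i U x ^ 2 := rfl
        rw [h2]
        linarith
    have hsecond : -(U x * (∑ i, (x i - c i) * pd i ζ x) * regSq c e x ^ (-(n / 2 : ℝ)))
        ≤ M * D * G * (r ^ 2) ^ (-(n / 2 : ℝ)) * χ x ^ 2 := by
      rcases hgr x with h0 | ⟨hrx, hχx⟩
      · have : ∀ i, pd i ζ x = 0 := fun i => by
          have := (Finset.sum_eq_zero_iff_of_nonneg (fun i _ => sq_nonneg (pd i ζ x))).1 h0 i
            (Finset.mem_univ i)
          simpa using this
        simp only [this, mul_zero, Finset.sum_const_zero, zero_mul, neg_zero]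
        positivity
      · have hxχ : x ∈ tsupport χ := subset_tsupport _ (by simp [hχx])
        have hxV := hχV hxχ
        have h1 : |∑ i, (x i - c i) * pd i ζ x| ≤ D * G := by
          refine abs_sum_mul_le hD.le hG ?_ (hζG x)
          rw [← norm_sub_sq_eq_sum]
          exact pow_le_pow_left₀ (norm_nonneg _) (hVD x hxV) 2
        have h2 : regSq c e x ^ (-(n / 2 : ℝ)) ≤ (r ^ 2) ^ (-(n / 2 : ℝ)) :=
          Real.rpow_le_rpow_of_nonpos (by positivity)
            ((pow_le_pow_left₀ hr.le hrx 2).trans (norm_sq_le_regSq c e x)) (by linarith)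
        have h3 : |U x * (∑ i, (x i - c i) * pd i ζ x)| ≤ M * (D * G) := by
          rw [abs_mul, abs_of_nonneg (hU0 x hxV)]
          exact mul_le_mul (hUM x hxχ) h1 (abs_nonneg _) hM
        calc _ ≤ |U x * (∑ i, (x i - c i) * pd i ζ x)| * regSq c e x ^ (-(n / 2 : ℝ)) := by
              rw [← neg_mul]
              exact mul_le_mul_of_nonneg_right (neg_le_abs _) hρ
          _ ≤ M * (D * G) * (r ^ 2) ^ (-(n / 2 : ℝ)) := mul_le_mul h3 h2 hρ (by positivity)
          _ = _ := by rw [hχx]; ring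
    rw [hpd]
    linarith
  have i1 : Integrable (fun x => regSq c e x ^ (-t) * ζ x ^ 2 * gradSq U x) := by
    have := crho (-t)
    exact integrable_of_zero_off_tsupport (by fun_prop) hζc fun x hx => by simp [hz x hx]
  have i2 : Integrable Fk :=
    (((crho _).continuousOn.integrableOn_compact (isCompact_closedBall c (D + 1))).mono_set
      Metric.ball_subset_closedBall).integrable_indicator Metric.isOpen_ball.measurableSet
  have i3 : Integrable (fun x => χ x ^ 2) :=
    integrable_of_zero_off_tsupport (by fun_prop) hχc fun x hx => by
      simp [image_eq_zero_of_notMem_tsupport hx]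
  have i4 : Integrable (fun x => -((∑ i, (x i - c i) * pd i φ x) * regSq c e x ^ (-(n / 2 : ℝ)))) := by
    have c1 := crho (-(n / 2 : ℝ))
    have c2 : ∀ i, Continuous (pd i φ) := fun i => continuous_pd hφ1 i
    exact integrable_of_zero_off_tsupport (by fun_prop) hφc fun x hx => by
      simp [pd_eq_zero_of_notMem_tsupport hx]
  have i5 : Integrable (fun x => χ x ^ 2 * gradSq U x) :=
    integrable_of_zero_off_tsupport (by fun_prop) hχc fun x hx => by
      simp [image_eq_zero_of_notMem_tsupport hx]
  have i12 : Integrable (fun x => 1 / 2 * (regSq c e x ^ (-t) * ζ x ^ 2 * gradSq U x)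
      + 1 / 2 * Fk x) := (i1.const_mul _).add (i2.const_mul _)
  have hup := integral_mono i4 (i12.add (i3.const_mul (M * D * G * (r ^ 2) ^ (-(n / 2 : ℝ))))) hpt
  have hup' : ∫ x, (1 / 2 * (regSq c e x ^ (-t) * ζ x ^ 2 * gradSq U x) + 1 / 2 * Fk x
        + M * D * G * (r ^ 2) ^ (-(n / 2 : ℝ)) * χ x ^ 2)
      = 1 / 2 * (∫ x, regSq c e x ^ (-t) * ζ x ^ 2 * gradSq U x) + 1 / 2 * (∫ x, Fk x)
        + M * D * G * (r ^ 2) ^ (-(n / 2 : ℝ)) * I1 := by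
    rw [integral_add i12 (i3.const_mul _), integral_add (i1.const_mul _) (i2.const_mul _),
      integral_const_mul, integral_const_mul, integral_const_mul]
  have hFI : ∫ x, Fk x ≤ K2 := by
    rw [hFk, integral_indicator Metric.isOpen_ball.measurableSet]
    exact hK2 c e he
  have hweight := hC Ω V f u U ζ χ c e h hζ hζc hζV hζ0 hζ1 cχ hχc hVD
    (fun x => (hgr x).imp id fun h => ⟨hζG x, h.1, h.2⟩) he he1
  have hζI : ∫ x, regSq c e x ^ (-t) * ζ x ^ 2 ≤ K1 := by
    refine (integral_mul_le_integral_ball cζ (fun x => ?_) (fun x hx => ?_) (crho _)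
      fun x => Real.rpow_nonneg (hw0 x).le _).trans (hK1 c e he)
    · rw [abs_of_nonneg (hζ0 x)]; exact hζ1 x
    · rw [Metric.mem_ball, dist_eq_norm]
      linarith [hVD x (hzV x hx)]
  have hcac := integral_sq_mul_gradSq_le hχ hχc hU (fun x hx => hU0 x (hχV hx)) hUM hUB
  have hχI : ∫ x, χ x ^ 2 * (gradSq U x + 1) ≤ I2 + I1 := by
    simp only [mul_add, mul_one]
    rw [integral_add i5 i3]
    linarith
  have hCχ := mul_le_mul_of_nonneg_left hχI hC0
  have hfin : U c / 2 * κ ≤ T := by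
    rw [hrep] at hlow
    have := hlow.trans (hup.trans_eq hup')
    rw [hT]
    linarith
  rw [div_lt_iff₀ hκ0] at hUcT
  linarith

end PointwiseBound

section BoundaryLayers

variable {n : ℕ}

lemma exists_cutoff {K O : Set (Euc n)} (hK : IsCompact K) (hO : IsOpen O) (hKO : K ⊆ O) :
    ∃ ζ : Euc n → ℝ, ContDiff ℝ 2 ζ ∧ HasCompactSupport ζ ∧ tsupport ζ ⊆ O ∧ (∀ x, 0 ≤ ζ x) ∧
      (∀ x, ζ x ≤ 1) ∧ ∀ x ∈ K, ∀ᶠ y in nhds x, ζ y = 1 := by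
  obtain ⟨L, hL, hKL, hLO⟩ := exists_compact_between hK hO hKO
  obtain ⟨f, hf1, hf0, hf⟩ := exists_contMDiffMap_one_nhds_of_subset_interior (n := 2)
    (modelWithCornersSelf ℝ (Euc n)) hK.isClosed hKL
  have hsub : tsupport f ⊆ L := closure_minimal
    (fun x hx => by_contra fun h => hx (hf0 x h)) hL.isClosed
  exact ⟨f, contMDiff_iff_contDiff.1 f.contMDiff, hL.of_isClosed_subset (isClosed_tsupport _) hsub,
    hsub.trans hLO, fun x => (hf x).1, fun x => (hf x).2,
    fun x hx => hf1.filter_mono (nhds_le_nhdsSet hx)⟩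

lemma gradSq_eq_zero_of_eventually {ζ : Euc n → ℝ} {x : Euc n} {a : ℝ}
    (h : ∀ᶠ y in nhds x, ζ y = a) : gradSq ζ x = 0 := by
  have h' : ζ =ᶠ[nhds x] fun _ => a := h
  refine Finset.sum_eq_zero fun i _ => ?_
  rw [pd_congr h']
  simp [pd]

lemma isOpen_layer {Ω : Set (Euc n)} (hΩ : IsOpen Ω) (I : Set ℝ) (hI : IsOpen I) :
    IsOpen {x ∈ Ω | Metric.infDist x (frontier Ω) ∈ I} :=
  hΩ.inter (hI.preimage (Metric.continuous_infDist_pt _))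

lemma isCompact_layer {Ω : Set (Euc n)} (hΩ : Bornology.IsBounded Ω) (I : Set ℝ)
    (hI : IsClosed I) : IsCompact {x ∈ closure Ω | Metric.infDist x (frontier Ω) ∈ I} :=
  hΩ.isCompact_closure.inter_right (hI.preimage (Metric.continuous_infDist_pt _))

lemma mem_of_infDist_frontier_pos {Ω : Set (Euc n)} (hΩ : IsOpen Ω) {x : Euc n}
    (hx : x ∈ closure Ω) (h : 0 < Metric.infDist x (frontier Ω)) : x ∈ Ω := by
  by_contra hcon
  have : x ∈ frontier Ω := by rw [hΩ.frontier_eq]; exact ⟨hx, hcon⟩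
  exact h.ne' (Metric.infDist_zero_of_mem this)

lemma frontier_nonempty {Ω : Set (Euc n)} (hn : n ≠ 0) (hb : Bornology.IsBounded Ω)
    (hne : Ω.Nonempty) : (frontier Ω).Nonempty := by
  have : Nontrivial (Euc n) := by
    have : Nonempty (Fin n) := ⟨⟨0, Nat.pos_of_ne_zero hn⟩⟩
    exact inferInstanceAs (Nontrivial (EuclideanSpace ℝ (Fin n)))
  refine nonempty_frontier_iff.2 ⟨hne, fun h => ?_⟩
  rw [h] at hb
  exact NormedSpace.unbounded_univ ℝ (Euc n) hb

/-- Semi-stable positive solutions with a common bound on the nonlinearity and on the `L¹` norm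
are uniformly bounded. -/
lemma exists_uniform_bound (hn : n = 2 ∨ n = 3 ∨ n = 4) {Ω : Set (Euc n)}
    (hΩ : IsSmoothBoundedDomain Ω) (hconv : n = 2 ∨ Convex ℝ Ω) {A : ℝ → ℝ}
    (S : ℝ) :
    ∃ K : ℝ, ∀ f u, ContDiff ℝ 1 f → PositiveSolution Ω f u → IsSemiStable Ω f u →
      (∀ s, 0 ≤ s → f s ≤ A s) → ∫ x in Ω, u x ≤ S → ∀ x ∈ Ω, u x ≤ K := by
  obtain ⟨R, hR, hball⟩ := hΩ.exists_touchingBalls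
  obtain ⟨ho, hbd, hne, -⟩ := hΩ
  have hfr := frontier_nonempty (by omega) hbd hne
  obtain ⟨D0, hD0⟩ := Metric.isBounded_iff.1 hbd
  set D := max R D0 with hDdef
  have hDpos : 0 < D := hR.trans_le (le_max_left _ _)
  have hD : ∀ x ∈ Ω, ∀ y ∈ Ω, ‖y - x‖ ≤ D := fun x hx y hy => by
    rw [← dist_eq_norm]; exact (hD0 hy hx).trans (le_max_right _ _)
  set v := volume.real (Metric.ball (0 : Euc n) (R ^ 2 / (2048 * D))) with hv
  have hv0 : 0 < v := ENNReal.toReal_pos (Metric.measure_ball_pos _ _ (by positivity)).ne'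
    measure_ball_lt_top.ne
  set M := max 0 (S / v) with hM
  have hM0 : 0 ≤ M := le_max_left _ _
  set d : Euc n → ℝ := fun x => Metric.infDist x (frontier Ω) with hd
  set δ := R / 64 with hδ
  have hδ0 : 0 < δ := by positivity
  have hmem : ∀ x ∈ closure Ω, 0 < d x → x ∈ Ω := fun x => mem_of_infDist_frontier_pos ho
  obtain ⟨θ, hθ, hθc, hθs, -, -, hθ1⟩ := exists_cutoff
    (isCompact_layer hbd (Set.Ici (δ / 8)) isClosed_Ici) ho
    fun x hx => hmem x hx.1 ((by positivity : 0 < δ / 8).trans_le hx.2)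
  set V := {x ∈ Ω | d x ∈ Set.Ioi (δ / 8)} with hV
  obtain ⟨ζ, hζ, hζc, hζs, hζ0, hζ1, hζ2⟩ := exists_cutoff
    (isCompact_layer hbd (Set.Ici (δ / 2)) isClosed_Ici) (isOpen_layer ho (Set.Ioi (δ / 4))
    isOpen_Ioi) fun x hx => ⟨hmem x hx.1 ((by positivity : 0 < δ / 2).trans_le hx.2),
      (by linarith : δ / 4 < δ / 2).trans_le hx.2⟩
  obtain ⟨χ, hχ, hχc, hχs, -, -, hχ1⟩ := exists_cutoff
    (isCompact_layer hbd (Set.Icc (δ / 4) (δ / 2)) isClosed_Icc)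
    (isOpen_layer ho (Set.Ioo (δ / 8) δ) isOpen_Ioo) fun x hx =>
    ⟨hmem x hx.1 ((by positivity : 0 < δ / 4).trans_le hx.2.1),
      (by linarith : δ / 8 < δ / 4).trans_le hx.2.1, hx.2.2.trans_lt (by linarith)⟩
  obtain ⟨K, hK⟩ := exists_interior_bound hn hDpos (r := δ / 2) (B := A M) (by positivity) hM0
    (hζ.of_le (by norm_num)) hζc hζ0 hζ1 (hχ.of_le (by norm_num)) hχc
  refine ⟨max M K, fun f u hf hu hst hfA hS x hx => ?_⟩
  have hstrip : ∀ y ∈ Ω, d y ≤ δ → u y ≤ M := fun y hy hyd => by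
    have := hu.mul_volume_le_integral hconv hR (le_max_left _ _) hD hball hfr hy hyd
    exact ((le_div_iff₀ hv0).2 (this.trans hS)).trans (le_max_right _ _)
  rcases le_or_gt (d x) δ with hxd | hxd
  · exact (hstrip x hx hxd).trans (le_max_left _ _)
  set U : Euc n → ℝ := fun y => θ y * u y with hU
  have hVU : ∀ y ∈ V, u =ᶠ[nhds y] U := fun y hy => by
    filter_upwards [hθ1 y ⟨subset_closure hy.1, Set.mem_Ici.2 (le_of_lt hy.2)⟩] with z hz
    simp [hU, hz]
  have hU2 : ContDiff ℝ 2 U := contDiff_iff_contDiffAt.2 fun y => by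
    by_cases hy : y ∈ tsupport θ
    · exact hθ.contDiffAt.mul (hu.contDiffAt y (subset_closure (hθs hy)))
    · have h0 : U =ᶠ[nhds y] fun _ => 0 := by
        filter_upwards [notMem_tsupport_iff_eventuallyEq.1 hy] with z hz
        simp [hU, hz]
      exact contDiffAt_const.congr_of_eventuallyEq h0
  have hVeq : ∀ y ∈ V, lapl U y + f (U y) = 0 := fun y hy => by
    rw [← lapl_congr (hVU y hy), ← (hVU y hy).eq_of_nhds]
    exact hu.equation y hy.1
  have hmodel : StableModel Ω V f u U :=
    ⟨ho, fun y hy => hy.1, hf, hu.mono, hst, fun y hy => (hVU y hy).eq_of_nhds, hU2,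
      hθc.mul_right, hVeq⟩
  have hχV : tsupport χ ⊆ V := fun y hy => ⟨(hχs hy).1, (hχs hy).2.1⟩
  have hχM : ∀ y ∈ tsupport χ, U y ≤ M := fun y hy => by
    rw [← (hVU y (hχV hy)).eq_of_nhds]
    exact hstrip y (hχs hy).1 (hχs hy).2.2.le
  have hU0 : ∀ y ∈ V, 0 ≤ U y := fun y hy => by
    rw [← (hVU y hy).eq_of_nhds]
    exact (hu.pos y hy.1).le
  have hζV : tsupport ζ ⊆ V := fun y hy =>
    ⟨(hζs hy).1, (by linarith : δ / 8 < δ / 4).trans (hζs hy).2⟩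
  have hxV : x ∈ V := ⟨hx, (by linarith : δ / 8 < δ).trans hxd⟩
  have key := hK Ω V f u U x hmodel hζV (fun y hy => hD x hx y hy.1) (fun y => ?_)
    (hζ2 x ⟨subset_closure hx, (by linarith : δ / 2 ≤ δ).trans hxd.le⟩) hU0 hχV hχM (fun y hy => ?_)
  · rw [← (hVU x hxV).eq_of_nhds] at key
    exact key.trans (le_max_right _ _)
  · by_cases hy : y ∈ tsupport ζ
    · obtain ⟨hyΩ, hyd⟩ := hζs hy
      rcases le_or_gt (δ / 2) (d y) with h | h
      · exact Or.inl (gradSq_eq_zero_of_eventually (hζ2 y ⟨subset_closure hyΩ, h⟩))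
      · refine Or.inr ⟨?_, (hχ1 y ⟨subset_closure hyΩ, le_of_lt hyd, h.le⟩).self_of_nhds⟩
        have : d x ≤ d y + dist x y := Metric.infDist_le_infDist_add_dist
        rw [dist_comm, dist_eq_norm] at this
        linarith
    · exact Or.inl (gradSq_eq_zero_of_eventually (notMem_tsupport_iff_eventuallyEq.1 hy))
  · have h1 := hVeq y (hχV hy)
    have h2 := hu.nonneg _ (hU0 y (hχV hy))
    rw [show lapl U y = -f (U y) by linarith, abs_neg, abs_of_nonneg h2]
    exact (hu.mono (hχM y hy)).trans (hfA M hM0)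

lemma ae_abs_le_of_tendsto {Ω : Set (Euc n)} (hΩ : MeasurableSet Ω) {u : ℕ → Euc n → ℝ}
    {v : Euc n → ℝ} (hu : ∀ k, IntegrableOn (u k) Ω) (hv : IntegrableOn v Ω)
    (h : Tendsto (fun k => ∫ x in Ω, |u k x - v x|) atTop (nhds 0)) {M : ℝ}
    (hM : ∀ k, ∀ x ∈ Ω, |u k x| ≤ M) : ∀ᵐ x ∂(volume.restrict Ω), |v x| ≤ M := by
  have hp : Integrable (fun x => max (|v x| - M) 0) (volume.restrict Ω) := by
    refine hv.abs.mono' (((hv.abs.aestronglyMeasurable.sub aestronglyMeasurable_const)).sup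
      aestronglyMeasurable_const) ?_
    filter_upwards [ae_restrict_mem hΩ] with x hx
    have := (abs_nonneg _).trans (hM 0 x hx)
    rw [Real.norm_of_nonneg (le_max_right _ _)]
    exact max_le (by linarith) (abs_nonneg _)
  have hle : ∀ k, ∫ x in Ω, max (|v x| - M) 0 ≤ ∫ x in Ω, |u k x - v x| := fun k => by
    refine setIntegral_mono_on hp ((hu k).sub hv).abs hΩ fun x hx => max_le ?_ (abs_nonneg _)
    have h1 := hM k x hx
    have h2 := abs_sub_abs_le_abs_sub (v x) (u k x)
    rw [abs_sub_comm] at h2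
    linarith
  have h0 : ∫ x in Ω, max (|v x| - M) 0 = 0 :=
    le_antisymm (ge_of_tendsto' h hle) (integral_nonneg fun x => le_max_right _ _)
  filter_upwards [(integral_eq_zero_iff_of_nonneg (fun x => le_max_right _ _) hp).1 h0] with x hx
  have hx' : max (|v x| - M) 0 = 0 := hx
  have := le_max_left (|v x| - M) 0
  linarith

end BoundaryLayers

/-- Boundedness of the extremal solution `u*` in dimensions
`2 ≤ n ≤ 4` (convex domain for `n ∈ {3,4}`): the `L¹` limit of an increasing
sequence of classical positive semi-stable solutions of `−Δu = λ_k g(u)` which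
is a weak solution for `λ*` is bounded. -/
theorem extremal_solution_bounded
    (n : ℕ) (hn : n ∈ ({2, 3, 4} : Set ℕ))
    (Ω : Set (EuclideanSpace ℝ (Fin n))) (hΩ : IsSmoothBoundedDomain Ω)
    (hconv : n ∈ ({3, 4} : Set ℕ) → Convex ℝ Ω)
    (g : ℝ → ℝ) (hg1 : ContDiff ℝ 1 g) (hgmono : Monotone g) (hg0 : 0 < g 0)
    (hgsuper : Tendsto (fun s : ℝ => g s / s) atTop atTop)
    (lam : ℕ → ℝ) (lamStar : ℝ) (hlampos : ∀ k, 0 < lam k) (hlammono : Monotone lam)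
    (hlamlim : Tendsto lam atTop (nhds lamStar)) (hlamStar : 0 < lamStar)
    (u : ℕ → EuclideanSpace ℝ (Fin n) → ℝ)
    (hsol : ∀ k, IsClassicalSol Ω (fun s => lam k * g s) (u k))
    (hstab : ∀ k, IsSemiStable Ω (fun s => lam k * g s) (u k))
    (hpos : ∀ k, ∀ x ∈ Ω, 0 < u k x)
    (hmono : ∀ k, ∀ x ∈ Ω, u k x ≤ u (k + 1) x)
    (uStar : EuclideanSpace ℝ (Fin n) → ℝ)
    (hweak : IsWeakSol Ω (fun s => lamStar * g s) uStar)
    (hL1 : Tendsto (fun k => ∫ x in Ω, |u k x - uStar x|) atTop (nhds 0)) :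
    ∃ M : ℝ, ∀ᵐ x ∂(volume.restrict Ω), |uStar x| ≤ M := by
  have hn' : n = 2 ∨ n = 3 ∨ n = 4 := by simpa using hn
  have hconv' : n = 2 ∨ Convex ℝ Ω := hn'.imp_right fun h => hconv (by simpa using h)
  have hgpos : ∀ s, 0 ≤ s → 0 ≤ g s := fun s hs => hg0.le.trans (hgmono hs)
  have hpsol : ∀ k, PositiveSolution Ω (fun s => lam k * g s) (u k) := fun k => by
    obtain ⟨⟨W, hW, hΩW, hu⟩, heq, hfr⟩ := hsol k
    exact ⟨hΩ.1, hΩ.2.1, fun x hx => hu.contDiffAt (hW.mem_nhds (hΩW hx)), hfr, hpos k, heq,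
      hgmono.const_mul (hlampos k).le, fun s hs => mul_nonneg (hlampos k).le (hgpos s hs)⟩
  have hint : ∀ k, IntegrableOn (u k) Ω := fun k => (hpsol k).integrableOn
  obtain ⟨C, hC⟩ := hL1.bddAbove_range
  have hS : ∀ k, ∫ x in Ω, u k x ≤ C + ∫ x in Ω, uStar x := fun k => by
    have h1 : ∫ x in Ω, (u k x - uStar x) ≤ ∫ x in Ω, |u k x - uStar x| :=
      integral_mono ((hint k).sub hweak.1) ((hint k).sub hweak.1).abs fun x => le_abs_self _
    rw [integral_sub (hint k) hweak.1] at h1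
    linarith [hC (Set.mem_range_self k)]
  obtain ⟨K, hK⟩ := exists_uniform_bound hn' hΩ hconv' (A := fun s => lamStar * g s)
    (C + ∫ x in Ω, uStar x)
  refine ⟨K, ae_abs_le_of_tendsto hΩ.1.measurableSet hint hweak.1 hL1 fun k x hx => ?_⟩
  rw [abs_of_pos (hpos k x hx)]
  exact hK _ (u k) (contDiff_const.mul hg1) (hpsol k) (hstab k)
    (fun s hs => mul_le_mul_of_nonneg_right (hlammono.ge_of_tendsto hlamlim k) (hgpos s hs))
    (hS k) x hx
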